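/- Let μ ∈ 𝓜 with distribution function α, let 0 ≤ s ≤ t ≤ 1 and x ∈ ℝ, and let X be the continuous (𝓕_r)-adapted process satisfying X(r) = x + ∫_s^r α(v)ζ(v) ∂_x Φ_μ(v, X(v)) dv + W(r) − W(s) for r ∈ [s,t]. Then the process ( ∂_{xx} Φ_μ(r, X(r)) + ∫_s^r α(v)ζ(v) (∂_{xx} Φ_μ(v, X(v)))² dv )_{s ≤ r ≤ t} is a continuous (𝓕_r)-martingale; in particular, for all s ≤ a ≤ b ≤ t, E[ ∂_{xx} Φ_μ(b, X(b)) − ∂_{xx} Φ_μ(a, X(a)) ] = − E[ ∫_a^b α(r)ζ(r) (∂_{xx} Φ_μ(r, X(r)))² dr ]. -/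

import Mathlib

open MeasureTheory ProbabilityTheory Real Set Filter

noncomputable section

/-- `ξ(s) = ∑_{p≥2} β_p² s^p` (we use `β : ℕ → ℝ` with `β 0 = β 1 = 0`). -/
def xiFn (β : ℕ → ℝ) (s : ℝ) : ℝ := ∑' p : ℕ, β p ^ 2 * s ^ p

/-- `ξ'(s)`. -/
def xiD (β : ℕ → ℝ) (s : ℝ) : ℝ := ∑' p : ℕ, (p : ℝ) * β p ^ 2 * s ^ (p - 1)

/-- `ζ(s) = ξ''(s)`. -/
def zetaFn (β : ℕ → ℝ) (s : ℝ) : ℝ :=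
  ∑' p : ℕ, (p : ℝ) * ((p : ℝ) - 1) * β p ^ 2 * s ^ (p - 2)

/-- admissible sequence of temperature parameters -/
def ValidBeta (β : ℕ → ℝ) : Prop :=
  β 0 = 0 ∧ β 1 = 0 ∧ (∀ p, 0 ≤ β p) ∧ (∃ p, 2 ≤ p ∧ 0 < β p) ∧
    Summable fun p : ℕ => (2 : ℝ) ^ p * β p ^ 2

/-- membership in `𝓜`: a Borel probability measure concentrated on `[0,1]` -/
def MemM (μ : Measure ℝ) : Prop := IsProbabilityMeasure μ ∧ μ (Icc (0 : ℝ) 1)ᶜ = 0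

/-- member of `𝓜_d`: finitely supported -/
def FinSupp (μ : Measure ℝ) : Prop := ∃ S : Finset ℝ, μ ((S : Set ℝ))ᶜ = 0

/-- the distribution function `α(s) = μ([0,s])` -/
def distF (μ : Measure ℝ) (s : ℝ) : ℝ := (μ (Icc 0 s)).toReal

/-- the metric `d(μ,ν) = ∫_0^1 |μ([0,s]) - ν([0,s])| ds` -/
def dM (μ ν : Measure ℝ) : ℝ := ∫ s in (0 : ℝ)..1, |distF μ s - distF ν s|

/-- the smallest atom of `μ` strictly after `s` (or `1` if there is none) -/
def nextPt (μ : Measure ℝ) (s : ℝ) : ℝ :=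
  sInf ({q : ℝ | s < q ∧ q ≤ 1 ∧ μ {q} ≠ 0} ∪ {1})

/-- one step of the backward recursion defining the Parisi PDE solution:
`(1/m) log E exp (m Φ(t, x + z √(ξ'(t) - ξ'(s))))`, interpreted as
`E Φ(t, x + z √(ξ'(t) - ξ'(s)))` when `m = 0`. -/
def gStep (β : ℕ → ℝ) (Φ : ℝ → ℝ → ℝ) (m t s x : ℝ) : ℝ :=
  if m = 0 then ∫ z, Φ t (x + z * Real.sqrt (xiD β t - xiD β s)) ∂(gaussianReal 0 1)
  else m⁻¹ * Real.log
    (∫ z, Real.exp (m * Φ t (x + z * Real.sqrt (xiD β t - xiD β s))) ∂(gaussianReal 0 1))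

/-- `Φ` is the Parisi PDE solution of a finitely supported `μ`. -/
def IsAtomicSol (β : ℕ → ℝ) (μ : Measure ℝ) (Φ : ℝ → ℝ → ℝ) : Prop :=
  (∀ x : ℝ, Φ 1 x = Real.log (Real.cosh x)) ∧
  (∀ s ∈ Ico (0 : ℝ) 1, ∀ x : ℝ, Φ s x = gStep β Φ (distF μ s) (nextPt μ s) s x)

/-- `Φ` is the Parisi family `μ ↦ Φ_μ`: it satisfies the backward recursion on `𝓜_d`
and is `d`-continuous on `𝓜` (uniformly in `(s,x) ∈ [0,1] × ℝ`). -/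
def IsParisiFamily (β : ℕ → ℝ) (Φ : Measure ℝ → ℝ → ℝ → ℝ) : Prop :=
  (∀ μ, MemM μ → FinSupp μ → IsAtomicSol β μ (Φ μ)) ∧
  (∀ μ, MemM μ → ∀ ε : ℝ, 0 < ε → ∃ δ : ℝ, 0 < δ ∧ ∀ ν, MemM ν → dM μ ν < δ →
      ∀ s ∈ Icc (0 : ℝ) 1, ∀ x : ℝ, |Φ μ s x - Φ ν s x| < ε)

/-- `B` is a standard Brownian motion under `P`. -/
def IsStdBM {Ω : Type*} [MeasurableSpace Ω] (P : Measure Ω) (B : ℝ → Ω → ℝ) : Prop :=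
  (∀ t : ℝ, Measurable (B t)) ∧
  (∀ᵐ ω ∂P, B 0 ω = 0) ∧
  (∀ᵐ ω ∂P, Continuous fun t => B t ω) ∧
  (∀ s t : ℝ, 0 ≤ s → s ≤ t →
    Measure.map (fun ω => B t ω - B s ω) P = gaussianReal 0 (Real.toNNReal (t - s))) ∧
  (∀ s t : ℝ, 0 ≤ s → s ≤ t →
    Indep (MeasurableSpace.comap (fun ω => B t ω - B s ω) inferInstance)
      (⨆ v ∈ Icc (0 : ℝ) s, MeasurableSpace.comap (B v) inferInstance) P)

/-- the space `𝓓[s,t]`: progressively measurable processes bounded by `1` on `[s,t]` -/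
def InD {Ω : Type*} {mΩ : MeasurableSpace Ω} (𝓕 : Filtration ℝ mΩ) (s t : ℝ)
    (u : ℝ → Ω → ℝ) : Prop :=
  ProgMeasurable 𝓕 u ∧ ∀ r ∈ Icc s t, ∀ ω, |u r ω| ≤ 1

/-- the norm `‖u‖ = (E ∫_s^t u(r)² dr)^{1/2}` on `𝓓[s,t]` -/
def normD {Ω : Type*} [MeasurableSpace Ω] (P : Measure Ω) (s t : ℝ)
    (u : ℝ → Ω → ℝ) : ℝ :=
  Real.sqrt (∫ ω, (∫ r in s..t, (u r ω) ^ 2) ∂P)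

/-- the functional
`F^{s,t}(u,x) = E[Φ_μ(t, x + ∫_s^t α ζ u dr + W(t) - W(s)) - (1/2)∫_s^t α ζ u² dr]`,
where `W r = B (ξ' r)`. -/
def Ffn {Ω : Type*} [MeasurableSpace Ω] (P : Measure Ω) (β : ℕ → ℝ) (μ : Measure ℝ)
    (Φ : ℝ → ℝ → ℝ) (W : ℝ → Ω → ℝ) (s t : ℝ) (u : ℝ → Ω → ℝ) (x : ℝ) : ℝ :=
  ∫ ω, (Φ t (x + (∫ r in s..t, distF μ r * zetaFn β r * u r ω) + (W t ω - W s ω))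
      - (1 / 2) * ∫ r in s..t, distF μ r * zetaFn β r * (u r ω) ^ 2) ∂P

section
open MeasureTheory ProbabilityTheory Real Set Filter
open scoped Topology NNReal ENNReal

namespace Parisi

/-- the standard Gaussian -/
abbrev γ : Measure ℝ := gaussianReal 0 1

lemma int_exp (k : ℕ) (c : ℝ) : Integrable (fun z : ℝ => |z| ^ k * exp (c * |z|)) γ := by
  have h := integrable_pow_abs_mul_exp_add_of_integrable_exp_mul (μ := γ) (X := fun z : ℝ => z)
    (v := 0) (t := |c| + 1) (x := |c|) (by simpa using integrable_exp_mul_gaussianReal (|c|+1))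
    (by simpa using integrable_exp_mul_gaussianReal (-(|c|+1))) (abs_nonneg c)
    (by rw [abs_of_pos (show 0 < |c| + 1 by positivity)]; linarith) k
  refine h.mono' (by fun_prop) (ae_of_all _ fun z => ?_)
  rw [Real.norm_eq_abs, abs_of_nonneg (by positivity)]
  gcongr
  nlinarith [abs_nonneg z, le_abs_self c]

lemma int_exp0 (c : ℝ) : Integrable (fun z : ℝ => exp (c * |z|)) γ := by
  simpa using int_exp 0 c

/-- exponential moments -/
def Cm (c : ℝ) (k : ℕ) : ℝ := ∫ z, |z| ^ k * exp (c * |z|) ∂γ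

lemma Cm_nonneg (c : ℝ) (k : ℕ) : 0 ≤ Cm c k := integral_nonneg fun z => by positivity

lemma int_of_exp {G : ℝ → ℝ} (hG : Continuous G) {C : ℝ} (hC : ∀ y, |G y| ≤ C * exp |y|) (x σ : ℝ) :
    Integrable (fun z => G (x + z * σ)) γ := by
  refine ((int_exp0 |σ|).const_mul (|C| * exp |x|)).mono' (by fun_prop) (ae_of_all _ fun z => ?_)
  rw [Real.norm_eq_abs]
  calc |G (x + z * σ)| ≤ C * exp |x + z * σ| := hC _
    _ ≤ |C| * exp |x + z * σ| := by gcongr; exact le_abs_self C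
    _ ≤ |C| * exp (|x| + |σ| * |z|) := by
        gcongr
        calc |x + z * σ| ≤ |x| + |z * σ| := abs_add_le _ _
          _ = _ := by rw [abs_mul, mul_comm]
    _ = _ := by rw [exp_add]; ring

lemma deriv_gauss {G G' : ℝ → ℝ} (hd : ∀ y, HasDerivAt G (G' y) y) (hG' : Continuous G') {C C' : ℝ}
    (hC : ∀ y, |G y| ≤ C * exp |y|) (hC' : ∀ y, |G' y| ≤ C' * exp |y|) (σ x : ℝ) :
    HasDerivAt (fun x => ∫ z, G (x + z * σ) ∂γ) (∫ z, G' (x + z * σ) ∂γ) x := by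
  have hG : Continuous G := continuous_iff_continuousAt.2 fun y => (hd y).continuousAt
  refine (hasDerivAt_integral_of_dominated_loc_of_deriv_le (s := Metric.ball x 1)
    (F := fun x z => G (x + z * σ)) (F' := fun x z => G' (x + z * σ))
    (bound := fun z => |C'| * exp (|x| + 1) * exp (|σ| * |z|)) (Metric.ball_mem_nhds x one_pos)
    (Eventually.of_forall fun y => by fun_prop) (int_of_exp hG hC x σ) (by fun_prop)
    (ae_of_all _ fun z y hy => ?_) ((int_exp0 |σ|).const_mul _) (ae_of_all _ fun z y hy => ?_)).2
  · rw [Real.norm_eq_abs]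
    have hy' : |y| ≤ |x| + 1 := by
      have : |y - x| < 1 := by simpa [Real.dist_eq] using hy
      have := abs_sub_abs_le_abs_sub y x
      linarith
    calc |G' (y + z * σ)| ≤ C' * exp |y + z * σ| := hC' _
      _ ≤ |C'| * exp |y + z * σ| := by gcongr; exact le_abs_self C'
      _ ≤ |C'| * exp (|x| + 1 + |σ| * |z|) := by
          gcongr
          calc |y + z * σ| ≤ |y| + |z * σ| := abs_add_le _ _
            _ ≤ _ := by rw [abs_mul, mul_comm |z|]; gcongr
      _ = _ := by rw [exp_add]; ring
  · exact (hd (y + z * σ)).comp_add_const y (z * σ)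

/-- Cameron-Martin in dimension one -/
lemma cameron (g : ℝ → ℝ) (θ : ℝ) :
    ∫ z, g (z + θ) ∂γ = ∫ z, g z * (exp (θ * z) * exp (-(θ ^ 2 / 2))) ∂γ := by
  rw [integral_gaussianReal_eq_integral_smul one_ne_zero,
    integral_gaussianReal_eq_integral_smul one_ne_zero,
    ← integral_add_right_eq_self (fun x => gaussianPDFReal 0 1 x •
      (g x * (exp (θ * x) * exp (-(θ ^ 2 / 2))))) θ]
  congr 1
  ext z
  simp only [gaussianPDFReal_def, smul_eq_mul]
  rw [← exp_add]
  have : rexp (-(z - 0) ^ 2 / (2 * ((1:ℝ≥0):ℝ))) = rexp (-(z + θ - 0) ^ 2 / (2 * ((1:ℝ≥0):ℝ)))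
     * rexp (θ * (z + θ) + -(θ ^ 2 / 2)) := by
    rw [← exp_add]; congr 1; simp; ring
  rw [this]; ring

lemma gauss_exp (θ : ℝ) : ∫ z, exp (θ * z) ∂γ = exp (θ ^ 2 / 2) := by
  have := congrFun (mgf_id_gaussianReal (μ := 0) (v := 1)) θ
  simpa [mgf] using this

lemma gauss_id : ∫ z, z ∂γ = 0 := integral_id_gaussianReal

lemma gauss_sq : ∫ z, z ^ 2 ∂γ = 1 := by
  have h := variance_fun_id_gaussianReal (μ := 0) (v := 1)
  rw [variance_eq_integral (by fun_prop)] at h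
  simpa [integral_id_gaussianReal] using h

end Parisi

end

section
open MeasureTheory ProbabilityTheory Real Set Filter
open scoped Topology NNReal ENNReal

namespace Parisi

/-- the operator `f ↦ (1/m) log E exp (m f(x + zσ))` -/
def T (f : ℝ → ℝ) (m σ x : ℝ) : ℝ :=
  if m = 0 then ∫ z, f (x + z * σ) ∂γ else m⁻¹ * Real.log (∫ z, Real.exp (m * f (x + z * σ)) ∂γ)

/-- regularity class -/
structure GC (K : ℝ) (f f1 f2 f3 : ℝ → ℝ) : Prop where
  d0 : ∀ y, HasDerivAt f (f1 y) y
  d1 : ∀ y, HasDerivAt f1 (f2 y) y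
  d2 : ∀ y, HasDerivAt f2 (f3 y) y
  c3 : Continuous f3
  b1 : ∀ y, |f1 y| ≤ 1
  p2 : ∀ y, 0 ≤ f2 y
  b2 : ∀ y, f2 y ≤ 1 - f1 y ^ 2
  b3 : ∀ y, |f3 y| ≤ K

/-- unnormalised tilted average -/
def A (f : ℝ → ℝ) (m σ : ℝ) (g : ℝ → ℝ) (x : ℝ) : ℝ :=
  ∫ z, g (x + z * σ) * exp (m * f (x + z * σ)) ∂γ

/-- normalised tilted average -/
def av (f : ℝ → ℝ) (m σ : ℝ) (g : ℝ → ℝ) (x : ℝ) : ℝ :=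
  A f m σ g x / A f m σ (fun _ => 1) x

lemma lip_of_deriv {g g' : ℝ → ℝ} (hd : ∀ y, HasDerivAt g (g' y) y) {L : ℝ} (hL : ∀ y, |g' y| ≤ L)
    (x y : ℝ) : |g x - g y| ≤ L * |x - y| := by
  have := Convex.norm_image_sub_le_of_norm_hasDerivWithin_le (f := g) (f' := g') (s := univ)
    (C := L) (x := y) (y := x) (fun x _ => (hd x).hasDerivWithinAt) (fun x _ => hL x) convex_univ
    (mem_univ _) (mem_univ _)
  simpa using this

/-- basic data for the tilt: `f` differentiable and 1-Lipschitz, `0 ≤ m ≤ 1` -/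
structure Lp (f f1 : ℝ → ℝ) (m : ℝ) : Prop where
  d0 : ∀ y, HasDerivAt f (f1 y) y
  c1 : Continuous f1
  b1 : ∀ y, |f1 y| ≤ 1
  m0 : 0 ≤ m
  m1 : m ≤ 1

namespace Lp
variable {f f1 : ℝ → ℝ} {m : ℝ}

lemma cont (h : Lp f f1 m) : Continuous f :=
  continuous_iff_continuousAt.2 fun y => (h.d0 y).continuousAt

lemma lip (h : Lp f f1 m) (x y : ℝ) : |f x - f y| ≤ |x - y| := by
  simpa using lip_of_deriv h.d0 h.b1 x y

lemma growth (h : Lp f f1 m) (y : ℝ) : |f y| ≤ (|f 0| + 1) * exp |y| := by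
  have h1 := h.lip y 0
  have h2 : |y| + 1 ≤ exp |y| := add_one_le_exp _
  have h3 := abs_sub_abs_le_abs_sub (f y) (f 0)
  rw [sub_zero] at h1
  nlinarith [abs_nonneg (f 0), abs_nonneg y]

lemma exp_growth (h : Lp f f1 m) (y : ℝ) : exp (m * f y) ≤ exp |f 0| * exp |y| := by
  rw [← exp_add]
  apply exp_le_exp.2
  have h1 := h.lip y 0
  have h3 := abs_sub_abs_le_abs_sub (f y) (f 0)
  rw [sub_zero] at h1
  have h4 : |f y| ≤ |f 0| + |y| := by linarith
  calc m * f y ≤ m * |f y| := by gcongr; exacts [h.m0, le_abs_self _]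
    _ ≤ 1 * |f y| := by gcongr; exact h.m1
    _ ≤ _ := by linarith

lemma gexp_growth (h : Lp f f1 m) {g : ℝ → ℝ} {C : ℝ} (hC : ∀ y, |g y| ≤ C) (y : ℝ) :
    |g y * exp (m * f y)| ≤ (C * exp |f 0|) * exp |y| := by
  rw [abs_mul, abs_of_pos (exp_pos _), mul_assoc]
  have : 0 ≤ C := (abs_nonneg _).trans (hC 0)
  gcongr
  · exact hC y
  · exact h.exp_growth y

lemma intA (h : Lp f f1 m) {g : ℝ → ℝ} (hg : Continuous g) {C : ℝ} (hC : ∀ y, |g y| ≤ C) (σ x : ℝ) :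
    Integrable (fun z => g (x + z * σ) * exp (m * f (x + z * σ))) γ :=
  int_of_exp (G := fun y => g y * exp (m * f y)) (by have := h.cont; fun_prop)
    (h.gexp_growth hC) x σ

lemma A1_pos (h : Lp f f1 m) (σ x : ℝ) : 0 < A f m σ (fun _ => 1) x := by
  have := h.intA (g := fun _ => 1) continuous_const (C := 1) (by simp) σ x
  simp only [one_mul] at this
  simpa [A] using integral_exp_pos this

lemma derivA (h : Lp f f1 m) {g g' : ℝ → ℝ} (hd : ∀ y, HasDerivAt g (g' y) y) (hg' : Continuous g')
    {C C' : ℝ} (hC : ∀ y, |g y| ≤ C) (hC' : ∀ y, |g' y| ≤ C') (σ x : ℝ) :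
    HasDerivAt (A f m σ g) (A f m σ (fun y => g' y + m * (g y * f1 y)) x) x := by
  have hg : Continuous g := continuous_iff_continuousAt.2 fun y => (hd y).continuousAt
  have hf := h.cont
  have hf1 := h.c1
  refine deriv_gauss (G := fun y => g y * exp (m * f y))
    (G' := fun y => (g' y + m * (g y * f1 y)) * exp (m * f y)) (fun y => ?_) (by fun_prop)
    (h.gexp_growth hC) (h.gexp_growth (C := C' + 1 * (C * 1)) fun y => ?_) σ x
  · convert! (hd y).mul ((h.d0 y).const_mul m).exp using 1
    ring
  · refine (abs_add_le _ _).trans ?_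
    rw [abs_mul, abs_mul]
    have : 0 ≤ C := (abs_nonneg _).trans (hC 0)
    gcongr
    · exact hC' y
    · rw [abs_of_nonneg h.m0]; exact h.m1
    · exact hC y
    · exact h.b1 y

lemma A_add (h : Lp f f1 m) {g k : ℝ → ℝ} (hg : Continuous g) {C : ℝ} (hC : ∀ y, |g y| ≤ C)
    (hk : Continuous k) {D : ℝ} (hD : ∀ y, |k y| ≤ D) (σ x : ℝ) :
    A f m σ (fun y => g y + k y) x = A f m σ g x + A f m σ k x := by
  unfold A
  rw [← integral_add (h.intA hg hC σ x) (h.intA hk hD σ x)]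
  simp only [add_mul]

lemma A_smul (c : ℝ) (g : ℝ → ℝ) (σ x : ℝ) :
    A f m σ (fun y => c * g y) x = c * A f m σ g x := by
  unfold A
  rw [← integral_const_mul]
  simp only [mul_assoc]

lemma av_add (h : Lp f f1 m) {g k : ℝ → ℝ} (hg : Continuous g) {C : ℝ} (hC : ∀ y, |g y| ≤ C)
    (hk : Continuous k) {D : ℝ} (hD : ∀ y, |k y| ≤ D) (σ x : ℝ) :
    av f m σ (fun y => g y + k y) x = av f m σ g x + av f m σ k x := by
  unfold av; rw [h.A_add hg hC hk hD, add_div]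

lemma av_smul (c : ℝ) (g : ℝ → ℝ) (σ x : ℝ) :
    av f m σ (fun y => c * g y) x = c * av f m σ g x := by
  unfold av; rw [A_smul, mul_div_assoc]

lemma av_const (h : Lp f f1 m) (c σ x : ℝ) : av f m σ (fun _ => c) x = c := by
  have := A_smul (f := f) (m := m) c (fun _ => 1) σ x
  simp only [mul_one] at this
  unfold av; rw [this, mul_div_assoc, div_self (h.A1_pos σ x).ne', mul_one]

lemma av_mono (h : Lp f f1 m) {g k : ℝ → ℝ} (hg : Continuous g) {C : ℝ} (hC : ∀ y, |g y| ≤ C)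
    (hk : Continuous k) {D : ℝ} (hD : ∀ y, |k y| ≤ D) (hgk : ∀ y, g y ≤ k y) (σ x : ℝ) :
    av f m σ g x ≤ av f m σ k x := by
  unfold av
  have := h.A1_pos σ x
  gcongr
  refine integral_mono (h.intA hg hC σ x) (h.intA hk hD σ x) fun z => ?_
  have := hgk (x + z * σ)
  dsimp only
  gcongr

lemma av_abs (h : Lp f f1 m) {g : ℝ → ℝ} (hg : Continuous g) {C : ℝ} (hC : ∀ y, |g y| ≤ C) (σ x : ℝ) :
    |av f m σ g x| ≤ C := by
  have h1 := h.av_mono hg hC continuous_const (fun _ => le_rfl) (fun y => (abs_le.1 (hC y)).2) σ x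
  have h2 := h.av_mono continuous_const (fun _ => le_rfl) hg hC (fun y => (abs_le.1 (hC y)).1) σ x
  rw [h.av_const] at h1 h2
  exact abs_le.2 ⟨h2, h1⟩

lemma deriv_av (h : Lp f f1 m) {g g' : ℝ → ℝ} (hd : ∀ y, HasDerivAt g (g' y) y) (hg' : Continuous g')
    {C C' : ℝ} (hC : ∀ y, |g y| ≤ C) (hC' : ∀ y, |g' y| ≤ C') (σ x : ℝ) :
    HasDerivAt (av f m σ g) (av f m σ g' x + m * (av f m σ (fun y => g y * f1 y) x
      - av f m σ g x * av f m σ f1 x)) x := by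
  have hg : Continuous g := continuous_iff_continuousAt.2 fun y => (hd y).continuousAt
  have hf1 := h.c1
  have hgf : ∀ y, |g y * f1 y| ≤ C * 1 := fun y => by
    rw [abs_mul]
    have : 0 ≤ C := (abs_nonneg _).trans (hC 0)
    gcongr
    · exact hC y
    · exact h.b1 y
  have e1 : A f m σ (fun y => g' y + m * (g y * f1 y)) x
      = A f m σ g' x + m * A f m σ (fun y => g y * f1 y) x := by
    rw [h.A_add hg' hC' (by fun_prop) (D := m * (C * 1)) (fun y => ?_), A_smul]
    rw [abs_mul, abs_of_nonneg h.m0]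
    exact mul_le_mul_of_nonneg_left (hgf y) h.m0
  have e2 : A f m σ (fun y => 0 + m * ((1:ℝ) * f1 y)) x = m * A f m σ f1 x := by
    simp only [zero_add, one_mul, A_smul]
  have hp := h.A1_pos σ x
  have h1 := h.derivA hd hg' hC hC' σ x
  have h2 := h.derivA (g := fun _ => 1) (g' := fun _ => 0) (fun y => hasDerivAt_const y 1)
    continuous_const (C := 1) (C' := 0) (by simp) (by simp) σ x
  rw [e1] at h1
  rw [e2] at h2
  convert! h1.div h2 hp.ne' using 1
  unfold av
  field_simp
  ring

end Lp

end Parisi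

end

section
open MeasureTheory ProbabilityTheory Real Set Filter
open scoped Topology NNReal ENNReal

namespace Parisi

/-- density of the tilt relative to the starting point -/
def rho (f : ℝ → ℝ) (m σ x z : ℝ) : ℝ := exp (m * (f (x + z * σ) - f x))

namespace Lp
variable {f f1 : ℝ → ℝ} {m : ℝ}

lemma contA (h : Lp f f1 m) {g : ℝ → ℝ} (hg : Continuous g) {C : ℝ} (hC : ∀ y, |g y| ≤ C) (σ : ℝ) :
    Continuous (A f m σ g) := by
  have hf := h.cont
  have hC0 : 0 ≤ C := (abs_nonneg _).trans (hC 0)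
  rw [continuous_iff_continuousAt]
  intro x
  refine continuousAt_of_dominated
    (bound := fun z => C * exp |f 0| * exp (|x| + 1) * exp (|σ| * |z|))
    (Eventually.of_forall fun y => by fun_prop) ?_ ((int_exp0 |σ|).const_mul _)
    (ae_of_all _ fun z => by fun_prop)
  filter_upwards [Metric.ball_mem_nhds x one_pos] with y hy
  refine ae_of_all _ fun z => ?_
  have hy' : |y| ≤ |x| + 1 := by
    have : |y - x| < 1 := by simpa [Real.dist_eq] using hy
    have := abs_sub_abs_le_abs_sub y x
    linarith
  calc |g (y + z * σ) * exp (m * f (y + z * σ))| ≤ C * exp |f 0| * exp |y + z * σ| :=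
        h.gexp_growth hC _
    _ ≤ C * exp |f 0| * exp (|x| + 1 + |σ| * |z|) := by
          gcongr
          calc |y + z * σ| ≤ |y| + |z * σ| := abs_add_le _ _
            _ ≤ _ := by rw [abs_mul, mul_comm |z|]; gcongr
    _ = _ := by rw [exp_add]; ring

lemma cont_av (h : Lp f f1 m) {g : ℝ → ℝ} (hg : Continuous g) {C : ℝ} (hC : ∀ y, |g y| ≤ C) (σ : ℝ) :
    Continuous (av f m σ g) :=
  (h.contA hg hC σ).div (h.contA continuous_const (C := 1) (by simp) σ)
    fun x => (h.A1_pos σ x).ne'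

lemma deriv_T (h : Lp f f1 m) (σ x : ℝ) : HasDerivAt (T f m σ) (av f m σ f1 x) x := by
  have hf := h.cont
  by_cases hm : m = 0
  · subst hm
    have := deriv_gauss h.d0 h.c1 h.growth (C' := 1) (fun y => (h.b1 y).trans (by simp)) σ x
    have e : T f 0 σ = fun x => ∫ z, f (x + z * σ) ∂γ := by
      ext y; simp [T]
    rw [e]
    simp only [av, A]
    simpa using this
  · have h2 := h.derivA (g := fun _ => 1) (g' := fun _ => 0) (fun y => hasDerivAt_const y 1)
      continuous_const (C := 1) (C' := 0) (by simp) (by simp) σ x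
    have e2 : A f m σ (fun y => 0 + m * ((1:ℝ) * f1 y)) x = m * A f m σ f1 x := by
      simp only [zero_add, one_mul, A_smul]
    rw [e2] at h2
    have h3 := (h2.log (h.A1_pos σ x).ne').const_mul m⁻¹
    have e : T f m σ = fun y => m⁻¹ * Real.log (A f m σ (fun _ => 1) y) := by
      ext y; simp [T, A, hm]
    rw [e]
    convert! h3 using 1
    unfold av
    field_simp

lemma rho_abs (h : Lp f f1 m) {σ c : ℝ} (h0 : 0 ≤ σ) (hc : σ ≤ c) (x z : ℝ) :
    |m * (f (x + z * σ) - f x)| ≤ σ * |z| := by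
  rw [abs_mul, abs_of_nonneg h.m0]
  have := h.lip (x + z * σ) x
  rw [add_sub_cancel_left, abs_mul, abs_of_nonneg h0] at this
  calc m * |f (x + z * σ) - f x| ≤ 1 * |f (x + z * σ) - f x| := by gcongr; exact h.m1
    _ ≤ _ := by linarith

lemma rho_le (h : Lp f f1 m) {σ c : ℝ} (h0 : 0 ≤ σ) (hc : σ ≤ c) (x z : ℝ) :
    rho f m σ x z ≤ exp (c * |z|) := by
  apply exp_le_exp.2
  have := le_of_abs_le (h.rho_abs h0 hc x z)
  nlinarith [abs_nonneg z]

lemma rho_cont (h : Lp f f1 m) (σ x : ℝ) : Continuous (rho f m σ x) := by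
  have hf := h.cont
  unfold rho; fun_prop

/-- functions of polynomial growth are integrable -/
lemma int_rho (h : Lp f f1 m) {σ c : ℝ} (h0 : 0 ≤ σ) (hc : σ ≤ c) (x : ℝ) {u : ℝ → ℝ}
    (hu : Continuous u) {M : ℝ} {k : ℕ} (hM : ∀ z, |u z| ≤ M * |z| ^ k) :
    Integrable (fun z => u z * rho f m σ x z) γ := by
  have hr := h.rho_cont σ x
  refine ((int_exp k c).const_mul M).mono' (by fun_prop) (ae_of_all _ fun z => ?_)
  rw [Real.norm_eq_abs, abs_mul, abs_of_pos (show 0 < rho f m σ x z from exp_pos _), ← mul_assoc]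
  exact mul_le_mul (hM z) (h.rho_le h0 hc x z) (exp_pos _).le ((abs_nonneg _).trans (hM z))

lemma abs_int_rho (h : Lp f f1 m) {σ c : ℝ} (h0 : 0 ≤ σ) (hc : σ ≤ c) (x : ℝ) {u : ℝ → ℝ}
    {M : ℝ} {k : ℕ} (hM : ∀ z, |u z| ≤ M * |z| ^ k) :
    |∫ z, u z * rho f m σ x z ∂γ| ≤ M * Cm c k := by
  rw [Cm, ← integral_const_mul, ← Real.norm_eq_abs]
  refine norm_integral_le_of_norm_le ((int_exp k c).const_mul M) (ae_of_all _ fun z => ?_)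
  rw [Real.norm_eq_abs, abs_mul, abs_of_pos (show 0 < rho f m σ x z from exp_pos _), ← mul_assoc]
  exact mul_le_mul (hM z) (h.rho_le h0 hc x z) (exp_pos _).le ((abs_nonneg _).trans (hM z))

lemma A_eq (g : ℝ → ℝ) (σ x : ℝ) :
    A f m σ g x = exp (m * f x) * ∫ z, g (x + z * σ) * rho f m σ x z ∂γ := by
  unfold A rho
  rw [← integral_const_mul]
  congr 1; ext z
  rw [mul_left_comm, ← exp_add]; congr 2; ring

lemma av_eq (g : ℝ → ℝ) (σ x : ℝ) :
    av f m σ g x = (∫ z, g (x + z * σ) * rho f m σ x z ∂γ) / ∫ z, rho f m σ x z ∂γ := by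
  unfold av
  rw [A_eq, A_eq, mul_div_mul_left _ _ (exp_pos _).ne']
  simp

lemma n_ge (h : Lp f f1 m) (hcv : ∀ x y, f x + f1 x * (y - x) ≤ f y) (σ x : ℝ) :
    1 ≤ ∫ z, rho f m σ x z ∂γ := by
  have hid : Integrable (fun z : ℝ => z) γ := by
    simpa using (int_exp 1 0).mono' (g := fun z => |z| ^ 1 * exp (0 * |z|)) (f := fun z : ℝ => z)
      (by fun_prop) (ae_of_all _ fun z => by simp)
  have e : ∫ z, (1 + (m * f1 x * σ) * z) ∂γ = 1 := by
    rw [integral_add (integrable_const _) (hid.const_mul _), integral_const_mul, gauss_id]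
    simp
  rw [← e]
  refine integral_mono ((integrable_const _).add (hid.const_mul _)) ?_ fun z => ?_
  · have := h.int_rho (σ := |σ|) (c := |σ|) (abs_nonneg σ) le_rfl x (u := fun _ => 1) continuous_const
      (M := 1) (k := 0) (by simp)
    have h2 := h.intA (g := fun _ => exp (- (m * f x))) continuous_const (C := exp (-(m * f x)))
      (fun y => by rw [abs_of_pos (exp_pos _)]) σ x
    refine h2.congr (ae_of_all _ fun z => ?_)
    simp only [rho]; rw [← exp_add]; congr 1; ring
  · have h1 := add_one_le_exp (m * (f (x + z * σ) - f x))
    have h2 := hcv x (x + z * σ)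
    have h3 : m * (f1 x * (z * σ)) ≤ m * (f (x + z * σ) - f x) := by
      apply mul_le_mul_of_nonneg_left _ h.m0
      linarith [show f1 x * (x + z * σ - x) = f1 x * (z * σ) by ring]
    simp only [rho]
    linarith [show m * f1 x * σ * z = m * (f1 x * (z * σ)) by ring]

lemma av_bound (h : Lp f f1 m) (hcv : ∀ x y, f x + f1 x * (y - x) ≤ f y) {σ c : ℝ} (h0 : 0 ≤ σ)
    (hc : σ ≤ c) (x : ℝ) {g : ℝ → ℝ}
    {M : ℝ} (hM0 : 0 ≤ M) {k : ℕ} (hM : ∀ z, |g (x + z * σ)| ≤ M * |z| ^ k) :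
    |av f m σ g x| ≤ M * Cm c k := by
  have hn := h.n_ge hcv σ x
  rw [av_eq, abs_div, abs_of_pos (show 0 < ∫ z, rho f m σ x z ∂γ by linarith)]
  have := h.abs_int_rho h0 hc x (u := fun z => g (x + z * σ)) hM
  exact (div_le_self (abs_nonneg _) hn).trans this

lemma av_sub_const (h : Lp f f1 m) {g : ℝ → ℝ} (hg : Continuous g) {C : ℝ} (hC : ∀ y, |g y| ≤ C)
    (σ x a : ℝ) : av f m σ (fun y => g y - a) x = av f m σ g x - a := by
  simp only [sub_eq_add_neg]
  rw [h.av_add hg hC continuous_const (fun _ => le_rfl), h.av_const]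

lemma cov_bound (h : Lp f f1 m) (hcv : ∀ x y, f x + f1 x * (y - x) ≤ f y) {σ c : ℝ} (h0 : 0 ≤ σ)
    (hc : σ ≤ c) (x : ℝ) {g k : ℝ → ℝ} (hg : Continuous g) {C : ℝ} (hC : ∀ y, |g y| ≤ C)
    (hk : Continuous k) {D : ℝ} (hD : ∀ y, |k y| ≤ D) {L M : ℝ}
    (hL : ∀ x y, |g x - g y| ≤ L * |x - y|) (hM : ∀ x y, |k x - k y| ≤ M * |x - y|) :
    |av f m σ (fun y => g y * k y) x - av f m σ g x * av f m σ k x|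
      ≤ L * M * (Cm c 2 + Cm c 1 ^ 2) * σ ^ 2 := by
  have hL0 : 0 ≤ L := by have := (abs_nonneg _).trans (hL 1 0); simpa using this
  have hM0 : 0 ≤ M := by have := (abs_nonneg _).trans (hM 1 0); simpa using this
  have hC0 : 0 ≤ C := (abs_nonneg _).trans (hC 0)
  have hgk : ∀ y, |g y * k y| ≤ C * D := fun y => by
    rw [abs_mul]; exact mul_le_mul (hC y) (hD y) (abs_nonneg _) hC0
  have e0 : av f m σ (fun y => (g y - g x) * (k y - k x)) x = av f m σ (fun y => g y * k y) x
      - g x * av f m σ k x - k x * av f m σ g x + g x * k x := by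
    have : (fun y => (g y - g x) * (k y - k x)) = fun y => (g y * k y + ((-g x) * k y
        + ((-k x) * g y + g x * k x))) := by ext y; ring
    have b1 : ∀ y, |(-k x) * g y| ≤ |-k x| * C := fun y => by
      rw [abs_mul]; gcongr; exact hC y
    have b2 : ∀ y, |(-k x) * g y + g x * k x| ≤ |-k x| * C + |g x * k x| := fun y =>
      (abs_add_le _ _).trans (by gcongr; exact b1 y)
    have b3 : ∀ y, |(-g x) * k y| ≤ |-g x| * D := fun y => by
      rw [abs_mul]; gcongr; exact hD y
    have b4 : ∀ y, |(-g x) * k y + ((-k x) * g y + g x * k x)| ≤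
        |-g x| * D + (|-k x| * C + |g x * k x|) := fun y =>
      (abs_add_le _ _).trans (add_le_add (b3 y) (b2 y))
    rw [this, h.av_add (by fun_prop) hgk (by fun_prop) b4,
      h.av_add (by fun_prop) b3 (by fun_prop) b2, h.av_add (by fun_prop) b1 continuous_const
        (fun _ => le_rfl), av_smul, av_smul, h.av_const]
    ring
  have e1 := h.av_sub_const hg hC σ x (g x)
  have e2 := h.av_sub_const hk hD σ x (k x)
  have lz : ∀ (w : ℝ → ℝ) (N : ℝ), (∀ x y, |w x - w y| ≤ N * |x - y|) → ∀ z,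
      |w (x + z * σ) - w x| ≤ N * σ * |z| ^ 1 := fun w N hN z => by
    have := hN (x + z * σ) x
    rw [add_sub_cancel_left, abs_mul, abs_of_nonneg h0] at this
    linarith [show N * (|z| * σ) = N * σ * |z| ^ 1 by ring]
  have a1 := h.av_bound hcv h0 hc x (g := fun y => g y - g x) (M := L * σ) (by positivity) (lz g L hL)
  have a2 := h.av_bound hcv h0 hc x (g := fun y => k y - k x) (M := M * σ) (by positivity) (lz k M hM)
  have a3 := h.av_bound hcv h0 hc x (g := fun y => (g y - g x) * (k y - k x))
    (M := L * M * σ ^ 2) (by positivity) (k := 2) (fun z => by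
      rw [abs_mul]
      calc _ ≤ (L * σ * |z| ^ 1) * (M * σ * |z| ^ 1) :=
            mul_le_mul (lz g L hL z) (lz k M hM z) (abs_nonneg _) (by positivity)
        _ = _ := by ring)
  have key : av f m σ (fun y => g y * k y) x - av f m σ g x * av f m σ k x =
      av f m σ (fun y => (g y - g x) * (k y - k x)) x
        - av f m σ (fun y => g y - g x) x * av f m σ (fun y => k y - k x) x := by
    rw [e0, e1, e2]; ring
  rw [key]
  refine (abs_sub _ _).trans ?_
  rw [abs_mul]
  calc _ ≤ L * M * σ ^ 2 * Cm c 2 + (L * σ * Cm c 1) * (M * σ * Cm c 1) :=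
        add_le_add a3 (mul_le_mul a1 a2 (abs_nonneg _) (mul_nonneg (by positivity) (Cm_nonneg _ _)))
    _ = _ := by ring

end Lp

namespace GC
variable {K : ℝ} {f f1 f2 f3 : ℝ → ℝ}

lemma toLp (h : GC K f f1 f2 f3) {m : ℝ} (h0 : 0 ≤ m) (h1 : m ≤ 1) : Lp f f1 m :=
  ⟨h.d0, continuous_iff_continuousAt.2 fun y => (h.d1 y).continuousAt, h.b1, h0, h1⟩

lemma c1 (h : GC K f f1 f2 f3) : Continuous f1 :=
  continuous_iff_continuousAt.2 fun y => (h.d1 y).continuousAt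

lemma c2 (h : GC K f f1 f2 f3) : Continuous f2 :=
  continuous_iff_continuousAt.2 fun y => (h.d2 y).continuousAt

lemma a2 (h : GC K f f1 f2 f3) (y : ℝ) : |f2 y| ≤ 1 := by
  rw [abs_of_nonneg (h.p2 y)]; nlinarith [h.b2 y, sq_nonneg (f1 y)]

lemma K0 (h : GC K f f1 f2 f3) : 0 ≤ K := (abs_nonneg _).trans (h.b3 0)

lemma lip1 (h : GC K f f1 f2 f3) (x y : ℝ) : |f1 x - f1 y| ≤ 1 * |x - y| := lip_of_deriv h.d1 h.a2 x y
lemma lip2 (h : GC K f f1 f2 f3) (x y : ℝ) : |f2 x - f2 y| ≤ K * |x - y| := lip_of_deriv h.d2 h.b3 x y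

lemma cvx (h : GC K f f1 f2 f3) (x y : ℝ) : f x + f1 x * (y - x) ≤ f y := by
  have hm : Monotone f1 := monotone_of_hasDerivAt_nonneg h.d1 h.p2
  rcases lt_trichotomy x y with hxy | rfl | hxy
  · obtain ⟨c, hc, e⟩ := exists_hasDerivAt_eq_slope f f1 hxy
      (fun z _ => (h.d0 z).continuousAt.continuousWithinAt) (fun z _ => h.d0 z)
    rw [eq_div_iff (by linarith)] at e
    nlinarith [hm hc.1.le]
  · simp
  · obtain ⟨c, hc, e⟩ := exists_hasDerivAt_eq_slope f f1 hxy
      (fun z _ => (h.d0 z).continuousAt.continuousWithinAt) (fun z _ => h.d0 z)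
    rw [eq_div_iff (by linarith)] at e
    nlinarith [hm hc.2.le]

end GC

/-- second derivative of `T f` -/
def T2 (f f1 f2 : ℝ → ℝ) (m σ x : ℝ) : ℝ :=
  av f m σ f2 x + m * (av f m σ (fun y => f1 y * f1 y) x - av f m σ f1 x * av f m σ f1 x)

/-- third derivative of `T f` -/
def T3 (f f1 f2 f3 : ℝ → ℝ) (m σ x : ℝ) : ℝ :=
  av f m σ f3 x + m * (av f m σ (fun y => f2 y * f1 y) x - av f m σ f2 x * av f m σ f1 x)
  + m * (av f m σ (fun y => f2 y * f1 y + f1 y * f2 y) x + m * (av f m σ (fun y => f1 y * f1 y * f1 y) x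
      - av f m σ (fun y => f1 y * f1 y) x * av f m σ f1 x)
      - (T2 f f1 f2 m σ x * av f m σ f1 x + av f m σ f1 x * T2 f f1 f2 m σ x))

/-- growth constant -/
def CG (c : ℝ) : ℝ := Cm c 2 + Cm c 1 ^ 2

lemma GC.step {K : ℝ} {f f1 f2 f3 : ℝ → ℝ} (h : GC K f f1 f2 f3) {m σ c : ℝ} (m0 : 0 ≤ m) (m1 : m ≤ 1)
    (h0 : 0 ≤ σ) (hc : σ ≤ c) :
    GC ((K + 2) * (1 + 3 * CG c * σ ^ 2) - 2) (T f m σ) (av f m σ f1) (T2 f f1 f2 m σ)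
      (T3 f f1 f2 f3 m σ) := by
  have H := h.toLp m0 m1
  have hc1 := h.c1
  have hc2 := h.c2
  have hc3 := h.c3
  have b11 : ∀ y, |f1 y * f1 y| ≤ 1 := fun y => by
    rw [abs_mul]; nlinarith [h.b1 y, abs_nonneg (f1 y)]
  have b12 : ∀ y, |f2 y * f1 y| ≤ 1 := fun y => by
    rw [abs_mul]; nlinarith [h.b1 y, abs_nonneg (f1 y), h.a2 y, abs_nonneg (f2 y)]
  have b12' : ∀ y, |f2 y * f1 y + f1 y * f2 y| ≤ 2 := fun y => by
    refine (abs_add_le _ _).trans ?_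
    rw [mul_comm (f1 y)]; linarith [b12 y]
  have b111 : ∀ y, |f1 y * f1 y * f1 y| ≤ 1 := fun y => by
    rw [abs_mul]; nlinarith [h.b1 y, abs_nonneg (f1 y), b11 y, abs_nonneg (f1 y * f1 y)]
  have D1 : ∀ y, HasDerivAt (av f m σ f1) (T2 f f1 f2 m σ y) y := fun y =>
    H.deriv_av h.d1 hc2 h.b1 h.a2 σ y
  have D2 := fun y => H.deriv_av h.d2 hc3 h.a2 h.b3 σ y
  have D3 := fun y => H.deriv_av (g := fun y => f1 y * f1 y)
    (fun y => (h.d1 y).mul (h.d1 y)) (by fun_prop) b11 b12' σ y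
  have DT2 : ∀ y, HasDerivAt (T2 f f1 f2 m σ) (T3 f f1 f2 f3 m σ y) y := fun y =>
    (D2 y).add (((D3 y).sub ((D1 y).mul (D1 y))).const_mul m)
  have q : ∀ y, av f m σ f1 y ^ 2 ≤ av f m σ (fun y => f1 y * f1 y) y := fun y => by
    set a := av f m σ f1 y with ha
    have h1 : 0 ≤ av f m σ (fun y => f1 y * f1 y + ((-2 * a) * f1 y + a ^ 2)) y := by
      unfold av
      refine div_nonneg (integral_nonneg fun z => ?_) (H.A1_pos σ y).le
      have : 0 ≤ (f1 (y + z * σ) - a) ^ 2 := sq_nonneg _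
      refine mul_nonneg ?_ (exp_pos _).le
      nlinarith
    have b1 : ∀ y, |(-2 * a) * f1 y| ≤ |-2 * a| * 1 := fun y => by
      rw [abs_mul]; gcongr; exact h.b1 y
    have b2 : ∀ y, |(-2 * a) * f1 y + a ^ 2| ≤ |-2 * a| * 1 + |a ^ 2| := fun y =>
      (abs_add_le _ _).trans (by gcongr; exact b1 y)
    rw [H.av_add (by fun_prop) b11 (by fun_prop) b2, H.av_add (by fun_prop) b1 continuous_const
      (fun _ => le_rfl), Lp.av_smul, H.av_const, ← ha] at h1
    nlinarith
  have A2 : ∀ y, |av f m σ f1 y| ≤ 1 := fun y => H.av_abs hc1 h.b1 σ y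
  refine ⟨fun y => H.deriv_T σ y, D1, DT2, ?_, A2, fun y => ?_, fun y => ?_, fun y => ?_⟩
  · have k1 := H.cont_av hc1 h.b1 σ
    have k2 := H.cont_av hc2 h.a2 σ
    have k3 := H.cont_av hc3 h.b3 σ
    have k4 := H.cont_av (by fun_prop) b12 σ
    have k5 := H.cont_av (by fun_prop) b12' σ
    have k6 := H.cont_av (by fun_prop) b111 σ
    have k7 := H.cont_av (by fun_prop) b11 σ
    unfold T3 T2
    fun_prop
  · unfold T2
    have h1 : 0 ≤ av f m σ f2 y := by
      unfold av
      exact div_nonneg (integral_nonneg fun z => mul_nonneg (h.p2 _) (exp_pos _).le) (H.A1_pos σ y).le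
    have := mul_nonneg m0 (sub_nonneg.2 (q y))
    nlinarith
  · unfold T2
    have h1 : av f m σ f2 y ≤ 1 - av f m σ (fun y => f1 y * f1 y) y := by
      have := H.av_mono hc2 h.a2 (k := fun y => 1 + (-1) * (f1 y * f1 y)) (by fun_prop) (D := 2)
        (fun y => by
          refine (abs_add_le _ _).trans ?_
          rw [abs_mul]; norm_num; linarith [le_abs_self (f1 y * f1 y), b11 y])
        (fun y => by nlinarith [h.b2 y]) σ y
      rw [H.av_add continuous_const (C := 1) (by simp) (by fun_prop) (D := 1)
        (fun y => by rw [abs_mul]; norm_num; linarith [le_abs_self (f1 y * f1 y), b11 y]), H.av_const, Lp.av_smul] at this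
      linarith
    have := mul_nonneg (sub_nonneg.2 m1) (sub_nonneg.2 (q y))
    nlinarith
  · have l11 : ∀ x y, |f1 x * f1 x - f1 y * f1 y| ≤ 2 * |x - y| := fun x y => by
      have := lip_of_deriv (g := fun y => f1 y * f1 y) (fun y => (h.d1 y).mul (h.d1 y)) b12' x y
      simpa using this
    have v1 := H.cov_bound h.cvx h0 hc y hc2 h.a2 hc1 h.b1 h.lip2 h.lip1
    have v2 := H.cov_bound h.cvx h0 hc y hc1 h.b1 hc1 h.b1 h.lip1 h.lip1
    have v3 := H.cov_bound h.cvx h0 hc y (g := fun y => f1 y * f1 y) (by fun_prop) b11 hc1 h.b1 l11 h.lip1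
    have v0 := H.av_abs hc3 h.b3 σ y
    have e5 : av f m σ (fun y => f2 y * f1 y + f1 y * f2 y) y = 2 * av f m σ (fun y => f2 y * f1 y) y := by
      rw [← Lp.av_smul]; congr 1; ext y; ring
    have a1 := A2 y
    have hG : 0 ≤ CG c * σ ^ 2 := by
      have := Cm_nonneg c 2
      unfold CG; positivity
    rw [show T3 f f1 f2 f3 m σ y = av f m σ f3 y + (3 * m) * (av f m σ (fun y => f2 y * f1 y) y - av f m σ f2 y * av f m σ f1 y)
      + m ^ 2 * ((av f m σ (fun y => f1 y * f1 y * f1 y) y - av f m σ (fun y => f1 y * f1 y) y * av f m σ f1 y)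
       - 2 * av f m σ f1 y * (av f m σ (fun y => f1 y * f1 y) y - av f m σ f1 y * av f m σ f1 y)) by
        unfold T3 T2; rw [e5]; ring]
    rw [show Cm c 2 + Cm c 1 ^ 2 = CG c from rfl] at v1 v2 v3
    set E := CG c * σ ^ 2
    have w1 : |(3 * m) * (av f m σ (fun y => f2 y * f1 y) y - av f m σ f2 y * av f m σ f1 y)| ≤ 3 * (K * E) := by
      rw [abs_mul, abs_of_nonneg (by positivity : 0 ≤ 3 * m)]
      exact mul_le_mul (by linarith) (by linarith [show K * 1 * CG c * σ ^ 2 = K * E by ring]) (abs_nonneg _) (by norm_num)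
    have w2 : |m ^ 2 * ((av f m σ (fun y => f1 y * f1 y * f1 y) y - av f m σ (fun y => f1 y * f1 y) y * av f m σ f1 y)
       - 2 * av f m σ f1 y * (av f m σ (fun y => f1 y * f1 y) y - av f m σ f1 y * av f m σ f1 y))| ≤ 1 * (4 * E) := by
      rw [abs_mul, abs_of_nonneg (by positivity : 0 ≤ m ^ 2)]
      refine mul_le_mul (by nlinarith) ?_ (abs_nonneg _) (by norm_num)
      refine (abs_sub _ _).trans ?_
      have : |2 * av f m σ f1 y * (av f m σ (fun y => f1 y * f1 y) y - av f m σ f1 y * av f m σ f1 y)| ≤ 2 * E := by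
        rw [abs_mul]
        refine mul_le_mul (by rw [abs_mul]; norm_num; linarith) (by linarith [show 1 * 1 * CG c * σ ^ 2 = E by ring]) (abs_nonneg _) (by norm_num)
      linarith [show 2 * 1 * CG c * σ ^ 2 = 2 * E by ring]
    have w := (abs_add_le _ _).trans (add_le_add (abs_add_le (av f m σ f3 y) ((3 * m) * (av f m σ (fun y => f2 y * f1 y) y - av f m σ f2 y * av f m σ f1 y))) (le_refl |m ^ 2 * ((av f m σ (fun y => f1 y * f1 y * f1 y) y - av f m σ (fun y => f1 y * f1 y) y * av f m σ f1 y)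
       - 2 * av f m σ f1 y * (av f m σ (fun y => f1 y * f1 y) y - av f m σ f1 y * av f m σ f1 y))|))
    refine w.trans ?_
    rw [show (K + 2) * (1 + 3 * CG c * σ ^ 2) - 2 = K + 3 * (K * E) + 6 * E by ring]
    linarith

end Parisi

end

section
open MeasureTheory ProbabilityTheory Real Set Filter
open scoped Topology NNReal ENNReal

namespace Parisi

lemma abs_exp_sub_one (a : ℝ) : |exp a - 1| ≤ |a| * exp |a| := by
  rcases le_total 0 a with h | h
  · rw [abs_of_nonneg (by linarith [one_le_exp h]), abs_of_nonneg h]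
    have := add_one_le_exp (-a)
    have h2 : exp a * exp (-a) = 1 := by rw [← exp_add]; simp
    nlinarith [exp_pos a]
  · rw [abs_of_nonpos (by linarith [exp_le_one_iff.2 h]), abs_of_nonpos h]
    have := add_one_le_exp a
    have := one_le_exp (neg_nonneg.2 h)
    nlinarith

lemma abs_exp_sub_one_sub (a : ℝ) : |exp a - 1 - a| ≤ |a| ^ 2 * exp |a| := by
  have h0 := add_one_le_exp a
  rw [abs_of_nonneg (by linarith)]
  have h1 := add_one_le_exp (-a)
  have h2 : exp a * exp (-a) = 1 := by rw [← exp_add]; simp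
  have h3 : exp a - 1 - a ≤ a * (exp a - 1) := by nlinarith [exp_pos a]
  have h4 : a * (exp a - 1) ≤ |a| * |exp a - 1| := by rw [← abs_mul]; exact le_abs_self _
  have h5 := mul_le_mul_of_nonneg_left (abs_exp_sub_one a) (abs_nonneg a)
  linarith [show |a| * (|a| * exp |a|) = |a| ^ 2 * exp |a| by ring]

lemma abs_exp_sub_exp {a b M : ℝ} (ha : a ≤ M) (hb : b ≤ M) : |exp a - exp b| ≤ |a - b| * exp M := by
  wlog hab : b ≤ a generalizing a b
  · rw [abs_sub_comm, abs_sub_comm a]; exact this hb ha (by linarith)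
  rw [abs_of_nonneg (by linarith [exp_le_exp.2 hab]), abs_of_nonneg (by linarith)]
  have h1 := add_one_le_exp (b - a)
  have h2 : exp a * exp (b - a) = exp b := by rw [← exp_add]; congr 1; ring
  have h3 := exp_le_exp.2 ha
  have h4 : exp a - exp b ≤ (a - b) * exp a := by nlinarith [exp_pos a]
  have h5 := mul_le_mul_of_nonneg_left h3 (sub_nonneg.2 hab)
  linarith

lemma taylor1 {g g' : ℝ → ℝ} (hd : ∀ y, HasDerivAt g (g' y) y) {L : ℝ}
    (hL : ∀ x y, |g' x - g' y| ≤ L * |x - y|) (x y : ℝ) :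
    |g y - g x - g' x * (y - x)| ≤ L * |y - x| ^ 2 := by
  have hL0 : 0 ≤ L := by have := (abs_nonneg _).trans (hL 1 0); simpa using this
  have := Convex.norm_image_sub_le_of_norm_hasDerivWithin_le (f := fun z => g z - g' x * z)
    (f' := fun z => g' z - g' x * 1) (s := uIcc x y)
    (C := L * |y - x|) (x := x) (y := y) 
    (fun z _ => ((hd z).sub ((hasDerivAt_id z).const_mul (g' x))).hasDerivWithinAt)
    (fun z hz => by
      rw [mul_one]
      refine (hL z x).trans ?_
      exact mul_le_mul_of_nonneg_left (abs_sub_left_of_mem_uIcc hz) hL0)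
    (convex_uIcc x y) left_mem_uIcc right_mem_uIcc
  rw [Real.norm_eq_abs, Real.norm_eq_abs] at this
  calc _ = |g y - g' x * y - (g x - g' x * x)| := by congr 1; ring
    _ ≤ L * |y - x| * |y - x| := this
    _ = _ := by ring

lemma int_id : Integrable (fun z : ℝ => z) γ :=
  by simpa using (int_exp 1 0).mono' (g := fun z => |z| ^ 1 * exp (0 * |z|)) (f := fun z : ℝ => z)
      (by fun_prop) (ae_of_all _ fun z => by simp)

lemma int_sq : Integrable (fun z : ℝ => z ^ 2) γ :=
  by simpa using (int_exp 2 0).mono' (g := fun z => |z| ^ 2 * exp (0 * |z|)) (f := fun z : ℝ => z ^ 2)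
      (by fun_prop) (ae_of_all _ fun z => by simp)

lemma abs_int_le {u : ℝ → ℝ} {M c : ℝ} {k : ℕ} (hM : ∀ z, |u z| ≤ M * (|z| ^ k * exp (c * |z|))) :
    |∫ z, u z ∂γ| ≤ M * Cm c k := by
  rw [Cm, ← integral_const_mul, ← Real.norm_eq_abs]
  exact norm_integral_le_of_norm_le ((int_exp k c).const_mul M) (ae_of_all _ fun z => hM z)

lemma int_of_le {u : ℝ → ℝ} (hu : Continuous u) {M c : ℝ} {k : ℕ}
    (hM : ∀ z, |u z| ≤ M * (|z| ^ k * exp (c * |z|))) : Integrable u γ :=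
  ((int_exp k c).const_mul M).mono' hu.aestronglyMeasurable (ae_of_all _ fun z => hM z)

lemma GC.T_sub {K : ℝ} {f f1 f2 f3 : ℝ → ℝ} (h : GC K f f1 f2 f3) {m σ c : ℝ} (m0 : 0 ≤ m) (m1 : m ≤ 1)
    (h0 : 0 ≤ σ) (hc : σ ≤ c) (x : ℝ) : |T f m σ x - f x| ≤ 2 * Cm c 2 * σ ^ 2 := by
  have H := h.toLp m0 m1
  have hf := H.cont
  have C2 := Cm_nonneg c 2
  have hc0 := h0.trans hc
  have tz : ∀ z, |f (x + z * σ) - f x - f1 x * (z * σ)| ≤ σ ^ 2 * |z| ^ 2 := fun z => by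
    have := taylor1 h.d0 h.lip1 x (x + z * σ)
    rw [add_sub_cancel_left, abs_mul, abs_of_nonneg h0] at this
    linarith [show 1 * (|z| * σ) ^ 2 = σ ^ 2 * |z| ^ 2 by ring]
  have one_le : ∀ z, 1 ≤ exp (c * |z|) := fun z => one_le_exp (by positivity)
  by_cases hm : m = 0
  · have e : T f m σ x - f x = ∫ z, (f (x + z * σ) - f x - f1 x * (z * σ)) ∂γ := by
      have i1 := int_of_exp hf H.growth x σ
      have i12 : Integrable (fun z => f (x + z * σ) - f x) γ := i1.sub (integrable_const _)
      rw [integral_sub i12 ((int_id.mul_const σ).const_mul _),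
        integral_sub i1 (integrable_const _), integral_const_mul, integral_mul_const, gauss_id]
      simp [T, hm]
    rw [e]
    have := abs_int_le (c := c) (k := 2) (M := σ ^ 2) fun z => (tz z).trans (by
      have := one_le z
      have h5 : 0 ≤ σ ^ 2 * |z| ^ 2 := by positivity
      nlinarith)
    nlinarith [sq_nonneg σ]
  · have mp : 0 < m := lt_of_le_of_ne m0 (Ne.symm hm)
    set n := ∫ z, rho f m σ x z ∂γ with hn
    have n1 : 1 ≤ n := H.n_ge h.cvx σ x
    have e : T f m σ x - f x = m⁻¹ * Real.log n := by
      have e1 : (∫ z, Real.exp (m * f (x + z * σ)) ∂γ) = exp (m * f x) * n := by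
        have := Lp.A_eq (f := f) (m := m) (fun _ => 1) σ x
        simpa [A] using this
      simp only [T, hm, if_false]
      rw [e1, Real.log_mul (exp_pos _).ne' (by linarith), Real.log_exp]
      field_simp
      ring
    have b : |n - 1| ≤ 2 * m * σ ^ 2 * Cm c 2 := by
      have i0 : Integrable (rho f m σ x) γ := by
        simpa using H.int_rho h0 hc x (u := fun _ => 1) continuous_const (M := 1) (k := 0) (by simp)
      have e2 : n - 1 = ∫ z, (rho f m σ x z - 1 - m * f1 x * (z * σ)) ∂γ := by
        have i12 : Integrable (fun z => rho f m σ x z - 1) γ := i0.sub (integrable_const _)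
        rw [integral_sub i12 ((int_id.mul_const σ).const_mul _),
          integral_sub i0 (integrable_const _), integral_const_mul, integral_mul_const, gauss_id]
        simp [hn]
      rw [e2]
      refine abs_int_le fun z => ?_
      set a := m * (f (x + z * σ) - f x) with ha
      have a1 : |a| ≤ σ * |z| := H.rho_abs h0 hc x z
      have a2 : |a| ≤ m * (σ * |z|) := by
        rw [ha, abs_mul, abs_of_pos mp]
        have := H.lip (x + z * σ) x
        rw [add_sub_cancel_left, abs_mul, abs_of_nonneg h0] at this
        gcongr; linarith
      have a3 := abs_exp_sub_one_sub a
      have a4 : |a| ^ 2 * exp |a| ≤ (m * (σ * |z|) * (σ * |z|)) * exp (c * |z|) := by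
        rw [sq]
        gcongr
        nlinarith [abs_nonneg z]
      have a5 : |a - m * f1 x * (z * σ)| ≤ m * (σ ^ 2 * |z| ^ 2) := by
        rw [ha, show m * (f (x + z * σ) - f x) - m * f1 x * (z * σ) =
          m * (f (x + z * σ) - f x - f1 x * (z * σ)) by ring, abs_mul, abs_of_pos mp]
        gcongr; exact tz z
      have a6 : rho f m σ x z - 1 - m * f1 x * (z * σ) = (exp a - 1 - a) + (a - m * f1 x * (z * σ)) := by
        simp only [rho, ← ha]; ring
      rw [a6]
      refine (abs_add_le _ _).trans ?_
      have a7 : 0 ≤ m * (σ ^ 2 * |z| ^ 2) := by positivity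
      nlinarith [one_le z]
    rw [abs_of_nonneg (by linarith)] at b
    rw [e, abs_of_nonneg (mul_nonneg (by positivity) (Real.log_nonneg n1))]
    have := Real.log_le_sub_one_of_pos (show 0 < n by linarith)
    rw [inv_mul_le_iff₀ mp]
    nlinarith

/-- error constant for one step -/
def CO (c K : ℝ) : ℝ := K * (Cm c 3 + Cm c 1 * Cm c 2) + (2 * K * Cm c 3 + (Cm c 3 + Cm c 1)
    + c * ((1 + K) * Cm c 2) ^ 2)

set_option maxHeartbeats 2000000 in
lemma GC.onestep {K : ℝ} {f f1 f2 f3 : ℝ → ℝ} (h : GC K f f1 f2 f3) {m σ c : ℝ} (m0 : 0 ≤ m)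
    (m1 : m ≤ 1) (h0 : 0 ≤ σ) (hc : σ ≤ c) (x : ℝ) :
    |(∫ z, f2 (x + m * σ ^ 2 * f1 x + z * σ) ∂γ) - T2 f f1 f2 m σ x + m * σ ^ 2 * f2 x ^ 2|
      ≤ CO c K * σ ^ 3 := by
  have H := h.toLp m0 m1
  have hf := H.cont
  have hc1 := h.c1
  have hc2 := h.c2
  have hr := H.rho_cont σ x
  have hc0 := h0.trans hc
  have hK := h.K0
  have C1 := Cm_nonneg c 1
  have C2 := Cm_nonneg c 2
  have C3 := Cm_nonneg c 3
  set n := ∫ z, rho f m σ x z ∂γ with hn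
  have n1 : 1 ≤ n := H.n_ge h.cvx σ x
  set θ := m * σ * f1 x with hθ
  have i0 : Integrable (rho f m σ x) γ := by
    simpa using H.int_rho h0 hc x (u := fun _ => 1) continuous_const (M := 1) (k := 0) (by simp)
  have θ1 : |θ| ≤ σ := by
    rw [hθ, abs_mul, abs_mul, abs_of_nonneg m0, abs_of_nonneg h0]
    have : m * σ ≤ σ := by nlinarith
    have := h.b1 x
    nlinarith [mul_nonneg m0 h0, abs_nonneg (f1 x)]
  have θz : ∀ z, |θ * z| ≤ σ * |z| := fun z => by rw [abs_mul]; gcongr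
  have θe : ∀ z, exp (θ * z) ≤ exp (c * |z|) := fun z => exp_le_exp.2 (by
    have := le_of_abs_le (θz z); nlinarith [abs_nonneg z])
  have r1 : ∀ z, |rho f m σ x z - exp (θ * z)| ≤ σ ^ 2 * |z| ^ 2 * exp (c * |z|) := fun z => by
    have ha := H.rho_abs h0 hc x z
    refine (abs_exp_sub_exp (M := c * |z|) ?_ ?_).trans ?_
    · have := le_of_abs_le ha; nlinarith [abs_nonneg z]
    · have := le_of_abs_le (θz z); nlinarith [abs_nonneg z]
    · gcongr
      have := taylor1 h.d0 h.lip1 x (x + z * σ)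
      rw [add_sub_cancel_left, abs_mul z, abs_of_nonneg h0] at this
      rw [hθ, show m * (f (x + z * σ) - f x) - m * σ * f1 x * z = m * (f (x + z * σ) - f x - f1 x * (z * σ)) by ring,
        abs_mul, abs_of_nonneg m0]
      have h9 : 0 ≤ |f (x + z * σ) - f x - f1 x * (z * σ)| := abs_nonneg _
      nlinarith
  have r2 : ∀ z, |rho f m σ x z - 1| ≤ σ * |z| * exp (c * |z|) := fun z => by
    have ha := H.rho_abs h0 hc x z
    refine (abs_exp_sub_one _).trans ?_
    gcongr
    nlinarith [abs_nonneg z]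
  have iθ : Integrable (fun z => exp (θ * z)) γ := by simpa using integrable_exp_mul_gaussianReal θ
  have nb : |n - exp (θ ^ 2 / 2)| ≤ σ ^ 2 * Cm c 2 := by
    rw [← gauss_exp, hn, ← integral_sub i0 iθ]
    exact abs_int_le fun z => (r1 z).trans (by rw [mul_assoc])
  have nb1 : |n - 1| ≤ σ * Cm c 1 := by
    rw [show n - 1 = ∫ z, (rho f m σ x z - 1) ∂γ by
      rw [integral_sub i0 (integrable_const _)]; simp [hn]]
    exact abs_int_le fun z => (r2 z).trans (by rw [mul_assoc, pow_one])
  set e := exp (θ ^ 2 / 2) with he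
  have e1 : 1 ≤ e := one_le_exp (by positivity)
  -- part one
  set φ : ℝ → ℝ := fun z => f2 (x + z * σ) - f2 x with hφ
  have cφ : Continuous φ := by fun_prop
  have φb : ∀ z, |φ z| ≤ K * σ * |z| := fun z => by
    have := h.lip2 (x + z * σ) x
    rw [add_sub_cancel_left, abs_mul, abs_of_nonneg h0] at this
    linarith [show K * (|z| * σ) = K * σ * |z| by ring]
  have hH : (∫ z, f2 (x + m * σ ^ 2 * f1 x + z * σ) ∂γ) - f2 x = (∫ z, φ z * exp (θ * z) ∂γ) / e := by
    have := cameron (fun z => f2 (x + z * σ)) θ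
    rw [show (fun z => f2 (x + m * σ ^ 2 * f1 x + z * σ)) = fun z => f2 (x + (z + θ) * σ) by
      ext z; congr 1; rw [hθ]; ring]
    rw [this]
    have i3 : Integrable (fun z => f2 (x + z * σ) * exp (θ * z)) γ := by
      refine iθ.mono' (by fun_prop) (ae_of_all _ fun z => ?_)
      rw [Real.norm_eq_abs, abs_mul, abs_of_pos (exp_pos _)]
      nlinarith [h.a2 (x + z * σ), exp_pos (θ * z)]
    have e3 : ∫ z, φ z * exp (θ * z) ∂γ = (∫ z, f2 (x + z * σ) * exp (θ * z) ∂γ) - f2 x * e := by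
      simp only [hφ, sub_mul]
      rw [integral_sub i3 (iθ.const_mul _), integral_const_mul, gauss_exp]
    rw [e3, exp_neg, ← he]
    simp only [← mul_assoc]
    rw [integral_mul_const]
    have : e ≠ 0 := by linarith
    generalize (∫ z, f2 (x + z * σ) * rexp (θ * z) ∂γ) = I
    field_simp
  have hA : av f m σ f2 x - f2 x = (∫ z, φ z * rho f m σ x z ∂γ) / n := by
    rw [← H.av_sub_const hc2 h.a2, Lp.av_eq]
  have p1 : |(∫ z, φ z * exp (θ * z) ∂γ) / e - (∫ z, φ z * rho f m σ x z ∂γ) / n|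
      ≤ K * (Cm c 3 + Cm c 1 * Cm c 2) * σ ^ 3 := by
    set I := ∫ z, φ z * exp (θ * z) ∂γ
    set J := ∫ z, φ z * rho f m σ x z ∂γ
    have bI : |I| ≤ K * σ * Cm c 1 := abs_int_le fun z => by
      rw [abs_mul, abs_of_pos (exp_pos _), pow_one, ← mul_assoc]
      exact mul_le_mul (φb z) (θe z) (exp_pos _).le (by positivity)
    have iI : Integrable (fun z => φ z * exp (θ * z)) γ := int_of_le (by fun_prop) (M := K * σ) (c := c) (k := 1) fun z => by
      rw [abs_mul, abs_of_pos (exp_pos _), pow_one, ← mul_assoc]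
      exact mul_le_mul (φb z) (θe z) (exp_pos _).le (by positivity)
    have iJ : Integrable (fun z => φ z * rho f m σ x z) γ := H.int_rho h0 hc x cφ (k := 1) (M := K * σ) (by simpa using φb)
    have bIJ : |I - J| ≤ K * σ ^ 3 * Cm c 3 := by
      rw [← integral_sub iI iJ]
      refine abs_int_le fun z => ?_
      rw [← mul_sub, abs_mul, abs_sub_comm (exp (θ * z))]
      calc _ ≤ (K * σ * |z|) * (σ ^ 2 * |z| ^ 2 * exp (c * |z|)) :=
            mul_le_mul (φb z) (r1 z) (abs_nonneg _) (by positivity)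
        _ = _ := by ring
    have s1 : I / e - J / n = (I - J) / n + I * (n - e) / (e * n) := by
      have : n ≠ 0 := by linarith
      have : e ≠ 0 := by linarith
      field_simp; ring
    rw [s1]
    refine (abs_add_le _ _).trans ?_
    rw [abs_div, abs_div, abs_mul, abs_of_pos (show 0 < n by linarith), abs_of_pos (show 0 < e * n by positivity)]
    have s2 : |I - J| / n ≤ |I - J| := div_le_self (abs_nonneg _) n1
    have s3 : |I| * |n - e| / (e * n) ≤ |I| * |n - e| := div_le_self (by positivity) (by nlinarith)
    have s4 : |I| * |n - e| ≤ (K * σ * Cm c 1) * (σ ^ 2 * Cm c 2) :=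
      mul_le_mul bI nb (abs_nonneg _) (by positivity)
    nlinarith
  -- part two: the variance
  set V := av f m σ (fun y => f1 y * f1 y) x - av f m σ f1 x * av f m σ f1 x with hV
  have b11 : ∀ y, |f1 y * f1 y| ≤ 1 := fun y => by
    rw [abs_mul]; nlinarith [h.b1 y, abs_nonneg (f1 y)]
  set d : ℝ → ℝ := fun z => f1 (x + z * σ) - f1 x with hd
  have cd : Continuous d := by fun_prop
  have db : ∀ z, |d z| ≤ σ * |z| := fun z => by
    have := h.lip1 (x + z * σ) x
    rw [add_sub_cancel_left, abs_mul, abs_of_nonneg h0] at this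
    linarith
  have dr : ∀ z, |d z - f2 x * σ * z| ≤ K * σ ^ 2 * |z| ^ 2 := fun z => by
    have := taylor1 h.d1 h.lip2 x (x + z * σ)
    rw [add_sub_cancel_left, abs_mul z, abs_of_nonneg h0] at this
    rw [show d z - f2 x * σ * z = f1 (x + z * σ) - f1 x - f2 x * (z * σ) by simp only [hd]; ring]
    linarith [show K * (|z| * σ) ^ 2 = K * σ ^ 2 * |z| ^ 2 by ring]
  set P := ∫ z, d z ^ 2 * rho f m σ x z ∂γ with hP
  set Q := ∫ z, d z * rho f m σ x z ∂γ with hQ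
  have eV : V = P / n - (Q / n) ^ 2 := by
    have q1 : Q / n = av f m σ f1 x - f1 x := by
      rw [← H.av_sub_const hc1 h.b1, Lp.av_eq]
    have q2 : P / n = av f m σ (fun y => f1 y * f1 y + ((-2 * f1 x) * f1 y + f1 x ^ 2)) x := by
      rw [Lp.av_eq, hP]; congr 3; ext z; simp only [hd]; ring
    have b1 : ∀ y, |(-2 * f1 x) * f1 y| ≤ |-2 * f1 x| * 1 := fun y => by
      rw [abs_mul]; gcongr; exact h.b1 y
    have b2 : ∀ y, |(-2 * f1 x) * f1 y + f1 x ^ 2| ≤ |-2 * f1 x| * 1 + |f1 x ^ 2| := fun y =>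
      (abs_add_le _ _).trans (by gcongr; exact b1 y)
    rw [H.av_add (by fun_prop) b11 (by fun_prop) b2, H.av_add (by fun_prop) b1 continuous_const
      (fun _ => le_rfl), Lp.av_smul, H.av_const] at q2
    rw [q1, q2, hV]; ring
  have a2 := h.a2 x
  have nn : 0 < n := by linarith
  -- the second moment
  set Z := ∫ z, z ^ 2 * rho f m σ x z ∂γ with hZ
  have iZ : Integrable (fun z => z ^ 2 * rho f m σ x z) γ :=
    H.int_rho h0 hc x (by fun_prop) (k := 2) (M := 1) (by simp)
  have bZ : |Z - 1| ≤ σ * Cm c 3 := by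
    rw [← gauss_sq, hZ, ← integral_sub iZ int_sq]
    refine abs_int_le fun z => ?_
    rw [show z ^ 2 * rho f m σ x z - z ^ 2 = z ^ 2 * (rho f m σ x z - 1) by ring, abs_mul, abs_pow]
    calc _ ≤ |z| ^ 2 * (σ * |z| * exp (c * |z|)) := by gcongr; exact r2 z
      _ = _ := by ring
  have bP : |P - f2 x ^ 2 * σ ^ 2 * Z| ≤ 2 * K * σ ^ 3 * Cm c 3 := by
    have iP : Integrable (fun z => d z ^ 2 * rho f m σ x z) γ :=
      H.int_rho h0 hc x (by fun_prop) (k := 2) (M := σ ^ 2) (fun z => by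
        rw [abs_pow, ← mul_pow]; gcongr; exact db z)
    rw [hP, hZ, ← integral_const_mul, ← integral_sub iP (iZ.const_mul _)]
    have : ∀ z, |(d z - f2 x * σ * z) * (d z + f2 x * σ * z)| ≤ 2 * K * σ ^ 3 * |z| ^ 3 := fun z => by
      rw [abs_mul]
      have k1 : |d z + f2 x * σ * z| ≤ 2 * (σ * |z|) := by
        refine (abs_add_le _ _).trans ?_
        rw [abs_mul, abs_mul, abs_of_nonneg h0]
        have : |f2 x| * σ * |z| ≤ 1 * σ * |z| := by gcongr
        linarith [db z]
      calc _ ≤ (K * σ ^ 2 * |z| ^ 2) * (2 * (σ * |z|)) :=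
            mul_le_mul (dr z) k1 (abs_nonneg _) (by positivity)
        _ = _ := by ring
    have k2 := H.abs_int_rho h0 hc x this
    convert k2 using 3
    ext z; ring
  have bQ : |Q| ≤ (1 + K) * Cm c 2 * σ ^ 2 := by
    set Y := ∫ z, z * rho f m σ x z ∂γ with hY
    have iY : Integrable (fun z => z * rho f m σ x z) γ :=
      H.int_rho h0 hc x (by fun_prop) (k := 1) (M := 1) (by simp)
    have bY : |Y| ≤ σ * Cm c 2 := by
      rw [show Y = ∫ z, (z * rho f m σ x z - z) ∂γ by rw [integral_sub iY int_id, gauss_id, sub_zero]]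
      refine abs_int_le fun z => ?_
      rw [show z * rho f m σ x z - z = z * (rho f m σ x z - 1) by ring, abs_mul]
      calc _ ≤ |z| * (σ * |z| * exp (c * |z|)) := by gcongr; exact r2 z
        _ = _ := by ring
    have iQ : Integrable (fun z => d z * rho f m σ x z) γ :=
      H.int_rho h0 hc x (by fun_prop) (k := 1) (M := σ) (fun z => by simpa using db z)
    have k3 := H.abs_int_rho h0 hc x dr
    have k4 : ∫ z, (d z - f2 x * σ * z) * rho f m σ x z ∂γ = Q - f2 x * σ * Y := by
      rw [hQ, hY, ← integral_const_mul, ← integral_sub iQ (iY.const_mul _)]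
      congr 1; ext z; ring
    rw [k4] at k3
    have k5 : |f2 x * σ * Y| ≤ 1 * σ * (σ * Cm c 2) := by
      rw [abs_mul, abs_mul, abs_of_nonneg h0]; gcongr
    have k6 := abs_add_le (Q - f2 x * σ * Y) (f2 x * σ * Y)
    rw [sub_add_cancel] at k6
    nlinarith
  have p2 : |V - σ ^ 2 * f2 x ^ 2| ≤ (2 * K * Cm c 3 + (Cm c 3 + Cm c 1)
    + c * ((1 + K) * Cm c 2) ^ 2) * σ ^ 3 := by
    have s0 : V - σ ^ 2 * f2 x ^ 2 = (P - f2 x ^ 2 * σ ^ 2 * Z) / n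
        + f2 x ^ 2 * σ ^ 2 * ((Z - 1) - (n - 1)) / n - (Q / n) ^ 2 := by
      rw [eV]; field_simp; ring
    rw [s0]
    refine (abs_sub _ _).trans ((add_le_add (abs_add_le _ _) le_rfl).trans ?_)
    rw [abs_div, abs_div, abs_mul, abs_mul, abs_pow, abs_pow, abs_pow, abs_div, abs_of_pos nn, abs_of_nonneg h0]
    have s1 : |P - f2 x ^ 2 * σ ^ 2 * Z| / n ≤ 2 * K * σ ^ 3 * Cm c 3 := (div_le_self (abs_nonneg _) n1).trans bP
    have s2 : |f2 x| ^ 2 * σ ^ 2 * |Z - 1 - (n - 1)| / n ≤ 1 ^ 2 * σ ^ 2 * (σ * Cm c 3 + σ * Cm c 1) := by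
      refine (div_le_self (by positivity) n1).trans ?_
      gcongr
      exact (abs_sub _ _).trans (add_le_add bZ nb1)
    have s3 : (|Q| / n) ^ 2 ≤ ((1 + K) * Cm c 2 * σ ^ 2) ^ 2 := by
      gcongr
      exact (div_le_self (abs_nonneg _) n1).trans bQ
    have s4 : ((1 + K) * Cm c 2 * σ ^ 2) ^ 2 ≤ c * ((1 + K) * Cm c 2) ^ 2 * σ ^ 3 := by
      rw [show ((1 + K) * Cm c 2 * σ ^ 2) ^ 2 = σ * ((1 + K) * Cm c 2) ^ 2 * σ ^ 3 by ring]
      gcongr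
    have s5 : (2 * K * Cm c 3 + (Cm c 3 + Cm c 1) + c * ((1 + K) * Cm c 2) ^ 2) * σ ^ 3 =
      2 * K * σ ^ 3 * Cm c 3 + 1 ^ 2 * σ ^ 2 * (σ * Cm c 3 + σ * Cm c 1) + c * ((1 + K) * Cm c 2) ^ 2 * σ ^ 3 := by ring
    linarith
  have fin : (∫ z, f2 (x + m * σ ^ 2 * f1 x + z * σ) ∂γ) - T2 f f1 f2 m σ x + m * σ ^ 2 * f2 x ^ 2
      = ((∫ z, φ z * exp (θ * z) ∂γ) / e - (∫ z, φ z * rho f m σ x z ∂γ) / n) - m * (V - σ ^ 2 * f2 x ^ 2) := by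
    rw [← hH, ← hA, T2]; ring
  rw [fin]
  refine (abs_sub _ _).trans ?_
  rw [abs_mul, abs_of_nonneg m0, CO]
  have : m * |V - σ ^ 2 * f2 x ^ 2| ≤ |V - σ ^ 2 * f2 x ^ 2| := by nlinarith [abs_nonneg (V - σ ^ 2 * f2 x ^ 2)]
  linarith

end Parisi

end

section
open MeasureTheory ProbabilityTheory Real Set Filter
open scoped Topology NNReal ENNReal

namespace Parisi

lemma exists_sq_bound : ∃ C : ℝ, 0 ≤ C ∧ ∀ p : ℕ, (p : ℝ) ^ 2 * (3 / 2) ^ p ≤ C * 2 ^ p := by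
  have h := (summable_pow_mul_geometric_of_norm_lt_one (R := ℝ) 2 (r := 3 / 4) (by norm_num)).tendsto_atTop_zero
  obtain ⟨C, hC⟩ := h.bddAbove_range
  have hC' : ∀ p : ℕ, (p : ℝ) ^ 2 * (3 / 4) ^ p ≤ C := fun p => hC ⟨p, rfl⟩
  refine ⟨C, by simpa using hC' 0, fun p => ?_⟩
  have : ((3 : ℝ) / 2) ^ p = (3 / 4) ^ p * 2 ^ p := by rw [← mul_pow]; norm_num
  rw [this, ← mul_assoc]
  exact mul_le_mul_of_nonneg_right (hC' p) (by positivity)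

lemma term2_bound {β : ℕ → ℝ} {C : ℝ} (hC : ∀ p : ℕ, (p : ℝ) ^ 2 * (3 / 2) ^ p ≤ C * 2 ^ p) (p : ℕ) {y : ℝ}
    (hy : |y| ≤ 3 / 2) :
    ‖(p : ℝ) * ((p : ℝ) - 1) * β p ^ 2 * y ^ (p - 2)‖ ≤ C * (2 ^ p * β p ^ 2) := by
  rcases p with _ | p
  · simp; have := hC 0; simp at this; positivity
  rw [norm_mul, norm_mul, norm_mul, norm_pow, Real.norm_eq_abs, Real.norm_eq_abs, Real.norm_eq_abs, Real.norm_eq_abs]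
  have h1 : |y| ^ (p + 1 - 2) ≤ (3 / 2) ^ (p + 1) :=
    (pow_le_pow_left₀ (abs_nonneg _) hy _).trans (pow_le_pow_right₀ (by norm_num) (by omega))
  have h2 : |((p + 1 : ℕ) : ℝ)| * |((p + 1 : ℕ) : ℝ) - 1| ≤ ((p + 1 : ℕ) : ℝ) ^ 2 := by
    push_cast
    rw [add_sub_cancel_right, abs_of_nonneg (by positivity), abs_of_nonneg (by positivity)]
    nlinarith [show (0 : ℝ) ≤ p by positivity]
  rw [sq_abs, abs_pow]
  calc _ ≤ ((p + 1 : ℕ) : ℝ) ^ 2 * β (p + 1) ^ 2 * (3 / 2) ^ (p + 1) := by gcongr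
    _ = (((p + 1 : ℕ) : ℝ) ^ 2 * (3 / 2) ^ (p + 1)) * β (p + 1) ^ 2 := by ring
    _ ≤ (C * 2 ^ (p + 1)) * β (p + 1) ^ 2 := mul_le_mul_of_nonneg_right (hC _) (sq_nonneg _)
    _ = _ := by ring

lemma xiD_hasDerivAt {β : ℕ → ℝ} (hβ : ValidBeta β) {y : ℝ} (hy : y ∈ Ioo (-(3 / 2) : ℝ) (3 / 2)) :
    HasDerivAt (xiD β) (zetaFn β y) y := by
  obtain ⟨C, C0, hC⟩ := exists_sq_bound
  obtain ⟨-, b1, -, -, hs⟩ := hβ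
  refine hasDerivAt_tsum_of_isPreconnected (u := fun p => C * (2 ^ p * β p ^ 2)) (t := Ioo (-(3 / 2) : ℝ) (3 / 2))
    (y₀ := 0) (hs.mul_left C) isOpen_Ioo isPreconnected_Ioo
    (g := fun (p : ℕ) y => (p : ℝ) * β p ^ 2 * y ^ (p - 1))
    (g' := fun (p : ℕ) y => (p : ℝ) * ((p : ℝ) - 1) * β p ^ 2 * y ^ (p - 2)) ?_ ?_ (by norm_num) ?_ hy
  · intro p y _
    rcases p with _ | p
    · simpa using hasDerivAt_const y (0 : ℝ)
    refine ((hasDerivAt_pow p y).const_mul (((p + 1 : ℕ) : ℝ) * β (p + 1) ^ 2)).congr_deriv ?_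
    rw [show p + 1 - 2 = p - 1 by omega]
    push_cast; ring
  · intro p y hy
    exact term2_bound hC p (abs_le.2 ⟨hy.1.le, hy.2.le⟩)
  · refine summable_of_ne_finset_zero (s := {1}) fun p hp => ?_
    rcases p with _ | _ | p
    · simp
    · simp at hp
    · simp

lemma zeta_cont {β : ℕ → ℝ} (hβ : ValidBeta β) : ContinuousOn (zetaFn β) (Icc 0 1) := by
  obtain ⟨C, C0, hC⟩ := exists_sq_bound
  refine continuousOn_tsum (u := fun p => C * (2 ^ p * β p ^ 2)) (fun p => by fun_prop) (hβ.2.2.2.2.mul_left C) ?_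
  intro p y hy
  exact term2_bound hC p (abs_le.2 ⟨by linarith [hy.1], by linarith [hy.2]⟩)

lemma zeta_nonneg (β : ℕ → ℝ) {y : ℝ} (hy : y ∈ Icc (0 : ℝ) 1) : 0 ≤ zetaFn β y := by
  refine tsum_nonneg fun p => ?_
  have := hy.1
  rcases p with _ | p
  · simp
  · push_cast; rw [add_sub_cancel_right]; positivity

lemma zeta_bound {β : ℕ → ℝ} (hβ : ValidBeta β) : ∃ Z : ℝ, 0 ≤ Z ∧ ∀ y ∈ Icc (0 : ℝ) 1, zetaFn β y ≤ Z := by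
  obtain ⟨Z, hZ⟩ := isCompact_Icc.exists_bound_of_continuousOn (zeta_cont hβ)
  exact ⟨Z, (norm_nonneg _).trans (hZ 0 (by simp)), fun y hy => (le_abs_self _).trans (hZ y hy)⟩

lemma zeta_intervalIntegrable {β : ℕ → ℝ} (hβ : ValidBeta β) {a b : ℝ} (ha : 0 ≤ a) (hab : a ≤ b) (hb : b ≤ 1) :
    IntervalIntegrable (zetaFn β) volume a b :=
  ((zeta_cont hβ).mono (Icc_subset_Icc ha hb)).intervalIntegrable_of_Icc hab

lemma int_zeta {β : ℕ → ℝ} (hβ : ValidBeta β) {a b : ℝ} (ha : 0 ≤ a) (hab : a ≤ b) (hb : b ≤ 1) :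
    ∫ v in a..b, zetaFn β v = xiD β b - xiD β a := by
  refine intervalIntegral.integral_eq_sub_of_hasDerivAt (fun y hy => xiD_hasDerivAt hβ ?_)
    (zeta_intervalIntegrable hβ ha hab hb)
  rw [uIcc_of_le hab] at hy
  exact ⟨by linarith [hy.1], by linarith [hy.2]⟩

lemma xiD_mono {β : ℕ → ℝ} (hβ : ValidBeta β) {a b : ℝ} (ha : 0 ≤ a) (hab : a ≤ b) (hb : b ≤ 1) :
    xiD β a ≤ xiD β b := by
  have := int_zeta hβ ha hab hb
  have h2 : 0 ≤ ∫ v in a..b, zetaFn β v := intervalIntegral.integral_nonneg hab fun u hu =>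
    zeta_nonneg β ⟨ha.trans hu.1, hu.2.trans hb⟩
  linarith

lemma xiD_nonneg (β : ℕ → ℝ) {a : ℝ} (ha : 0 ≤ a) : 0 ≤ xiD β a :=
  tsum_nonneg fun p => by positivity

lemma xiD_lip {β : ℕ → ℝ} (hβ : ValidBeta β) {Z : ℝ} (hZ : ∀ y ∈ Icc (0 : ℝ) 1, zetaFn β y ≤ Z)
    {a b : ℝ} (ha : 0 ≤ a) (hab : a ≤ b) (hb : b ≤ 1) :
    xiD β b - xiD β a ≤ Z * (b - a) := by
  rw [← int_zeta hβ ha hab hb]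
  have := intervalIntegral.integral_mono_on hab (zeta_intervalIntegrable hβ ha hab hb)
    (intervalIntegrable_const (c := Z)) (fun u hu => hZ u ⟨ha.trans hu.1, hu.2.trans hb⟩)
  simpa [mul_comm] using this

end Parisi

end

section
open MeasureTheory ProbabilityTheory Real Set Filter
open scoped Topology NNReal ENNReal

namespace Parisi

/-- `ν` is an atomic measure whose atoms are exactly the points of `S`. -/
structure Grid (ν : Measure ℝ) (S : Finset ℝ) : Prop where
  mem : MemM ν
  supp : ν ((S : Set ℝ))ᶜ = 0
  atom : ∀ q ∈ S, ν {q} ≠ 0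
  sub : ∀ q ∈ S, q ∈ Icc (0 : ℝ) 1
  one : (1 : ℝ) ∈ S

/-- `p < q` are consecutive points of `S` -/
structure Cons (S : Finset ℝ) (p q : ℝ) : Prop where
  hp : p ∈ S
  hq : q ∈ S
  lt : p < q
  nb : ∀ r ∈ S, ¬ (p < r ∧ r < q)

lemma Grid.fin {ν : Measure ℝ} {S : Finset ℝ} (h : Grid ν S) : FinSupp ν := ⟨S, h.supp⟩

lemma Grid.nextPt {ν : Measure ℝ} {S : Finset ℝ} (h : Grid ν S) {p q : ℝ} (hpq : Cons S p q) :
    nextPt ν p = q := by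
  have q1 := (h.sub q hpq.hq).2
  refine IsLeast.csInf_eq ⟨Or.inl ⟨hpq.lt, q1, h.atom q hpq.hq⟩, ?_⟩
  rintro r (⟨h1, h2, h3⟩ | rfl)
  · by_contra h4
    refine hpq.nb r ?_ ⟨h1, lt_of_not_ge h4⟩
    by_contra h5
    exact h3 (measure_mono_null (by simpa using h5) h.supp)
  · exact q1

lemma distF_nonneg (μ : Measure ℝ) (s : ℝ) : 0 ≤ distF μ s := ENNReal.toReal_nonneg

lemma distF_le_one {μ : Measure ℝ} (h : MemM μ) (s : ℝ) : distF μ s ≤ 1 := by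
  haveI := h.1
  exact measureReal_le_one

lemma distF_mono {μ : Measure ℝ} (h : MemM μ) : Monotone (distF μ) := fun a b hab => by
  haveI := h.1
  exact measureReal_mono (Icc_subset_Icc_right hab)

lemma Grid.distF {ν : Measure ℝ} {S : Finset ℝ} (h : Grid ν S) {p q r : ℝ} (hpq : Cons S p q)
    (h1 : p ≤ r) (h2 : r < q) : distF ν r = distF ν p := by
  unfold _root_.distF
  congr 1
  refine le_antisymm ?_ (measure_mono (Icc_subset_Icc_right h1))
  have : Icc 0 r ⊆ Icc 0 p ∪ ((S : Set ℝ))ᶜ := by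
    intro y hy
    by_cases h3 : y ≤ p
    · exact Or.inl ⟨hy.1, h3⟩
    · exact Or.inr fun h4 => hpq.nb y h4 ⟨lt_of_not_ge h3, hy.2.trans_lt h2⟩
  refine (measure_mono this).trans ((measure_union_le _ _).trans ?_)
  rw [h.supp, add_zero]

lemma Grid.step {ν : Measure ℝ} {S : Finset ℝ} (h : Grid ν S) {β : ℕ → ℝ} {Φ : ℝ → ℝ → ℝ} (hΦ : IsAtomicSol β ν Φ)
    {p q : ℝ} (hpq : Cons S p q) :
    Φ p = T (Φ q) (_root_.distF ν p) (√(xiD β q - xiD β p)) := by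
  ext x
  rw [hΦ.2 p ⟨(h.sub p hpq.hp).1, hpq.lt.trans_le (h.sub q hpq.hq).2⟩ x, h.nextPt hpq]
  rfl

lemma Cons.induct {S : Finset ℝ} {b : ℝ} (hb : b ∈ S) {Pr : ℝ → Prop} (h0 : Pr b)
    (step : ∀ p q, Cons S p q → q ≤ b → Pr q → Pr p) : ∀ a ∈ S, a ≤ b → Pr a := by
  have key : ∀ n : ℕ, ∀ a ∈ S, a ≤ b → (S.filter (fun y => a < y)).card = n → Pr a := by
    intro n
    induction n using Nat.strong_induction_on with
    | _ n ih =>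
      intro a ha hab hn
      rcases hab.eq_or_lt with rfl | hlt
      · exact h0
      have hne : (S.filter (fun y => a < y)).Nonempty := ⟨b, by simp [hb, hlt]⟩
      set q := (S.filter (fun y => a < y)).min' hne with hq
      have hqm := Finset.min'_mem _ hne
      rw [← hq, Finset.mem_filter] at hqm
      have hqle : ∀ r ∈ S, a < r → q ≤ r := fun r hr har =>
        Finset.min'_le _ _ (by simp [hr, har])
      refine step a q ⟨ha, hqm.1, hqm.2, fun r hr hh => absurd (hqle r hr hh.1) (not_le.2 hh.2)⟩
        (hqle b hb hlt) (ih _ ?_ q hqm.1 (hqle b hb hlt) rfl)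
      rw [← hn]
      refine Finset.card_lt_card ⟨fun y hy => ?_, fun hh => ?_⟩
      · simp only [Finset.mem_filter] at hy ⊢
        exact ⟨hy.1, hqm.2.trans hy.2⟩
      · have := hh (show q ∈ S.filter (fun y => a < y) by simp [hqm])
        simp at this
  exact fun a ha hab => key _ a ha hab rfl

lemma hasDerivAt_tanh (x : ℝ) : HasDerivAt tanh (1 - tanh x ^ 2) x := by
  have h := (hasDerivAt_sinh x).div (hasDerivAt_cosh x) (cosh_pos x).ne'
  have e : tanh = fun y => sinh y / cosh y := by ext y; exact tanh_eq_sinh_div_cosh y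
  rw [e]
  refine h.congr_deriv ?_
  have := (cosh_pos x).ne'
  field_simp

lemma GC_logcosh : GC 2 (fun x => log (cosh x)) tanh (fun x => 1 - tanh x ^ 2)
    (fun x => -(2 * tanh x * (1 - tanh x ^ 2))) := by
  have sq1 : ∀ y, tanh y ^ 2 ≤ 1 := fun y => by
    rw [← sq_abs]; exact pow_le_one₀ (abs_nonneg _) (abs_tanh_lt_one y).le
  have ct : Continuous tanh := continuous_iff_continuousAt.2 fun y => (hasDerivAt_tanh y).continuousAt
  constructor
  · intro y
    refine ((hasDerivAt_cosh y).log (cosh_pos y).ne').congr_deriv ?_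
    rw [tanh_eq_sinh_div_cosh]
  · exact hasDerivAt_tanh
  · intro y
    refine (((hasDerivAt_tanh y).pow 2).const_sub 1).congr_deriv ?_
    simp
  · fun_prop
  · exact fun y => (abs_tanh_lt_one y).le
  · exact fun y => by linarith [sq1 y]
  · exact fun y => le_rfl
  · intro y
    have h1 := (abs_tanh_lt_one y).le
    have h2 := sq1 y
    rw [abs_neg, abs_mul, abs_mul, abs_of_pos (two_pos), abs_of_nonneg (show 0 ≤ 1 - tanh y ^ 2 by linarith)]
    nlinarith [abs_nonneg (tanh y), sq_nonneg (tanh y)]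

/-- regularity class, with actual derivatives -/
def GD (K : ℝ) (f : ℝ → ℝ) : Prop := GC K f (deriv f) (iteratedDeriv 2 f) (deriv (iteratedDeriv 2 f))

lemma GC.eqs {K : ℝ} {f f1 f2 f3 : ℝ → ℝ} (h : GC K f f1 f2 f3) :
    f1 = deriv f ∧ f2 = iteratedDeriv 2 f ∧ f3 = deriv (iteratedDeriv 2 f) := by
  have e1 : f1 = deriv f := by ext y; exact (h.d0 y).deriv.symm
  have e2 : f2 = iteratedDeriv 2 f := by
    rw [iteratedDeriv_succ, iteratedDeriv_one, ← e1]
    ext y; exact (h.d1 y).deriv.symm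
  refine ⟨e1, e2, ?_⟩
  rw [← e2]
  ext y; exact (h.d2 y).deriv.symm

lemma GC.toGD {K : ℝ} {f f1 f2 f3 : ℝ → ℝ} (h : GC K f f1 f2 f3) : GD K f := by
  obtain ⟨e1, e2, e3⟩ := h.eqs
  unfold GD
  rw [← e3, ← e2, ← e1]; exact h

lemma GC.mono {K K' : ℝ} {f f1 f2 f3 : ℝ → ℝ} (h : GC K f f1 f2 f3) (hK : K ≤ K') : GC K' f f1 f2 f3 :=
  ⟨h.d0, h.d1, h.d2, h.c3, h.b1, h.p2, h.b2, fun y => (h.b3 y).trans hK⟩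

/-- uniform constant -/
def KK (β : ℕ → ℝ) : ℝ := 4 * exp (3 * CG √(xiD β 1) * xiD β 1)

lemma CG_nonneg (c : ℝ) : 0 ≤ CG c := by
  have := Cm_nonneg c 2
  unfold CG; positivity

section
variable {ν : Measure ℝ} {S : Finset ℝ} {β : ℕ → ℝ} {Φ : ℝ → ℝ → ℝ}

lemma Grid.sig (h : Grid ν S) (hβ : ValidBeta β) {p q : ℝ} (hpq : Cons S p q) :
    0 ≤ xiD β q - xiD β p ∧ √(xiD β q - xiD β p) ^ 2 = xiD β q - xiD β p ∧
    √(xiD β q - xiD β p) ≤ √(xiD β 1) := by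
  have hp := h.sub p hpq.hp
  have hq := h.sub q hpq.hq
  have h1 := xiD_mono hβ hp.1 hpq.lt.le hq.2
  have h2 := xiD_mono hβ hq.1 hq.2 le_rfl
  have h3 := xiD_nonneg β hp.1
  exact ⟨by linarith, Real.sq_sqrt (by linarith), Real.sqrt_le_sqrt (by linarith)⟩

lemma Grid.GD (h : Grid ν S) (hβ : ValidBeta β) (hΦ : IsAtomicSol β ν Φ) :
    ∀ p ∈ S, GD (KK β) (Φ p) := by
  set C := 3 * CG √(xiD β 1) with hC
  have hC0 : 0 ≤ C := by have := CG_nonneg √(xiD β 1); positivity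
  have key : ∀ p ∈ S, p ≤ 1 → Parisi.GD (4 * exp (C * (xiD β 1 - xiD β p)) - 2) (Φ p) := by
    refine Cons.induct h.one ?_ ?_
    · rw [show Φ 1 = fun x => log (cosh x) from funext hΦ.1]
      have := GC_logcosh.toGD
      rw [sub_self, mul_zero, exp_zero]
      norm_num
      exact this
    · intro p q hpq _ hq
      obtain ⟨s1, s2, s3⟩ := h.sig hβ hpq
      have st := GC.step hq (distF_nonneg ν p) (distF_le_one h.mem p) (Real.sqrt_nonneg _) s3
      rw [← h.step hΦ hpq, s2] at st
      refine (st.mono ?_).toGD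
      have e1 : exp (C * (xiD β 1 - xiD β p)) = exp (C * (xiD β 1 - xiD β q)) * exp (C * (xiD β q - xiD β p)) := by
        rw [← exp_add]; congr 1; ring
      rw [e1, sub_add_cancel, ← mul_assoc]
      have := add_one_le_exp (C * (xiD β q - xiD β p))
      gcongr
      linarith
  intro p hp
  have h1 := key p hp (h.sub p hp).2
  refine (GC.mono h1 ?_).toGD
  have h2 := xiD_nonneg β (h.sub p hp).1
  have : exp (C * (xiD β 1 - xiD β p)) ≤ exp (C * xiD β 1) := by gcongr; linarith
  unfold KK
  linarith

lemma Grid.T2 (h : Grid ν S) (hβ : ValidBeta β) (hΦ : IsAtomicSol β ν Φ) {p q : ℝ} (hpq : Cons S p q) :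
    iteratedDeriv 2 (Φ p) = T2 (Φ q) (deriv (Φ q)) (iteratedDeriv 2 (Φ q)) (_root_.distF ν p) √(xiD β q - xiD β p) := by
  obtain ⟨s1, s2, s3⟩ := h.sig hβ hpq
  have st := GC.step (h.GD hβ hΦ q hpq.hq) (distF_nonneg ν p) (distF_le_one h.mem p) (Real.sqrt_nonneg _) s3
  rw [← h.step hΦ hpq] at st
  exact st.eqs.2.1.symm

lemma Grid.time (h : Grid ν S) (hβ : ValidBeta β) (hΦ : IsAtomicSol β ν Φ) {a b : ℝ} (ha : a ∈ S) (hb : b ∈ S)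
    (hab : a ≤ b) (x : ℝ) :
    |Φ a x - Φ b x| ≤ 2 * Cm √(xiD β 1) 2 * (xiD β b - xiD β a) := by
  refine Cons.induct (Pr := fun a => |Φ a x - Φ b x| ≤ 2 * Cm √(xiD β 1) 2 * (xiD β b - xiD β a)) hb (by simp) ?_ a ha hab
  intro p q hpq _ hq
  obtain ⟨s1, s2, s3⟩ := h.sig hβ hpq
  have st := GC.T_sub (h.GD hβ hΦ q hpq.hq) (distF_nonneg ν p) (distF_le_one h.mem p) (Real.sqrt_nonneg _) s3 x
  rw [← h.step hΦ hpq, s2] at st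
  have := abs_sub_le (Φ p x) (Φ q x) (Φ b x)
  linarith

end

lemma gridpts (N : ℕ) (hN : 0 < N) {p q : ℝ} (hp : 0 ≤ p) (hq : q ≤ 1) (S : Finset ℝ)
    (hS : ∀ i : ℕ, i ≤ N → (i : ℝ) / N ∈ S) (h : Cons S p q) : q - p ≤ 1 / N := by
  by_contra h1
  push Not at h1
  have hN' : (0 : ℝ) < N := by positivity
  have f1 := Nat.floor_le (show 0 ≤ (N : ℝ) * p by positivity)
  have f2 := Nat.lt_floor_add_one ((N : ℝ) * p)
  set i := ⌊(N : ℝ) * p⌋₊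
  have h2 : ((i + 1 : ℕ) : ℝ) / N < q := by
    rw [div_lt_iff₀ hN']; push_cast
    rw [div_lt_iff₀ hN'] at h1
    nlinarith
  have h3 : p < ((i + 1 : ℕ) : ℝ) / N := by
    rw [lt_div_iff₀ hN']; push_cast; linarith
  refine h.nb _ (hS (i + 1) ?_) ⟨h3, h2⟩
  have : ((i + 1 : ℕ) : ℝ) / N ≤ 1 := by linarith
  rw [div_le_one hN'] at this
  exact_mod_cast this

lemma int_shift {μ : Measure ℝ} (hμ : MemM μ) {h : ℝ} (h0 : 0 ≤ h) :
    ∫ s in (0 : ℝ)..1, (distF μ s - distF μ (s - h)) ≤ h := by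
  have hm := distF_mono hμ
  have i1 : ∀ a b : ℝ, IntervalIntegrable (distF μ) volume a b := fun a b => hm.intervalIntegrable
  have hm2 : Monotone fun s => distF μ (s - h) := fun a b hab => hm (by linarith)
  rw [intervalIntegral.integral_sub (i1 _ _) hm2.intervalIntegrable,
    intervalIntegral.integral_comp_sub_right,
    intervalIntegral.integral_interval_sub_interval_comm (i1 _ _) (i1 _ _) (i1 _ _),
    intervalIntegral.integral_symm (0 - h) 0]
  have h1 : 0 ≤ ∫ s in (0 - h)..0, distF μ s := intervalIntegral.integral_nonneg (by linarith) fun u _ => distF_nonneg μ u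
  have h2 : ∫ s in (1 - h)..1, distF μ s ≤ ∫ s in (1 - h)..1, 1 :=
    intervalIntegral.integral_mono_on (by linarith) (i1 _ _) intervalIntegrable_const fun u _ => distF_le_one hμ u
  rw [intervalIntegral.integral_const, intervalIntegral.integral_symm (1 - h) 1] at *
  simp at h2
  linarith

lemma exists_grid {μ : Measure ℝ} (hμ : MemM μ) {a b η : ℝ} (ha : a ∈ Icc (0 : ℝ) 1) (hb : b ∈ Icc (0 : ℝ) 1)
    (hη : 0 < η) : ∃ (ν : Measure ℝ) (S : Finset ℝ), Grid ν S ∧ a ∈ S ∧ b ∈ S ∧ dM μ ν < η ∧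
      ∀ p q, Cons S p q → q - p < η := by
  classical
  haveI := hμ.1
  obtain ⟨n, hn⟩ := exists_nat_one_div_lt (show 0 < η / 2 by positivity)
  set N := n + 1 with hN
  have hN0 : 0 < N := by omega
  have hNr : (0 : ℝ) < N := by positivity
  have hn' : 1 / (N : ℝ) < η / 2 := by rw [hN]; push_cast; exact hn
  set S : Finset ℝ := insert a (insert b ((Finset.range (N + 1)).image fun i : ℕ => (i : ℝ) / N)) with hS
  have hSi : ∀ i : ℕ, i ≤ N → (i : ℝ) / N ∈ S := fun i hi => by
    simp only [hS, Finset.mem_insert, Finset.mem_image, Finset.mem_range]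
    exact Or.inr (Or.inr ⟨i, by omega, rfl⟩)
  have hS1 : (1 : ℝ) ∈ S := by
    have := hSi N le_rfl; rwa [div_self hNr.ne'] at this
  have hSsub : ∀ q ∈ S, q ∈ Icc (0 : ℝ) 1 := by
    intro q hq
    simp only [hS, Finset.mem_insert, Finset.mem_image, Finset.mem_range] at hq
    rcases hq with rfl | rfl | ⟨i, hi, rfl⟩
    · exact ha
    · exact hb
    · exact ⟨by positivity, by rw [div_le_one hNr]; exact_mod_cast (show i ≤ N by omega)⟩
  set g : ℝ → ℝ := fun y => (⌈(N : ℝ) * y⌉₊ : ℝ) / N with hg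
  have gm : Measurable g := by
    refine Measurable.div_const ?_ _
    exact (measurable_from_nat (f := fun k : ℕ => (k : ℝ))).comp (Nat.measurable_ceil.comp (measurable_const_mul _))
  have g1 : ∀ y, y ≤ g y := fun y => by
    rw [hg, le_div_iff₀ hNr, mul_comm]; exact Nat.le_ceil _
  have g0 : ∀ y, 0 ≤ g y := fun y => by positivity
  have g2 : ∀ y, 0 ≤ y → g y ≤ y + 1 / N := fun y hy => by
    rw [hg, div_le_iff₀ hNr]
    have := (Nat.ceil_lt_add_one (show 0 ≤ (N : ℝ) * y by positivity)).le
    field_simp; linarith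
  have gS : ∀ y ∈ Icc (0 : ℝ) 1, g y ∈ S := fun y hy => by
    refine hSi _ (Nat.ceil_le.2 ?_)
    nlinarith [hy.2]
  set c : ℝ := (S.card : ℝ) with hc
  have hc0 : 0 < c := by
    have : 0 < S.card := Finset.card_pos.2 ⟨1, hS1⟩
    rw [hc]; exact_mod_cast this
  set ε := min (η / 2) 1 with hε
  have ε0 : 0 < ε := by positivity
  have ε1 : ε ≤ 1 := min_le_right _ _
  have ε2 : ε ≤ η / 2 := min_le_left _ _
  set U : Measure ℝ := ∑ q ∈ S, Measure.dirac q with hU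
  have Uap : ∀ E : Set ℝ, MeasurableSet E → U E = ((S.filter (· ∈ E)).card : ℝ≥0∞) := fun E hE => by
    simp only [hU, Measure.finset_sum_apply, Measure.dirac_apply' _ hE]
    rw [Finset.card_filter]
    push_cast
    refine Finset.sum_congr rfl fun q _ => ?_
    by_cases h : q ∈ E <;> simp [h]
  set ν0 := μ.map g with hν0
  haveI : IsProbabilityMeasure ν0 := Measure.isProbabilityMeasure_map gm.aemeasurable
  set ν : Measure ℝ := ENNReal.ofReal (1 - ε) • ν0 + ENNReal.ofReal (ε / c) • U with hν
  have νap : ∀ E : Set ℝ, ν E = ENNReal.ofReal (1 - ε) * ν0 E + ENNReal.ofReal (ε / c) * U E := fun E => by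
    simp [hν]
  have Uuniv : U univ = ENNReal.ofReal c := by
    rw [Uap _ MeasurableSet.univ]; simp [hc]
  have hprob : IsProbabilityMeasure ν := ⟨by
    rw [νap, Uuniv, measure_univ, mul_one, ← ENNReal.ofReal_mul (by positivity), div_mul_cancel₀ _ hc0.ne',
      ← ENNReal.ofReal_add (by linarith) ε0.le]
    simp⟩
  have hsupp : ν ((S : Set ℝ))ᶜ = 0 := by
    have hm : MeasurableSet ((S : Set ℝ))ᶜ := S.measurableSet.compl
    rw [νap, Uap _ hm, hν0, Measure.map_apply gm hm]
    have e1 : μ (g ⁻¹' ((S : Set ℝ))ᶜ) = 0 :=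
      measure_mono_null (fun y hy h2 => hy (gS y h2)) hμ.2
    rw [e1]; simp
  have hmem : MemM ν := ⟨hprob, measure_mono_null (compl_subset_compl.2 fun q hq => hSsub q hq) hsupp⟩
  have hG : Grid ν S := ⟨hmem, hsupp, fun q hq h0 => by
    rw [νap, Uap _ (measurableSet_singleton q)] at h0
    have h2 := (add_eq_zero.1 h0).2
    rw [mul_eq_zero] at h2
    rcases h2 with h2 | h2
    · rw [ENNReal.ofReal_eq_zero] at h2
      have : 0 < ε / c := by positivity
      linarith
    · norm_cast at h2
      rw [Finset.card_eq_zero] at h2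
      rw [Finset.filter_eq_empty_iff] at h2
      exact h2 hq (mem_singleton q), hSsub, hS1⟩
  refine ⟨ν, S, hG, by simp [hS], by simp [hS], ?_, ?_⟩
  swap
  · intro p q hpq
    have := gridpts N hN0 (hSsub p hpq.hp).1 (hSsub q hpq.hq).2 S hSi hpq
    linarith
  -- the distance
  have hD : ∀ s, distF ν s = (1 - ε) * distF ν0 s + (ε / c) * (U (Icc 0 s)).toReal := fun s => by
    unfold distF
    rw [νap, ENNReal.toReal_add, ENNReal.toReal_mul, ENNReal.toReal_mul, ENNReal.toReal_ofReal (by linarith),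
      ENNReal.toReal_ofReal (by positivity)]
    · exact ENNReal.mul_ne_top ENNReal.ofReal_ne_top (measure_ne_top _ _)
    · refine ENNReal.mul_ne_top ENNReal.ofReal_ne_top ?_
      rw [Uap _ measurableSet_Icc]; simp
  have d01 : ∀ s, distF ν0 s ≤ 1 := fun s => measureReal_le_one
  have d0 : ∀ s, distF ν0 s ≤ distF μ s := fun s => by
    unfold distF
    refine ENNReal.toReal_mono (measure_ne_top _ _) ?_
    rw [hν0, Measure.map_apply gm measurableSet_Icc]
    have : g ⁻¹' Icc 0 s ⊆ Icc 0 s ∪ (Icc (0 : ℝ) 1)ᶜ := fun y hy => by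
      by_cases h : y ∈ Icc (0 : ℝ) 1
      · exact Or.inl ⟨h.1, (g1 y).trans hy.2⟩
      · exact Or.inr h
    refine (measure_mono this).trans ((measure_union_le _ _).trans ?_)
    rw [hμ.2, add_zero]
  have d2 : ∀ s, distF μ (s - 1 / N) ≤ distF ν0 s := fun s => by
    unfold distF
    refine ENNReal.toReal_mono (measure_ne_top _ _) ?_
    rw [hν0, Measure.map_apply gm measurableSet_Icc]
    refine measure_mono fun y hy => ⟨g0 y, ?_⟩
    have := g2 y hy.1
    linarith [hy.2]
  have d3 : ∀ s, 0 ≤ (U (Icc 0 s)).toReal ∧ (U (Icc 0 s)).toReal ≤ c := fun s => by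
    refine ⟨ENNReal.toReal_nonneg, ?_⟩
    rw [Uap _ measurableSet_Icc, ENNReal.toReal_natCast, hc]
    exact_mod_cast Finset.card_filter_le _ _
  have pt : ∀ s, |distF μ s - distF ν s| ≤ (distF μ s - distF μ (s - 1 / N)) + ε := fun s => by
    have q1 := d0 s
    have q2 := d2 s
    have q3 := d01 s
    have q4 := distF_nonneg ν0 s
    have q5 : 0 ≤ (ε / c) * (U (Icc 0 s)).toReal := mul_nonneg (by positivity) (d3 s).1
    have q6 : (ε / c) * (U (Icc 0 s)).toReal ≤ ε := by
      calc _ ≤ (ε / c) * c := mul_le_mul_of_nonneg_left (d3 s).2 (by positivity)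
        _ = ε := by field_simp
    rw [hD, abs_le]
    constructor <;> nlinarith
  have hm := distF_mono hμ
  have hm2 : Monotone fun s => distF μ (s - 1 / N) := fun a b hab => hm (by linarith)
  have i2 : IntervalIntegrable (fun s => distF μ s - distF μ (s - 1 / N)) volume 0 1 :=
    hm.intervalIntegrable.sub hm2.intervalIntegrable
  have i1 : IntervalIntegrable (fun s => |distF μ s - distF ν s|) volume 0 1 :=
    (hm.intervalIntegrable.sub (distF_mono hmem).intervalIntegrable).abs
  have : dM μ ν ≤ ∫ s in (0 : ℝ)..1, ((distF μ s - distF μ (s - 1 / N)) + ε) :=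
    intervalIntegral.integral_mono_on zero_le_one i1 (i2.add intervalIntegrable_const) fun s _ => pt s
  rw [intervalIntegral.integral_add i2 intervalIntegrable_const] at this
  have sh := int_shift hμ (h := 1 / N) (by positivity)
  simp only [intervalIntegral.integral_const, sub_zero, one_smul] at this
  linarith

end Parisi

end

section
open MeasureTheory ProbabilityTheory Real Set Filter
open scoped Topology NNReal ENNReal

namespace Parisi

/-- quantitative `C^{2,1}` class, closed under uniform limits -/
structure Q (K : ℝ) (f f1 f2 : ℝ → ℝ) : Prop where
  t0 : ∀ x y, |f y - f x - f1 x * (y - x)| ≤ 1 * |y - x| ^ 2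
  t1 : ∀ x y, |f1 y - f1 x - f2 x * (y - x)| ≤ K * |y - x| ^ 2
  b1 : ∀ y, |f1 y| ≤ 1
  p2 : ∀ y, 0 ≤ f2 y
  b2 : ∀ y, f2 y ≤ 1
  l1 : ∀ x y, |f1 x - f1 y| ≤ 1 * |x - y|
  l2 : ∀ x y, |f2 x - f2 y| ≤ K * |x - y|

lemma GC.toQ {K : ℝ} {f f1 f2 f3 : ℝ → ℝ} (h : GC K f f1 f2 f3) : Q K f f1 f2 where
  t0 := fun x y => taylor1 h.d0 h.lip1 x y
  t1 := fun x y => taylor1 h.d1 h.lip2 x y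
  b1 := h.b1
  p2 := h.p2
  b2 := fun y => (h.b2 y).trans (by nlinarith [sq_nonneg (f1 y)])
  l1 := h.lip1
  l2 := h.lip2

lemma hasDerivAt_of_quad {f f1 : ℝ → ℝ} {L : ℝ} (h : ∀ x y, |f y - f x - f1 x * (y - x)| ≤ L * |y - x| ^ 2) (x : ℝ) :
    HasDerivAt f (f1 x) x := by
  rw [hasDerivAt_iff_isLittleO]
  have h1 : (fun y => f y - f x - (y - x) • f1 x) =O[𝓝 x] fun y => (y - x) ^ 2 := by
    refine Asymptotics.IsBigO.of_bound L (Eventually.of_forall fun y => ?_)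
    rw [smul_eq_mul, mul_comm (y - x), Real.norm_eq_abs, norm_pow, Real.norm_eq_abs]
    exact h x y
  refine h1.trans_isLittleO ?_
  have h2 : (fun y : ℝ => (y - x) ^ 2) = fun y => (y - x) * (y - x) := by ext y; ring
  rw [h2]
  have h3 : (fun y : ℝ => (y - x)) =o[𝓝 x] fun _ => (1 : ℝ) := by
    rw [Asymptotics.isLittleO_one_iff]
    have : Tendsto (fun y : ℝ => y - x) (𝓝 x) (𝓝 (x - x)) := by
      apply Continuous.tendsto; fun_prop
    simpa using this
  have h4 := (Asymptotics.isBigO_refl (fun y : ℝ => y - x) (𝓝 x)).mul_isLittleO h3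
  simpa using h4

lemma Q.eqs {K : ℝ} {f f1 f2 : ℝ → ℝ} (h : Q K f f1 f2) : f1 = deriv f ∧ f2 = iteratedDeriv 2 f := by
  have e1 : f1 = deriv f := by ext y; exact (hasDerivAt_of_quad h.t0 y).deriv.symm
  refine ⟨e1, ?_⟩
  rw [iteratedDeriv_succ, iteratedDeriv_one, ← e1]
  ext y; exact (hasDerivAt_of_quad h.t1 y).deriv.symm

/-- same, with actual derivatives -/
def QD (K : ℝ) (f : ℝ → ℝ) : Prop := Q K f (deriv f) (iteratedDeriv 2 f)

lemma Q.toQD {K : ℝ} {f f1 f2 : ℝ → ℝ} (h : Q K f f1 f2) : QD K f := by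
  obtain ⟨e1, e2⟩ := h.eqs
  unfold QD
  rw [← e2, ← e1]; exact h

lemma interp0 {f g f1 g1 : ℝ → ℝ} {L ε : ℝ} (ε0 : 0 ≤ ε)
    (hf : ∀ x y, |f y - f x - f1 x * (y - x)| ≤ L * |y - x| ^ 2)
    (hg : ∀ x y, |g y - g x - g1 x * (y - x)| ≤ L * |y - x| ^ 2)
    (hfg : ∀ x, |f x - g x| ≤ ε) (x : ℝ) : |f1 x - g1 x| ≤ 2 * (1 + L) * √ε := by
  have key : ∀ e, ε < e → |f1 x - g1 x| ≤ 2 * (1 + L) * √e := by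
    intro e he
    have e0 : 0 < e := by linarith
    have s0 := Real.sqrt_pos.2 e0
    have ss := Real.mul_self_sqrt e0.le
    set h := √e
    have a1 := hf x (x + h)
    have a2 := hg x (x + h)
    rw [add_sub_cancel_left, abs_of_pos s0] at a1 a2
    have a3 := hfg x
    have a4 := hfg (x + h)
    have a5 : |f1 x - g1 x| * h ≤ (2 * (1 + L) * h) * h := by
      rw [← abs_of_pos s0, ← abs_mul, abs_of_pos s0]
      rw [abs_le] at *
      constructor <;> nlinarith
    exact le_of_mul_le_mul_right a5 s0
  have ht : Tendsto (fun e => 2 * (1 + L) * √e) (𝓝[>] ε) (𝓝 (2 * (1 + L) * √ε)) := by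
    apply Tendsto.mono_left _ nhdsWithin_le_nhds
    apply Continuous.tendsto; fun_prop
  exact ge_of_tendsto ht (eventually_nhdsWithin_of_forall fun e he => key e he)

/-- modulus for first derivatives -/
def om1 (ε : ℝ) : ℝ := 2 * (1 + 1) * √ε
/-- modulus for second derivatives -/
def om2 (K ε : ℝ) : ℝ := 2 * (1 + K) * √(om1 ε)

lemma om1_cont : Continuous om1 := by unfold om1; fun_prop
lemma om2_cont (K : ℝ) : Continuous (om2 K) := by
  have := om1_cont
  unfold om2; fun_prop
lemma om1_zero : om1 0 = 0 := by simp [om1]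
lemma om2_zero (K : ℝ) : om2 K 0 = 0 := by simp [om2, om1]
lemma om1_nonneg (ε : ℝ) : 0 ≤ om1 ε := by unfold om1; positivity

lemma Q.interp1 {K : ℝ} {f f1 f2 g g1 g2 : ℝ → ℝ} (hf : Q K f f1 f2) (hg : Q K g g1 g2) {ε : ℝ} (ε0 : 0 ≤ ε)
    (hfg : ∀ x, |f x - g x| ≤ ε) (x : ℝ) : |f1 x - g1 x| ≤ om1 ε :=
  interp0 ε0 hf.t0 hg.t0 hfg x

lemma Q.interp2 {K : ℝ} {f f1 f2 g g1 g2 : ℝ → ℝ} (hf : Q K f f1 f2) (hg : Q K g g1 g2) {ε : ℝ} (ε0 : 0 ≤ ε)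
    (hfg : ∀ x, |f x - g x| ≤ ε) (x : ℝ) : |f2 x - g2 x| ≤ om2 K ε :=
  interp0 (om1_nonneg ε) hf.t1 hg.t1 (hf.interp1 hg ε0 hfg) x

lemma QD.closure {K : ℝ} {f : ℝ → ℝ} (h : ∀ ε > 0, ∃ g, QD K g ∧ ∀ x, |f x - g x| ≤ ε) : QD K f := by
  have h' : ∀ n : ℕ, ∃ g, QD K g ∧ ∀ x, |f x - g x| ≤ 1 / ((n : ℝ) + 1) := fun n => h _ (by positivity)
  choose g hg hfg using h'
  have inv : ∀ (n N : ℕ), N ≤ n → 1 / ((n : ℝ) + 1) ≤ 1 / ((N : ℝ) + 1) := fun n N hN => by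
    have : (N : ℝ) ≤ n := by exact_mod_cast hN
    gcongr
  have t0 := tendsto_one_div_add_atTop_nhds_zero_nat (𝕜 := ℝ)
  have t0' : Tendsto (fun N : ℕ => 2 * (1 / ((N : ℝ) + 1))) atTop (𝓝 0) := by simpa using t0.const_mul 2
  have dd : ∀ n m N, N ≤ n → N ≤ m → ∀ x, |g n x - g m x| ≤ 2 * (1 / ((N : ℝ) + 1)) := fun n m N hn hm x => by
    have a1 := hfg n x
    have a2 := hfg m x
    have a3 := inv n N hn
    have a4 := inv m N hm
    rw [abs_sub_comm] at a1
    have := abs_sub_le (g n x) (f x) (g m x)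
    linarith
  have c1 : ∀ x, ∃ l, Tendsto (fun n => deriv (g n) x) atTop (𝓝 l) := fun x =>
    cauchySeq_tendsto_of_complete (cauchySeq_of_le_tendsto_0 (fun N : ℕ => om1 (2 * (1 / ((N : ℝ) + 1))))
      (fun n m N hn hm => (hg n).interp1 (hg m) (by positivity) (dd n m N hn hm) x)
      (by have := (om1_cont.tendsto 0).comp t0'; rwa [om1_zero] at this))
  have c2 : ∀ x, ∃ l, Tendsto (fun n => iteratedDeriv 2 (g n) x) atTop (𝓝 l) := fun x =>
    cauchySeq_tendsto_of_complete (cauchySeq_of_le_tendsto_0 (fun N : ℕ => om2 K (2 * (1 / ((N : ℝ) + 1))))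
      (fun n m N hn hm => (hg n).interp2 (hg m) (by positivity) (dd n m N hn hm) x)
      (by have := ((om2_cont K).tendsto 0).comp t0'; rwa [om2_zero] at this))
  choose f1 hf1 using c1
  choose f2 hf2 using c2
  have hf0 : ∀ x, Tendsto (fun n => g n x) atTop (𝓝 (f x)) := fun x => by
    rw [tendsto_iff_dist_tendsto_zero]
    refine squeeze_zero (fun _ => dist_nonneg) (fun n => ?_) t0
    rw [dist_comm]; exact hfg n x
  refine Q.toQD (f1 := f1) (f2 := f2) ⟨fun x y => ?_, fun x y => ?_, fun y => ?_, fun y => ?_, fun y => ?_, fun x y => ?_, fun x y => ?_⟩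
  · exact le_of_tendsto (((hf0 y).sub (hf0 x)).sub ((hf1 x).mul_const _)).abs (Eventually.of_forall fun n => (hg n).t0 x y)
  · exact le_of_tendsto (((hf1 y).sub (hf1 x)).sub ((hf2 x).mul_const _)).abs (Eventually.of_forall fun n => (hg n).t1 x y)
  · exact le_of_tendsto (hf1 y).abs (Eventually.of_forall fun n => (hg n).b1 y)
  · exact ge_of_tendsto (hf2 y) (Eventually.of_forall fun n => (hg n).p2 y)
  · exact le_of_tendsto (hf2 y) (Eventually.of_forall fun n => (hg n).b2 y)
  · exact le_of_tendsto ((hf1 x).sub (hf1 y)).abs (Eventually.of_forall fun n => (hg n).l1 x y)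
  · exact le_of_tendsto ((hf2 x).sub (hf2 y)).abs (Eventually.of_forall fun n => (hg n).l2 x y)

section
variable {β : ℕ → ℝ} {Φ : Measure ℝ → ℝ → ℝ → ℝ} {μ : Measure ℝ}

lemma KK_nonneg (β : ℕ → ℝ) : 0 ≤ KK β := by unfold KK; positivity

lemma Phi_QD (hβ : ValidBeta β) (hΦ : IsParisiFamily β Φ) (hμ : MemM μ) {r : ℝ} (hr : r ∈ Icc (0 : ℝ) 1) :
    QD (KK β) (Φ μ r) := by
  refine QD.closure fun ε hε => ?_
  obtain ⟨δ, δ0, hδ⟩ := hΦ.2 μ hμ ε hε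
  obtain ⟨ν, S, hG, hrS, -, hd, -⟩ := exists_grid hμ hr hr δ0
  exact ⟨Φ ν r, (hG.GD hβ (hΦ.1 ν hG.mem hG.fin) r hrS).toQ.toQD, fun x => (hδ ν hG.mem hd r hr x).le⟩

/-- time modulus constant -/
def CT (β : ℕ → ℝ) : ℝ := 2 * Cm √(xiD β 1) 2

lemma CT_nonneg (β : ℕ → ℝ) : 0 ≤ CT β := by have := Cm_nonneg √(xiD β 1) 2; unfold CT; positivity

lemma Phi_time (hβ : ValidBeta β) (hΦ : IsParisiFamily β Φ) (hμ : MemM μ) {a b : ℝ} (ha : 0 ≤ a) (hab : a ≤ b)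
    (hb : b ≤ 1) (x : ℝ) : |Φ μ a x - Φ μ b x| ≤ CT β * (xiD β b - xiD β a) := by
  refine le_of_forall_pos_le_add fun ε hε => ?_
  obtain ⟨δ, δ0, hδ⟩ := hΦ.2 μ hμ (ε / 2) (by positivity)
  have ha' : a ∈ Icc (0 : ℝ) 1 := ⟨ha, hab.trans hb⟩
  have hb' : b ∈ Icc (0 : ℝ) 1 := ⟨ha.trans hab, hb⟩
  obtain ⟨ν, S, hG, haS, hbS, hd, -⟩ := exists_grid hμ ha' hb' δ0
  have h1 := hδ ν hG.mem hd a ha' x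
  have h2 := hδ ν hG.mem hd b hb' x
  have h3 := hG.time hβ (hΦ.1 ν hG.mem hG.fin) haS hbS hab x
  have h4 := abs_sub_le (Φ μ a x) (Φ ν a x) (Φ μ b x)
  have h5 := abs_sub_le (Φ ν a x) (Φ ν b x) (Φ μ b x)
  rw [abs_sub_comm (Φ ν b x)] at h5
  unfold CT
  linarith

lemma Phi_time' (hβ : ValidBeta β) (hΦ : IsParisiFamily β Φ) (hμ : MemM μ) {a b : ℝ} (ha : a ∈ Icc (0 : ℝ) 1)
    (hb : b ∈ Icc (0 : ℝ) 1) (x : ℝ) : |Φ μ a x - Φ μ b x| ≤ CT β * |xiD β a - xiD β b| := by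
  rcases le_total a b with h | h
  · rw [abs_sub_comm (xiD β a), abs_of_nonneg (sub_nonneg.2 (xiD_mono hβ ha.1 h hb.2))]
    exact Phi_time hβ hΦ hμ ha.1 h hb.2 x
  · rw [abs_sub_comm, abs_of_nonneg (sub_nonneg.2 (xiD_mono hβ hb.1 h ha.2))]
    exact Phi_time hβ hΦ hμ hb.1 h ha.2 x

lemma xiD_contOn (hβ : ValidBeta β) : ContinuousOn (xiD β) (Icc 0 1) := fun y hy =>
  (xiD_hasDerivAt hβ ⟨by linarith [hy.1], by linarith [hy.2]⟩).continuousAt.continuousWithinAt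

lemma contOn_aux (hβ : ValidBeta β) {F : ℝ → ℝ → ℝ} {om : ℝ → ℝ} (omc : Continuous om) (om0 : om 0 = 0) {K : ℝ}
    (hF : ∀ a ∈ Icc (0 : ℝ) 1, ∀ b ∈ Icc (0 : ℝ) 1, ∀ x, |F a x - F b x| ≤ om (CT β * |xiD β a - xiD β b|))
    (hL : ∀ a ∈ Icc (0 : ℝ) 1, ∀ x y, |F a x - F a y| ≤ K * |x - y|) {s t : ℝ} (hs : 0 ≤ s) (ht : t ≤ 1)
    {Y : ℝ → ℝ} (hY : ContinuousOn Y (Icc s t)) : ContinuousOn (fun v => F v (Y v)) (Icc s t) := by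
  intro v hv
  have sub : Icc s t ⊆ Icc (0 : ℝ) 1 := Icc_subset_Icc hs ht
  have hx := ((xiD_contOn hβ).mono sub) v hv
  have hy := hY v hv
  unfold ContinuousWithinAt at *
  rw [tendsto_iff_dist_tendsto_zero]
  have lim : Tendsto (fun w => om (CT β * |xiD β w - xiD β v|) + K * |Y w - Y v|) (𝓝[Icc s t] v) (𝓝 0) := by
    have l1 : Tendsto (fun w => CT β * |xiD β w - xiD β v|) (𝓝[Icc s t] v) (𝓝 0) := by
      simpa using ((hx.sub_const (xiD β v)).abs).const_mul (CT β)
    have l2 : Tendsto (fun w => K * |Y w - Y v|) (𝓝[Icc s t] v) (𝓝 0) := by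
      simpa using ((hy.sub_const (Y v)).abs).const_mul K
    have l3 := (omc.tendsto 0).comp l1
    rw [om0] at l3
    simpa using l3.add l2
  refine squeeze_zero' (Eventually.of_forall fun _ => dist_nonneg) ?_ lim
  refine eventually_nhdsWithin_of_forall fun w hw => ?_
  rw [Real.dist_eq]
  have h1 := hF w (sub hw) v (sub hv) (Y v)
  have h2 := hL w (sub hw) (Y w) (Y v)
  have := abs_sub_le (F w (Y w)) (F w (Y v)) (F v (Y v))
  linarith

lemma d1_time (hβ : ValidBeta β) (hΦ : IsParisiFamily β Φ) (hμ : MemM μ) {a b : ℝ} (ha : a ∈ Icc (0 : ℝ) 1)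
    (hb : b ∈ Icc (0 : ℝ) 1) (x : ℝ) :
    |deriv (Φ μ a) x - deriv (Φ μ b) x| ≤ om1 (CT β * |xiD β a - xiD β b|) :=
  (Phi_QD hβ hΦ hμ ha).interp1 (Phi_QD hβ hΦ hμ hb) (mul_nonneg (CT_nonneg β) (abs_nonneg _))
    (Phi_time' hβ hΦ hμ ha hb) x

lemma d2_time (hβ : ValidBeta β) (hΦ : IsParisiFamily β Φ) (hμ : MemM μ) {a b : ℝ} (ha : a ∈ Icc (0 : ℝ) 1)
    (hb : b ∈ Icc (0 : ℝ) 1) (x : ℝ) :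
    |iteratedDeriv 2 (Φ μ a) x - iteratedDeriv 2 (Φ μ b) x| ≤ om2 (KK β) (CT β * |xiD β a - xiD β b|) :=
  (Phi_QD hβ hΦ hμ ha).interp2 (Phi_QD hβ hΦ hμ hb) (mul_nonneg (CT_nonneg β) (abs_nonneg _))
    (Phi_time' hβ hΦ hμ ha hb) x

lemma d1_contOn (hβ : ValidBeta β) (hΦ : IsParisiFamily β Φ) (hμ : MemM μ) {s t : ℝ} (hs : 0 ≤ s) (ht : t ≤ 1)
    {Y : ℝ → ℝ} (hY : ContinuousOn Y (Icc s t)) : ContinuousOn (fun v => deriv (Φ μ v) (Y v)) (Icc s t) :=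
  contOn_aux (F := fun v => deriv (Φ μ v)) hβ om1_cont om1_zero
    (fun _ ha _ hb x => d1_time hβ hΦ hμ ha hb x) (fun _ ha x y => (Phi_QD hβ hΦ hμ ha).l1 x y) hs ht hY

lemma d2_contOn (hβ : ValidBeta β) (hΦ : IsParisiFamily β Φ) (hμ : MemM μ) {s t : ℝ} (hs : 0 ≤ s) (ht : t ≤ 1)
    {Y : ℝ → ℝ} (hY : ContinuousOn Y (Icc s t)) : ContinuousOn (fun v => iteratedDeriv 2 (Φ μ v) (Y v)) (Icc s t) :=
  contOn_aux (F := fun v => iteratedDeriv 2 (Φ μ v)) hβ (om2_cont _) (om2_zero _)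
    (fun _ ha _ hb x => d2_time hβ hΦ hμ ha hb x) (fun _ ha x y => (Phi_QD hβ hΦ hμ ha).l2 x y) hs ht hY

end

end Parisi

end

section
open MeasureTheory ProbabilityTheory Real Set Filter
open scoped Topology NNReal ENNReal

namespace Parisi

lemma joint_meas {Ω : Type*} {m : MeasurableSpace Ω} {a b : ℝ} (hab : a ≤ b) {Y : ℝ → Ω → ℝ}
    (hc : ∀ ω, ContinuousOn (fun v => Y v ω) (Icc a b)) (hm : ∀ v ∈ Icc a b, Measurable (Y v)) :
    Measurable (fun z : ℝ × Ω => Y (projIcc a b hab z.1) z.2) := by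
  have := measurable_uncurry_of_continuous_of_measurable (u := fun (v : ℝ) ω => Y (projIcc a b hab v) ω)
    (fun ω => ?_) (fun v => hm _ (projIcc a b hab v).2)
  · exact this
  · exact (continuousOn_iff_continuous_restrict.1 (hc ω)).comp continuous_projIcc

lemma smeas_int {Ω : Type*} {m : MeasurableSpace Ω} {a b : ℝ} (hab : a ≤ b) {Y : ℝ → Ω → ℝ} {k k' : ℝ → ℝ}
    (hk : Measurable k') (hkk : ∀ v ∈ Icc a b, k v = k' v)
    (hc : ∀ ω, ContinuousOn (fun v => Y v ω) (Icc a b)) (hm : ∀ v ∈ Icc a b, Measurable (Y v)) :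
    StronglyMeasurable (fun ω => ∫ v in a..b, k v * Y v ω) := by
  have e : (fun ω => ∫ v in a..b, k v * Y v ω) =
      fun ω => ∫ v, k' v * Y (projIcc a b hab v) ω ∂(volume.restrict (Ioc a b)) := by
    ext ω
    rw [intervalIntegral.integral_of_le hab]
    refine setIntegral_congr_fun measurableSet_Ioc fun v hv => ?_
    have hv' := Ioc_subset_Icc_self hv
    simp only [hkk v hv', projIcc_of_mem hab hv']
  rw [e]
  have hj := joint_meas hab hc hm
  have h2 : Measurable (fun z : Ω × ℝ => k' z.2 * Y (projIcc a b hab z.2) z.1) :=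
    (hk.comp measurable_snd).mul (hj.comp measurable_swap)
  exact h2.stronglyMeasurable.integral_prod_right'

lemma fub {Ω : Type*} {m : MeasurableSpace Ω} {P : Measure Ω} [IsProbabilityMeasure P] {a b : ℝ} (hab : a ≤ b)
    {Y : ℝ → Ω → ℝ} {k k' : ℝ → ℝ} (hk : Measurable k') (hkk : ∀ v ∈ Icc a b, k v = k' v)
    (hki : IntervalIntegrable k volume a b) (hk0 : ∀ v ∈ Icc a b, 0 ≤ k v)
    (hc : ∀ ω, ContinuousOn (fun v => Y v ω) (Icc a b)) (hm : ∀ v ∈ Icc a b, Measurable (Y v))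
    {C e : ℝ} (hC : ∀ v ω, |Y v ω| ≤ C) (he : ∀ v ∈ Icc a b, ∫ ω, Y v ω ∂P ≤ e) :
    ∫ ω, (∫ v in a..b, k v * Y v ω) ∂P ≤ (∫ v in a..b, k v) * e := by
  have e1 : (fun ω => ∫ v in a..b, k v * Y v ω) =
      fun ω => ∫ v, k' v * Y (projIcc a b hab v) ω ∂(volume.restrict (Ioc a b)) := by
    ext ω
    rw [intervalIntegral.integral_of_le hab]
    refine setIntegral_congr_fun measurableSet_Ioc fun v hv => ?_
    have hv' := Ioc_subset_Icc_self hv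
    simp only [hkk v hv', projIcc_of_mem hab hv']
  have hj := joint_meas hab hc hm
  have h2 : Measurable (fun z : Ω × ℝ => k' z.2 * Y (projIcc a b hab z.2) z.1) :=
    (hk.comp measurable_snd).mul (hj.comp measurable_swap)
  have hk'i : Integrable k' (volume.restrict (Ioc a b)) := by
    rw [intervalIntegrable_iff_integrableOn_Ioc_of_le hab] at hki
    exact hki.congr_fun (fun v hv => hkk v (Ioc_subset_Icc_self hv)) measurableSet_Ioc
  have iprod : Integrable (fun z : Ω × ℝ => k' z.2 * Y (projIcc a b hab z.2) z.1) (P.prod (volume.restrict (Ioc a b))) := by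
    have := (hk'i.comp_snd (μ := P)).mul_bdd (c := C) (g := fun z : Ω × ℝ => Y (projIcc a b hab z.2) z.1)
      (hj.comp measurable_swap).aestronglyMeasurable (ae_of_all _ fun z => hC _ _)
    exact this
  rw [e1, integral_integral_swap iprod, intervalIntegral.integral_of_le hab, ← integral_mul_const]
  refine setIntegral_mono_on iprod.integral_prod_right ?_ measurableSet_Ioc fun v hv => ?_
  · rw [intervalIntegrable_iff_integrableOn_Ioc_of_le hab] at hki
    exact hki.mul_const e
  · have hv' := Ioc_subset_Icc_self hv
    rw [integral_const_mul, ← hkk v hv', projIcc_of_mem hab hv']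
    exact mul_le_mul_of_nonneg_left (he v hv') (hk0 v hv')

lemma indep_int {Ω : Type*} {m mΩ : MeasurableSpace Ω} {P : Measure Ω} [IsProbabilityMeasure P]
    (hm : m ≤ mΩ) {D : Ω → ℝ} (hD : Measurable D)
    (hi : Indep (MeasurableSpace.comap D inferInstance) m P) {Y : Ω → ℝ} (hY : Measurable[m] Y)
    {E : Set Ω} (hE : MeasurableSet[m] E) {φ : ℝ → ℝ → ℝ} (hφ : Continuous (Function.uncurry φ)) {C : ℝ}
    (hC : ∀ x y, |φ x y| ≤ C) :
    ∫ ω in E, φ (Y ω) (D ω) ∂P = ∫ ω in E, (∫ y, φ (Y ω) y ∂(P.map D)) ∂P := by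
  classical
  set I : Ω → ℝ := E.indicator (fun _ => 1) with hI
  have hIm : Measurable[m] I := measurable_const.indicator hE
  set U : Ω → ℝ × ℝ := fun ω => (Y ω, I ω) with hU
  have hUm : Measurable[m] U := hY.prodMk hIm
  have hUm' : Measurable U := hUm.mono hm le_rfl
  have hind : IndepFun U D P := by
    rw [IndepFun_iff_Indep]
    exact indep_of_indep_of_le_left hi.symm hUm.comap_le
  have hmap := (indepFun_iff_map_prod_eq_prod_map_map hUm'.aemeasurable hD.aemeasurable).1 hind
  set ψ : (ℝ × ℝ) × ℝ → ℝ := fun z => z.1.2 * φ z.1.1 z.2 with hψ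
  have ψc : Continuous ψ := by
    have : Continuous fun z : (ℝ × ℝ) × ℝ => Function.uncurry φ (z.1.1, z.2) := hφ.comp (by fun_prop)
    exact (by fun_prop : Continuous fun z : (ℝ × ℝ) × ℝ => z.1.2).mul this
  haveI : IsProbabilityMeasure (P.map D) := Measure.isProbabilityMeasure_map hD.aemeasurable
  haveI : IsProbabilityMeasure (P.map U) := Measure.isProbabilityMeasure_map hUm'.aemeasurable
  have hI1 : ∀ ω, |I ω| ≤ 1 := fun ω => by
    simp only [hI, indicator]; split_ifs <;> simp
  have C0 : 0 ≤ C := (abs_nonneg _).trans (hC 0 0)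
  have iprod : Integrable ψ ((P.map U).prod (P.map D)) := by
    rw [← hmap, integrable_map_measure ψc.aestronglyMeasurable (hUm'.prodMk hD).aemeasurable]
    refine Integrable.of_bound (ψc.measurable.comp (hUm'.prodMk hD)).aestronglyMeasurable C (ae_of_all _ fun ω => ?_)
    simp only [Function.comp, hψ, hU, Real.norm_eq_abs, abs_mul]
    nlinarith [hI1 ω, hC (Y ω) (D ω), abs_nonneg (I ω), abs_nonneg (φ (Y ω) (D ω))]
  have hEm : MeasurableSet E := hm _ hE
  have l : ∫ ω in E, φ (Y ω) (D ω) ∂P = ∫ z, ψ z ∂(P.map fun ω => (U ω, D ω)) := by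
    rw [integral_map (hUm'.prodMk hD).aemeasurable ψc.aestronglyMeasurable, ← integral_indicator hEm]
    congr 1; ext ω
    by_cases h : ω ∈ E <;> simp [hψ, hU, hI, h]
  have r : ∫ ω in E, (∫ y, φ (Y ω) y ∂(P.map D)) ∂P = ∫ u, (∫ y, ψ (u, y) ∂(P.map D)) ∂(P.map U) := by
    rw [integral_map hUm'.aemeasurable ψc.stronglyMeasurable.integral_prod_right'.aestronglyMeasurable,
      ← integral_indicator hEm]
    congr 1; ext ω
    by_cases h : ω ∈ E <;> simp [hψ, hU, hI, h]
  rw [l, r, hmap, integral_prod _ iprod]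

lemma gauss_scale (δ : ℝ) (hδ : 0 ≤ δ) (g : ℝ → ℝ) (hg : Continuous g) :
    ∫ y, g y ∂(gaussianReal 0 (Real.toNNReal δ)) = ∫ z, g (z * √δ) ∂γ := by
  have h := gaussianReal_map_mul_const (μ := 0) (v := 1) (√δ)
  have e : NNReal.mk (√δ ^ 2) (sq_nonneg _) * 1 = Real.toNNReal δ := by
    rw [mul_one]
    ext
    simp [Real.sq_sqrt hδ, hδ]
  rw [e, mul_zero] at h
  rw [← h, integral_map (by fun_prop) hg.aestronglyMeasurable]

end Parisi

end

section
open MeasureTheory ProbabilityTheory Real Set Filter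
open scoped Topology NNReal ENNReal

namespace Parisi

/-- the data of the theorem -/
structure SD {Ω : Type*} {mΩ : MeasurableSpace Ω} (P : Measure Ω) (β : ℕ → ℝ) (Φ : Measure ℝ → ℝ → ℝ → ℝ)
    (B : ℝ → Ω → ℝ) (𝓕 : Filtration ℝ mΩ) (μ : Measure ℝ) (s t x : ℝ) (X : ℝ → Ω → ℝ) : Prop where
  hβ : ValidBeta β
  hΦ : IsParisiFamily β Φ
  hB : IsStdBM P B
  h𝓕 : ∀ r : ℝ, (𝓕 r : MeasurableSpace Ω)
      = ⨆ v ∈ Icc (0 : ℝ) r, MeasurableSpace.comap (fun ω => B (xiD β v) ω) inferInstance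
  hμ : MemM μ
  hs : 0 ≤ s
  hst : s ≤ t
  ht : t ≤ 1
  hXcont : ∀ ω, ContinuousOn (fun r => X r ω) (Icc s t)
  hXadap : ∀ r ∈ Icc s t, StronglyMeasurable[𝓕 r] (X r)
  hX : ∀ ω, ∀ r ∈ Icc s t, X r ω
      = x + (∫ v in s..r, distF μ v * zetaFn β v * deriv (Φ μ v) (X v ω))
          + (B (xiD β r) ω - B (xiD β s) ω)

lemma kap_meas {β : ℕ → ℝ} (hβ : ValidBeta β) {μ : Measure ℝ} (hμ : MemM μ) :
    ∃ k' : ℝ → ℝ, Measurable k' ∧ ∀ v ∈ Icc (0 : ℝ) 1, distF μ v * zetaFn β v = k' v := by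
  refine ⟨fun v => distF μ v * zetaFn β (projIcc 0 1 zero_le_one v), ?_, fun v hv => ?_⟩
  · exact (distF_mono hμ).measurable.mul
      ((continuousOn_iff_continuous_restrict.1 (zeta_cont hβ)).comp continuous_projIcc).measurable
  · simp only [projIcc_of_mem zero_le_one hv]

lemma zeta_meas {β : ℕ → ℝ} (hβ : ValidBeta β) :
    ∃ k' : ℝ → ℝ, Measurable k' ∧ ∀ v ∈ Icc (0 : ℝ) 1, zetaFn β v = k' v := by
  refine ⟨fun v => zetaFn β (projIcc 0 1 zero_le_one v), ?_, fun v hv => ?_⟩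
  · exact ((continuousOn_iff_continuous_restrict.1 (zeta_cont hβ)).comp continuous_projIcc).measurable
  · simp only [projIcc_of_mem zero_le_one hv]

lemma kap_ii {β : ℕ → ℝ} (hβ : ValidBeta β) {μ : Measure ℝ} (hμ : MemM μ) {a b : ℝ} (ha : 0 ≤ a) (hab : a ≤ b)
    (hb : b ≤ 1) : IntervalIntegrable (fun v => distF μ v * zetaFn β v) volume a b := by
  refine (distF_mono hμ).intervalIntegrable.mul_continuousOn ?_
  rw [uIcc_of_le hab]; exact (zeta_cont hβ).mono (Icc_subset_Icc ha hb)

section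
variable {Ω : Type*} {mΩ : MeasurableSpace Ω} {P : Measure Ω} [IsProbabilityMeasure P] {β : ℕ → ℝ}
  {Φ : Measure ℝ → ℝ → ℝ → ℝ} {B : ℝ → Ω → ℝ} {𝓕 : Filtration ℝ mΩ} {μ : Measure ℝ} {s t x : ℝ} {X : ℝ → Ω → ℝ}

lemma kapF_ii {β : ℕ → ℝ} (hβ : ValidBeta β) {μ : Measure ℝ} (hμ : MemM μ) {a b : ℝ} (ha : 0 ≤ a) (hab : a ≤ b)
    (hb : b ≤ 1) {Y : ℝ → ℝ} (hY : ContinuousOn Y (Icc a b)) :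
    IntervalIntegrable (fun v => distF μ v * zetaFn β v * Y v) volume a b := by
  refine (kap_ii hβ hμ ha hab hb).mul_continuousOn ?_
  rwa [uIcc_of_le hab]

lemma kapF_bound {β : ℕ → ℝ} (hβ : ValidBeta β) {μ : Measure ℝ} (hμ : MemM μ) {a b : ℝ} (ha : 0 ≤ a) (hab : a ≤ b)
    (hb : b ≤ 1) {Y : ℝ → ℝ} (hY1 : ∀ v ∈ Icc a b, |Y v| ≤ 1) :
    |∫ v in a..b, distF μ v * zetaFn β v * Y v| ≤ xiD β b - xiD β a := by
  rw [← int_zeta hβ ha hab hb, ← Real.norm_eq_abs]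
  refine intervalIntegral.norm_integral_le_of_norm_le hab (ae_of_all _ fun v hv => ?_) (zeta_intervalIntegrable hβ ha hab hb)
  have hv' := Ioc_subset_Icc_self hv
  have z0 := zeta_nonneg β (y := v) ⟨ha.trans hv'.1, hv'.2.trans hb⟩
  rw [Real.norm_eq_abs, abs_mul, abs_mul, abs_of_nonneg (distF_nonneg μ v), abs_of_nonneg z0]
  have := distF_le_one hμ v
  have := distF_nonneg μ v
  have h3 := hY1 v hv'
  have : distF μ v * zetaFn β v ≤ zetaFn β v := by nlinarith
  nlinarith [abs_nonneg (Y v), mul_nonneg (distF_nonneg μ v) z0]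

lemma SD.ucont (h : SD P β Φ B 𝓕 μ s t x X) (ω : Ω) :
    ContinuousOn (fun v => deriv (Φ μ v) (X v ω)) (Icc s t) := d1_contOn h.hβ h.hΦ h.hμ h.hs h.ht (h.hXcont ω)

lemma SD.wcont (h : SD P β Φ B 𝓕 μ s t x X) (ω : Ω) :
    ContinuousOn (fun v => iteratedDeriv 2 (Φ μ v) (X v ω)) (Icc s t) := d2_contOn h.hβ h.hΦ h.hμ h.hs h.ht (h.hXcont ω)

lemma SD.incr (h : SD P β Φ B 𝓕 μ s t x X) {p v : ℝ} (hp : s ≤ p) (hpv : p ≤ v) (hv : v ≤ t) (ω : Ω) :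
    X v ω = X p ω + (∫ r in p..v, distF μ r * zetaFn β r * deriv (Φ μ r) (X r ω)) + (B (xiD β v) ω - B (xiD β p) ω) := by
  rw [h.hX ω v ⟨hp.trans hpv, hv⟩, h.hX ω p ⟨hp, hpv.trans hv⟩]
  have i1 := kapF_ii h.hβ h.hμ h.hs hp ((hpv.trans hv).trans h.ht)
    ((h.ucont ω).mono (Icc_subset_Icc_right (hpv.trans hv)))
  have i2 := kapF_ii h.hβ h.hμ (h.hs.trans hp) hpv (hv.trans h.ht)
    ((h.ucont ω).mono (Icc_subset_Icc hp hv))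
  rw [← intervalIntegral.integral_add_adjacent_intervals i1 i2]
  ring

lemma SD.Xm (h : SD P β Φ B 𝓕 μ s t x X) {v : ℝ} (hv : v ∈ Icc s t) : Measurable (X v) :=
  ((h.hXadap v hv).mono (𝓕.le v)).measurable

lemma SD.indep (h : SD P β Φ B 𝓕 μ s t x X) {p v : ℝ} (hp : 0 ≤ p) (hpv : p ≤ v) (hv : v ≤ 1) :
    Indep (MeasurableSpace.comap (fun ω => B (xiD β v) ω - B (xiD β p) ω) inferInstance) (𝓕 p) P := by
  have h1 := h.hB.2.2.2.2 (xiD β p) (xiD β v) (xiD_nonneg β hp) (xiD_mono h.hβ hp hpv hv)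
  refine indep_of_indep_of_le_right h1 ?_
  rw [h.h𝓕 p]
  refine iSup₂_le fun r hr => ?_
  exact le_iSup₂_of_le (f := fun v (_ : v ∈ Icc (0 : ℝ) (xiD β p)) => MeasurableSpace.comap (B v) inferInstance) (xiD β r)
    ⟨xiD_nonneg β hr.1, xiD_mono h.hβ hr.1 hr.2 (hpv.trans hv)⟩ le_rfl

lemma SD.law (h : SD P β Φ B 𝓕 μ s t x X) {p v : ℝ} (hp : 0 ≤ p) (hpv : p ≤ v) (hv : v ≤ 1) (g : ℝ → ℝ) (hg : Continuous g) :
    ∫ y, g y ∂(P.map fun ω => B (xiD β v) ω - B (xiD β p) ω) = ∫ z, g (z * √(xiD β v - xiD β p)) ∂γ := by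
  have hm := xiD_mono h.hβ hp hpv hv
  rw [h.hB.2.2.2.1 (xiD β p) (xiD β v) (xiD_nonneg β hp) hm]
  exact gauss_scale _ (by linarith) g hg

lemma SD.Bm (h : SD P β Φ B 𝓕 μ s t x X) (p v : ℝ) : Measurable (fun ω => B (xiD β v) ω - B (xiD β p) ω) :=
  (h.hB.1 _).sub (h.hB.1 _)

/-- expected size of an increment -/
def rr (d : ℝ) : ℝ := d + √d * Cm 0 1

lemma rr_nonneg {d : ℝ} (hd : 0 ≤ d) : 0 ≤ rr d := by
  have := Cm_nonneg 0 1
  unfold rr; positivity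

lemma rr_mono {d d' : ℝ} (h : d ≤ d') : rr d ≤ rr d' := by
  have := Cm_nonneg 0 1
  have := Real.sqrt_le_sqrt h
  unfold rr; gcongr

lemma SD.Eabs (h : SD P β Φ B 𝓕 μ s t x X) {p v : ℝ} (hp : 0 ≤ p) (hpv : p ≤ v) (hv : v ≤ 1) :
    Integrable (fun ω => |B (xiD β v) ω - B (xiD β p) ω|) P ∧
    ∫ ω, |B (xiD β v) ω - B (xiD β p) ω| ∂P = √(xiD β v - xiD β p) * Cm 0 1 := by
  constructor
  · have hg : Integrable (fun y : ℝ => |y|) (P.map fun ω => B (xiD β v) ω - B (xiD β p) ω) := by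
      rw [h.hB.2.2.2.1 (xiD β p) (xiD β v) (xiD_nonneg β hp) (xiD_mono h.hβ hp hpv hv)]
      have := (memLp_id_gaussianReal (μ := 0) (v := (xiD β v - xiD β p).toNNReal) 1)
      rw [ENNReal.coe_one, memLp_one_iff_integrable] at this
      exact this.abs
    exact hg.comp_measurable (h.Bm p v)
  · have h1 := h.law hp hpv hv (fun y => |y|) continuous_abs
    rw [integral_map (h.Bm p v).aemeasurable continuous_abs.aestronglyMeasurable] at h1
    rw [h1, Cm, ← integral_const_mul]
    congr 1; ext z
    rw [abs_mul, abs_of_nonneg (Real.sqrt_nonneg _)]; simp [mul_comm]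

lemma SD.EY (h : SD P β Φ B 𝓕 μ s t x X) {p v : ℝ} (hp : s ≤ p) (hpv : p ≤ v) (hv : v ≤ t) :
    ∫ ω, min 2 |X v ω - X p ω| ∂P ≤ rr (xiD β v - xiD β p) := by
  have hp0 := h.hs.trans hp
  have hv1 := hv.trans h.ht
  obtain ⟨i1, e1⟩ := h.Eabs hp0 hpv hv1
  have i2 : Integrable (fun ω => (xiD β v - xiD β p) + |B (xiD β v) ω - B (xiD β p) ω|) P :=
    (integrable_const _).add i1
  have : ∫ ω, min 2 |X v ω - X p ω| ∂P ≤ ∫ ω, ((xiD β v - xiD β p) + |B (xiD β v) ω - B (xiD β p) ω|) ∂P := by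
    refine integral_mono_of_nonneg (ae_of_all _ fun ω => by positivity) i2 (ae_of_all _ fun ω => ?_)
    refine (min_le_right _ _).trans ?_
    rw [h.incr hp hpv hv ω]
    have b := kapF_bound h.hβ h.hμ hp0 hpv hv1 (Y := fun r => deriv (Φ μ r) (X r ω))
      (fun r hr => (Phi_QD h.hβ h.hΦ h.hμ ⟨hp0.trans hr.1, hr.2.trans hv1⟩).b1 _)
    have := abs_add_le (∫ r in p..v, distF μ r * zetaFn β r * deriv (Φ μ r) (X r ω)) (B (xiD β v) ω - B (xiD β p) ω)
    calc _ = |(∫ r in p..v, distF μ r * zetaFn β r * deriv (Φ μ r) (X r ω)) + (B (xiD β v) ω - B (xiD β p) ω)| := by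
          congr 1; ring
      _ ≤ _ := by linarith
  rw [integral_add (integrable_const _) i1, e1] at this
  simpa [rr] using this

lemma SD.step_err (h : SD P β Φ B 𝓕 μ s t x X) {p q : ℝ} (hsp : s ≤ p) (hpq : p ≤ q) (hqt : q ≤ t) {m : ℝ}
    (m0 : 0 ≤ m) (m1 : m ≤ 1) {F : ℝ → ℝ → ℝ} {g : ℝ → ℝ} {L e : ℝ} (hL : 0 ≤ L)
    (hFc : ∀ ω, ContinuousOn (fun v => F v (X v ω)) (Icc p q))
    (hF1 : ∀ v ∈ Icc p q, ∀ y, |F v y| ≤ 1)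
    (hFL : ∀ v ∈ Icc p q, ∀ y z, |F v y - F v z| ≤ L * |y - z|)
    (hFg : ∀ v ∈ Icc p q, ∀ y, |F v y - g y| ≤ e) :
    ∫ ω, |(∫ v in p..q, distF μ v * zetaFn β v * F v (X v ω)) - m * (xiD β q - xiD β p) * g (X p ω)| ∂P
      ≤ (∫ v in p..q, |distF μ v - m| * zetaFn β v)
        + (xiD β q - xiD β p) * (e + (L + 1) * rr (xiD β q - xiD β p)) := by
  have hp0 := h.hs.trans hsp
  have hq1 := hqt.trans h.ht
  have iz := zeta_intervalIntegrable h.hβ hp0 hpq hq1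
  set δ := xiD β q - xiD β p with hδ
  have ez : ∫ v in p..q, zetaFn β v = δ := int_zeta h.hβ hp0 hpq hq1
  have z0 : ∀ v ∈ Icc p q, 0 ≤ zetaFn β v := fun v hv => zeta_nonneg β ⟨hp0.trans hv.1, hv.2.trans hq1⟩
  have δ0 : 0 ≤ δ := sub_nonneg.2 (xiD_mono h.hβ hp0 hpq hq1)
  set Y : ℝ → Ω → ℝ := fun v ω => min 2 |X v ω - X p ω| with hY
  have hYc : ∀ ω, ContinuousOn (fun v => Y v ω) (Icc p q) := fun ω => by
    have := (h.hXcont ω).mono (Icc_subset_Icc hsp hqt)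
    simp only [hY]
    fun_prop
  have hpm : p ∈ Icc s t := ⟨hsp, hpq.trans hqt⟩
  have hYm : ∀ v ∈ Icc p q, Measurable (Y v) := fun v hv => by
    have := h.Xm (v := v) ⟨hsp.trans hv.1, hv.2.trans hqt⟩
    have := h.Xm hpm
    simp only [hY]
    fun_prop
  have hYb : ∀ v ω, |Y v ω| ≤ 2 := fun v ω => by
    rw [abs_of_nonneg (by positivity)]; exact min_le_left _ _
  have iI : IntervalIntegrable (fun v => |distF μ v - m| * zetaFn β v) volume p q := by
    refine IntervalIntegrable.mul_continuousOn ?_ ?_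
    · exact ((distF_mono h.hμ).intervalIntegrable.sub intervalIntegrable_const).abs
    · rw [uIcc_of_le hpq]; exact (zeta_cont h.hβ).mono (Icc_subset_Icc hp0 hq1)
  have iY : ∀ ω, IntervalIntegrable (fun v => zetaFn β v * Y v ω) volume p q := fun ω =>
    iz.mul_continuousOn (by rw [uIcc_of_le hpq]; exact hYc ω)
  obtain ⟨k', k'm, k'e⟩ := zeta_meas h.hβ
  have k'e' : ∀ v ∈ Icc p q, zetaFn β v = k' v := fun v hv => k'e v ⟨hp0.trans hv.1, hv.2.trans hq1⟩
  have pt : ∀ ω, |(∫ v in p..q, distF μ v * zetaFn β v * F v (X v ω)) - m * δ * g (X p ω)|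
      ≤ (∫ v in p..q, |distF μ v - m| * zetaFn β v) + (δ * e + (L + 1) * ∫ v in p..q, zetaFn β v * Y v ω) := by
    intro ω
    have e1 : (∫ v in p..q, distF μ v * zetaFn β v * F v (X v ω)) - m * δ * g (X p ω)
        = ∫ v in p..q, (distF μ v * zetaFn β v * F v (X v ω) - zetaFn β v * (m * g (X p ω))) := by
      rw [intervalIntegral.integral_sub (kapF_ii h.hβ h.hμ hp0 hpq hq1 (hFc ω)) (iz.mul_const _),
        intervalIntegral.integral_mul_const, ez]
      ring
    have e2 : (∫ v in p..q, |distF μ v - m| * zetaFn β v) + (δ * e + (L + 1) * ∫ v in p..q, zetaFn β v * Y v ω)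
        = ∫ v in p..q, (|distF μ v - m| * zetaFn β v + (zetaFn β v * e + (L + 1) * (zetaFn β v * Y v ω))) := by
      rw [intervalIntegral.integral_add iI ((iz.mul_const e).add ((iY ω).const_mul _)),
        intervalIntegral.integral_add (iz.mul_const e) ((iY ω).const_mul _),
        intervalIntegral.integral_mul_const, ez, intervalIntegral.integral_const_mul]
    rw [e1, e2, ← Real.norm_eq_abs]
    refine intervalIntegral.norm_integral_le_of_norm_le hpq (ae_of_all _ fun v hv => ?_)
      (iI.add ((iz.mul_const e).add ((iY ω).const_mul _)))
    have hv' := Ioc_subset_Icc_self hv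
    have zz := z0 v hv'
    rw [Real.norm_eq_abs]
    have d1 : distF μ v * zetaFn β v * F v (X v ω) - zetaFn β v * (m * g (X p ω)) =
      (distF μ v - m) * zetaFn β v * F v (X v ω) + zetaFn β v * (m * (F v (X v ω) - g (X p ω))) := by ring
    rw [d1]
    refine (abs_add_le _ _).trans (add_le_add ?_ ?_)
    · rw [abs_mul, abs_mul, abs_of_nonneg zz]
      have := hF1 v hv' (X v ω)
      have h9 : 0 ≤ |distF μ v - m| * zetaFn β v := by positivity
      nlinarith
    · rw [abs_mul, abs_of_nonneg zz, abs_mul, abs_of_nonneg m0]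
      have y1 : |F v (X v ω) - F v (X p ω)| ≤ (L + 1) * Y v ω := by
        simp only [hY]
        rcases le_total 2 |X v ω - X p ω| with hh | hh
        · rw [min_eq_left hh]
          have b1 := hF1 v hv' (X v ω)
          have b2 := hF1 v hv' (X p ω)
          have := abs_sub (F v (X v ω)) (F v (X p ω))
          linarith
        · rw [min_eq_right hh]
          have := hFL v hv' (X v ω) (X p ω)
          linarith [abs_nonneg (X v ω - X p ω)]
      have y2 := hFg v hv' (X p ω)
      have y3 := abs_sub_le (F v (X v ω)) (F v (X p ω)) (g (X p ω))
      have y4 : m * |F v (X v ω) - g (X p ω)| ≤ e + (L + 1) * Y v ω := by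
        nlinarith [abs_nonneg (F v (X v ω) - g (X p ω))]
      calc _ ≤ zetaFn β v * (e + (L + 1) * Y v ω) := by gcongr
        _ = _ := by ring
  have sm := smeas_int hpq k'm k'e' hYc hYm
  have ib : Integrable (fun ω => ∫ v in p..q, zetaFn β v * Y v ω) P := by
    refine Integrable.of_bound sm.aestronglyMeasurable (δ * 2) (ae_of_all _ fun ω => ?_)
    rw [← ez, ← intervalIntegral.integral_mul_const]
    refine intervalIntegral.norm_integral_le_of_norm_le hpq (ae_of_all _ fun v hv => ?_) (iz.mul_const _)
    have hv' := Ioc_subset_Icc_self hv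
    rw [Real.norm_eq_abs, abs_mul, abs_of_nonneg (z0 v hv')]
    exact mul_le_mul_of_nonneg_left (hYb v ω) (z0 v hv')
  have ir : Integrable (fun ω => (∫ v in p..q, |distF μ v - m| * zetaFn β v) +
      (δ * e + (L + 1) * ∫ v in p..q, zetaFn β v * Y v ω)) P :=
    (integrable_const _).add ((integrable_const _).add (ib.const_mul _))
  have f1 := integral_mono_of_nonneg (ae_of_all P fun ω => abs_nonneg _) ir (ae_of_all P pt)
  have i3 : Integrable (fun ω => δ * e + (L + 1) * ∫ v in p..q, zetaFn β v * Y v ω) P :=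
    (integrable_const _).add (ib.const_mul _)
  rw [integral_add (integrable_const _) i3,
    integral_add (integrable_const _) (ib.const_mul _),
    integral_const_mul (L + 1) (fun ω => ∫ v in p..q, zetaFn β v * Y v ω)] at f1
  have f2 := fub (P := P) hpq k'm k'e' iz z0 hYc hYm hYb (e := rr δ) (fun v hv => by
    refine (h.EY hsp hv.1 (hv.2.trans hqt)).trans (rr_mono ?_)
    have := xiD_mono h.hβ (hp0.trans hv.1) hv.2 hq1
    linarith)
  rw [ez] at f2
  simp only [integral_const, probReal_univ, one_smul] at f1
  have f3 := mul_le_mul_of_nonneg_left f2 (by linarith : 0 ≤ L + 1)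
  linarith

end

end Parisi

end

section
open MeasureTheory ProbabilityTheory Real Set Filter
open scoped Topology NNReal ENNReal

namespace Parisi

lemma om1_mono {a b : ℝ} (h : a ≤ b) : om1 a ≤ om1 b := by
  have := Real.sqrt_le_sqrt h
  unfold om1; linarith

lemma om2_mono {K : ℝ} (hK : 0 ≤ K) {a b : ℝ} (h : a ≤ b) : om2 K a ≤ om2 K b := by
  have := Real.sqrt_le_sqrt (om1_mono h)
  unfold om2; gcongr

lemma CO_nonneg {c K : ℝ} (hc : 0 ≤ c) (hK : 0 ≤ K) : 0 ≤ CO c K := by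
  have := Cm_nonneg c 1
  have := Cm_nonneg c 2
  have := Cm_nonneg c 3
  unfold CO; positivity

/-- the one step error rate -/
def ER (β : ℕ → ℝ) (d ε : ℝ) : ℝ :=
  KK β * (om1 (CT β * d) + om1 ε + (1 + 1) * rr d) + CO √(xiD β 1) (KK β) * √d
    + (2 * (om2 (KK β) (CT β * d) + om2 (KK β) ε) + (2 * KK β + 1) * rr d)

lemma ER_mono {β : ℕ → ℝ} {d d' : ℝ} (h : d ≤ d') (ε : ℝ) : ER β d ε ≤ ER β d' ε := by
  have k0 := KK_nonneg β
  have c0 := CT_nonneg β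
  have h1 := om1_mono (mul_le_mul_of_nonneg_left h c0)
  have h2 := om2_mono k0 (mul_le_mul_of_nonneg_left h c0)
  have h3 := rr_mono h
  have h4 := Real.sqrt_le_sqrt h
  have h5 := CO_nonneg (Real.sqrt_nonneg (xiD β 1)) k0
  unfold ER
  gcongr

lemma Q.c2 {K : ℝ} {f f1 f2 : ℝ → ℝ} (h : Q K f f1 f2) : Continuous f2 := by
  refine (LipschitzWith.of_dist_le_mul (K := K.toNNReal) fun x y => ?_).continuous
  rw [Real.dist_eq, Real.dist_eq]
  exact (h.l2 x y).trans (mul_le_mul_of_nonneg_right (Real.le_coe_toNNReal K) (abs_nonneg _))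

section
variable {Ω : Type*} {mΩ : MeasurableSpace Ω} {P : Measure Ω} [IsProbabilityMeasure P] {β : ℕ → ℝ}
  {Φ : Measure ℝ → ℝ → ℝ → ℝ} {B : ℝ → Ω → ℝ} {𝓕 : Filtration ℝ mΩ} {μ : Measure ℝ} {s t x : ℝ} {X : ℝ → Ω → ℝ}

lemma bdd_int {g : Ω → ℝ} (hg : Measurable g) {C : ℝ} (hC : ∀ ω, |g ω| ≤ C) : Integrable g P :=
  Integrable.of_bound hg.aestronglyMeasurable C (ae_of_all _ hC)

lemma set_le {g : Ω → ℝ} (hg : Integrable g P) (A : Set Ω) : |∫ ω in A, g ω ∂P| ≤ ∫ ω, |g ω| ∂P :=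
  (norm_integral_le_integral_norm _).trans
    (setIntegral_le_integral hg.norm (ae_of_all _ fun _ => norm_nonneg _))

lemma int_sub_add {f g k : Ω → ℝ} (hf : Integrable f P) (hg : Integrable g P) (hk : Integrable k P) {A : Set Ω} :
    ∫ ω in A, (f ω - g ω + k ω) ∂P = (∫ ω in A, f ω ∂P) - (∫ ω in A, g ω ∂P) + ∫ ω in A, k ω ∂P := by
  have h1 : IntegrableOn (fun ω => f ω - g ω) A P := (hf.sub hg).integrableOn
  rw [integral_add h1 hk.integrableOn, integral_sub hf.integrableOn hg.integrableOn]

/-- the quadratic drift integral is measurable and bounded -/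
lemma SD.drift_sm (h : SD P β Φ B 𝓕 μ s t x X) {p q : ℝ} (hsp : s ≤ p) (hpq : p ≤ q) (hqt : q ≤ t) :
    StronglyMeasurable[𝓕 q] (fun ω => ∫ v in p..q, distF μ v * zetaFn β v * (iteratedDeriv 2 (Φ μ v) (X v ω)) ^ 2) := by
  have hp0 := h.hs.trans hsp
  have hq1 := hqt.trans h.ht
  obtain ⟨k', k'm, k'e⟩ := kap_meas h.hβ h.hμ
  refine smeas_int (m := 𝓕 q) (k := fun v => distF μ v * zetaFn β v) hpq k'm
    (fun v hv => k'e v ⟨hp0.trans hv.1, hv.2.trans hq1⟩)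
    (fun ω => ((h.wcont ω).mono (Icc_subset_Icc hsp hqt)).pow 2) (fun v hv => ?_)
  have h1 : Measurable[𝓕 q] (X v) :=
    ((h.hXadap v ⟨hsp.trans hv.1, hv.2.trans hqt⟩).mono (𝓕.mono hv.2)).measurable
  exact (((Phi_QD h.hβ h.hΦ h.hμ ⟨hp0.trans hv.1, hv.2.trans hq1⟩).c2.pow 2).measurable).comp h1

lemma SD.w1 (h : SD P β Φ B 𝓕 μ s t x X) {v : ℝ} (hv : v ∈ Icc (0 : ℝ) 1) (y : ℝ) :
    |iteratedDeriv 2 (Φ μ v) y| ≤ 1 := by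
  have hq := Phi_QD h.hβ h.hΦ h.hμ hv
  rw [abs_of_nonneg (hq.p2 y)]; exact hq.b2 y

lemma SD.drift_b (h : SD P β Φ B 𝓕 μ s t x X) {p q : ℝ} (hsp : s ≤ p) (hpq : p ≤ q) (hqt : q ≤ t) (ω : Ω) :
    |∫ v in p..q, distF μ v * zetaFn β v * (iteratedDeriv 2 (Φ μ v) (X v ω)) ^ 2| ≤ xiD β q - xiD β p := by
  refine kapF_bound h.hβ h.hμ (h.hs.trans hsp) hpq (hqt.trans h.ht) fun v hv => ?_
  have := h.w1 (v := v) ⟨(h.hs.trans hsp).trans hv.1, hv.2.trans (hqt.trans h.ht)⟩ (X v ω)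
  rw [abs_pow]; exact pow_le_one₀ (abs_nonneg _) this

set_option maxHeartbeats 1000000 in
lemma SD.step (h : SD P β Φ B 𝓕 μ s t x X) {ν : Measure ℝ} {S : Finset ℝ} (hG : Grid ν S) {p q : ℝ} (hc : Cons S p q)
    (hsp : s ≤ p) (hqt : q ≤ t) {ε : ℝ} (ε0 : 0 ≤ ε)
    (hε : ∀ r ∈ Icc (0 : ℝ) 1, ∀ y, |Φ μ r y - Φ ν r y| ≤ ε) {A : Set Ω} (hA : MeasurableSet[𝓕 p] A) :
    |∫ ω in A, (iteratedDeriv 2 (Φ ν q) (X q ω) - iteratedDeriv 2 (Φ ν p) (X p ω)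
      + ∫ v in p..q, distF μ v * zetaFn β v * (iteratedDeriv 2 (Φ μ v) (X v ω)) ^ 2) ∂P|
    ≤ (KK β + 1) * (∫ v in p..q, |distF μ v - distF ν p| * zetaFn β v)
      + (xiD β q - xiD β p) * ER β (xiD β q - xiD β p) ε := by
  have hpq := hc.lt.le
  have hp0 := h.hs.trans hsp
  have hq1 := hqt.trans h.ht
  have hat := h.hΦ.1 ν hG.mem hG.fin
  have gq : GD (KK β) (Φ ν q) := hG.GD h.hβ hat q hc.hq
  have gp : GD (KK β) (Φ ν p) := hG.GD h.hβ hat p hc.hp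
  have Qq := GC.toQ gq
  have Qp := GC.toQ gp
  have m0 := distF_nonneg ν p
  have m1 := distF_le_one hG.mem p
  obtain ⟨δ0, σ2, σc⟩ := hG.sig h.hβ hc
  have k0 := KK_nonneg β
  have hT := hG.T2 h.hβ hat hc
  have hone := fun y => GC.onestep gq m0 m1 (Real.sqrt_nonneg _) σc y
  rw [← hT] at hone
  set f1 := deriv (Φ ν q) with hf1
  set f2 := iteratedDeriv 2 (Φ ν q) with hf2
  set T := iteratedDeriv 2 (Φ ν p) with hTd
  set m := distF ν p with hm
  set δ := xiD β q - xiD β p with hδ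
  set K := KK β with hK
  rw [σ2] at hone
  set I := fun ω => ∫ v in p..q, distF μ v * zetaFn β v * (iteratedDeriv 2 (Φ μ v) (X v ω)) ^ 2 with hI
  set J := fun ω => ∫ v in p..q, distF μ v * zetaFn β v * deriv (Φ μ v) (X v ω) with hJ
  set D := fun ω => B (xiD β q) ω - B (xiD β p) ω with hD
  have qm : q ∈ Icc (0 : ℝ) 1 := ⟨hp0.trans hpq, hq1⟩
  have vm : ∀ v ∈ Icc p q, v ∈ Icc (0 : ℝ) 1 := fun v hv => ⟨hp0.trans hv.1, hv.2.trans hq1⟩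
  have xd : ∀ v ∈ Icc p q, |xiD β v - xiD β q| ≤ δ := fun v hv => by
    have a1 := xiD_mono h.hβ hp0 hv.1 (vm v hv).2
    have a2 := xiD_mono h.hβ (vm v hv).1 hv.2 hq1
    rw [abs_le]; constructor <;> linarith
  have ct := CT_nonneg β
  have E1 : ∀ v ∈ Icc p q, ∀ y, |deriv (Φ μ v) y - f1 y| ≤ om1 (CT β * δ) + om1 ε := fun v hv y => by
    have a1 := d1_time h.hβ h.hΦ h.hμ (vm v hv) qm y
    have a2 := om1_mono (mul_le_mul_of_nonneg_left (xd v hv) ct)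
    have a3 := (Phi_QD h.hβ h.hΦ h.hμ qm).interp1 Qq ε0 (hε q qm) y
    have := abs_sub_le (deriv (Φ μ v) y) (deriv (Φ μ q) y) (f1 y)
    linarith
  have E2 : ∀ v ∈ Icc p q, ∀ y, |iteratedDeriv 2 (Φ μ v) y - f2 y| ≤ om2 K (CT β * δ) + om2 K ε := fun v hv y => by
    have a1 := d2_time h.hβ h.hΦ h.hμ (vm v hv) qm y
    have a2 := om2_mono k0 (mul_le_mul_of_nonneg_left (xd v hv) ct)
    have a3 := (Phi_QD h.hβ h.hΦ h.hμ qm).interp2 Qq ε0 (hε q qm) y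
    have := abs_sub_le (iteratedDeriv 2 (Φ μ v) y) (iteratedDeriv 2 (Φ μ q) y) (f2 y)
    linarith
  have sqd : ∀ a b : ℝ, |a| ≤ 1 → |b| ≤ 1 → |a ^ 2 - b ^ 2| ≤ 2 * |a - b| := fun a b ha hb => by
    have : a ^ 2 - b ^ 2 = (a + b) * (a - b) := by ring
    rw [this, abs_mul]
    have := abs_add_le a b
    exact mul_le_mul_of_nonneg_right (by linarith) (abs_nonneg _)
  have fb : ∀ y, |f2 y| ≤ 1 := fun y => by rw [abs_of_nonneg (Qq.p2 y)]; exact Qq.b2 y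
  have Tb : ∀ y, |T y| ≤ 1 := fun y => by rw [abs_of_nonneg (Qp.p2 y)]; exact Qp.b2 y
  have S1 := h.step_err hsp hpq hqt m0 m1 (F := fun v => deriv (Φ μ v)) (g := f1) zero_le_one
    (fun ω => (h.ucont ω).mono (Icc_subset_Icc hsp hqt))
    (fun v hv y => (Phi_QD h.hβ h.hΦ h.hμ (vm v hv)).b1 y)
    (fun v hv y z => (Phi_QD h.hβ h.hΦ h.hμ (vm v hv)).l1 y z) E1
  have S2 := h.step_err hsp hpq hqt m0 m1 (F := fun v y => iteratedDeriv 2 (Φ μ v) y ^ 2) (g := fun y => f2 y ^ 2)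
    (L := 2 * K) (e := 2 * (om2 K (CT β * δ) + om2 K ε)) (by positivity)
    (fun ω => ((h.wcont ω).mono (Icc_subset_Icc hsp hqt)).pow 2)
    (fun v hv y => by rw [abs_pow]; exact pow_le_one₀ (abs_nonneg _) (h.w1 (vm v hv) y))
    (fun v hv y z => by
      have a1 := sqd _ _ (h.w1 (vm v hv) y) (h.w1 (vm v hv) z)
      have a2 := (Phi_QD h.hβ h.hΦ h.hμ (vm v hv)).l2 y z
      linarith)
    (fun v hv y => by
      have a1 := sqd _ _ (h.w1 (vm v hv) y) (fb y)
      have a2 := E2 v hv y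
      linarith)
  simp only [← hδ] at S1 S2
  -- measurability
  have pm : p ∈ Icc s t := ⟨hsp, hpq.trans hqt⟩
  have Xq := h.Xm (v := q) ⟨hsp.trans hpq, hqt⟩
  have Xp := h.Xm pm
  have hDm : Measurable D := h.Bm p q
  have cf1 : Continuous f1 := GC.c1 gq
  have cf2 : Continuous f2 := Qq.c2
  have cT : Continuous T := Qp.c2
  have Im : Measurable I := ((h.drift_sm hsp hpq hqt).mono (𝓕.le q)).measurable
  have Ib : ∀ ω, |I ω| ≤ δ := h.drift_b hsp hpq hqt
  have inc : ∀ ω, X q ω = X p ω + J ω + D ω := h.incr hsp hpq hqt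
  have Jb : ∀ ω, |J ω| ≤ δ := fun ω => kapF_bound h.hβ h.hμ hp0 hpq hq1
    (fun v hv => (Phi_QD h.hβ h.hΦ h.hμ (vm v hv)).b1 _)
  have Jm : Measurable J := by
    have : J = fun ω => X q ω - X p ω - D ω := by ext ω; rw [inc ω]; ring
    rw [this]; exact (Xq.sub Xp).sub hDm
  set φ : ℝ → ℝ → ℝ := fun y d => f2 (y + m * δ * f1 y + d) with hφ
  have cφ : Continuous (Function.uncurry φ) := by
    simp only [hφ, Function.uncurry_def]; fun_prop
  have bφ : ∀ y d, |φ y d| ≤ 1 := fun y d => fb _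
  set H : ℝ → ℝ := fun y => ∫ z, f2 (y + m * δ * f1 y + z * √δ) ∂γ with hH
  have ind : ∫ ω in A, φ (X p ω) (D ω) ∂P = ∫ ω in A, H (X p ω) ∂P := by
    rw [indep_int (𝓕.le p) hDm (h.indep hp0 hpq hq1) (h.hXadap p pm).measurable hA cφ bφ]
    congr 1; ext ω
    exact h.law hp0 hpq hq1 (φ (X p ω)) (by simp only [hφ]; fun_prop)
  have cH : Continuous H := by
    refine continuous_of_dominated (bound := fun _ => 1) (fun y => ?_) (fun y => ae_of_all _ fun z => fb _)
      (integrable_const _) (ae_of_all _ fun z => by fun_prop)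
    exact (by fun_prop : Continuous fun z : ℝ => f2 (y + m * δ * f1 y + z * √δ)).aestronglyMeasurable
  have bH : ∀ y, |H y| ≤ 1 := fun y => by
    have := norm_integral_le_of_norm_le_const (μ := γ) (C := 1) (f := fun z => f2 (y + m * δ * f1 y + z * √δ))
      (ae_of_all _ fun z => fb _)
    simpa using this
  have iI : Integrable I P := bdd_int Im Ib
  have iT : Integrable (fun ω => T (X p ω)) P := bdd_int (cT.measurable.comp Xp) fun ω => Tb _
  have iHH : Integrable (fun ω => H (X p ω)) P := bdd_int (cH.measurable.comp Xp) fun ω => bH _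
  have ifq : Integrable (fun ω => f2 (X q ω)) P := bdd_int (cf2.measurable.comp Xq) fun ω => fb _
  have iφ : Integrable (fun ω => φ (X p ω) (D ω)) P :=
    bdd_int (cφ.measurable.comp (Xp.prodMk hDm)) fun ω => bφ _ _
  have if2 : Integrable (fun ω => m * δ * f2 (X p ω) ^ 2) P := by
    refine (bdd_int (((cf2.pow 2).measurable).comp Xp) (C := 1) fun ω => ?_).const_mul (m * δ)
    simp only [Function.comp, Pi.pow_apply]
    rw [abs_pow]; exact pow_le_one₀ (abs_nonneg _) (fb _)
  have if1 : Integrable (fun ω => m * δ * f1 (X p ω)) P :=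
    (bdd_int (cf1.measurable.comp Xp) (C := 1) fun ω => Qq.b1 _).const_mul (m * δ)
  have iJ : Integrable J P := bdd_int Jm Jb
  -- the decomposition
  have e1 : ∫ ω in A, (f2 (X q ω) - T (X p ω) + I ω) ∂P
      = (∫ ω in A, (f2 (X q ω) - φ (X p ω) (D ω)) ∂P)
        + ∫ ω in A, (H (X p ω) - T (X p ω) + I ω) ∂P := by
    rw [int_sub_add ifq iT iI, int_sub_add iHH iT iI, integral_sub ifq.integrableOn iφ.integrableOn, ind]
    ring
  have b1 : |∫ ω in A, (f2 (X q ω) - φ (X p ω) (D ω)) ∂P| ≤ K * ∫ ω, |J ω - m * δ * f1 (X p ω)| ∂P := by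
    refine (set_le (ifq.sub iφ) A).trans ?_
    rw [← integral_const_mul]
    refine integral_mono (ifq.sub iφ).abs ((iJ.sub if1).abs.const_mul K) fun ω => ?_
    simp only [hφ, Pi.sub_apply]
    refine (Qq.l2 _ _).trans (le_of_eq ?_)
    rw [inc ω]; congr 2; ring
  have b2 : |∫ ω in A, (H (X p ω) - T (X p ω) + I ω) ∂P| ≤ CO √(xiD β 1) K * √δ ^ 3
      + ∫ ω, |I ω - m * δ * f2 (X p ω) ^ 2| ∂P := by
    refine (set_le ((iHH.sub iT).add iI) A).trans ?_
    have : CO √(xiD β 1) K * √δ ^ 3 = ∫ ω, (CO √(xiD β 1) K * √δ ^ 3) ∂P := by simp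
    have i5 : Integrable (fun ω => |I ω - m * δ * f2 (X p ω) ^ 2|) P := (iI.sub if2).abs
    rw [this, ← integral_add (integrable_const _) i5]
    refine integral_mono ((iHH.sub iT).add iI).abs ((integrable_const _).add i5) fun ω => ?_
    have a1 := hone (X p ω)
    have a2 := abs_add_le (H (X p ω) - T (X p ω) + m * δ * f2 (X p ω) ^ 2) (I ω - m * δ * f2 (X p ω) ^ 2)
    simp only [Pi.add_apply, Pi.sub_apply]
    calc |H (X p ω) - T (X p ω) + I ω| = |(H (X p ω) - T (X p ω) + m * δ * f2 (X p ω) ^ 2) + (I ω - m * δ * f2 (X p ω) ^ 2)| := by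
          congr 1; ring
      _ ≤ _ := a2
      _ ≤ _ := add_le_add a1 le_rfl
  rw [e1]
  refine (abs_add_le _ _).trans ((add_le_add b1 b2).trans ?_)
  have S1' := mul_le_mul_of_nonneg_left S1 k0
  have s3 : √δ ^ 3 = δ * √δ := by rw [pow_succ, σ2]
  rw [s3]
  unfold ER
  rw [← hK]
  calc _ ≤ K * ((∫ v in p..q, |distF μ v - m| * zetaFn β v) + δ * (om1 (CT β * δ) + om1 ε + (1 + 1) * rr δ))
        + (CO √(xiD β 1) K * (δ * √δ) + ((∫ v in p..q, |distF μ v - m| * zetaFn β v)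
          + δ * (2 * (om2 K (CT β * δ) + om2 K ε) + (2 * K + 1) * rr δ))) := by
        gcongr
    _ = _ := by ring

end

end Parisi

end

section
open MeasureTheory ProbabilityTheory Real Set Filter
open scoped Topology NNReal ENNReal

namespace Parisi

section
variable {Ω : Type*} {mΩ : MeasurableSpace Ω} {P : Measure Ω} [IsProbabilityMeasure P] {β : ℕ → ℝ}
  {Φ : Measure ℝ → ℝ → ℝ → ℝ} {B : ℝ → Ω → ℝ} {𝓕 : Filtration ℝ mΩ} {μ : Measure ℝ} {s t x : ℝ} {X : ℝ → Ω → ℝ}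

lemma SD.drift_int (h : SD P β Φ B 𝓕 μ s t x X) {p q : ℝ} (hsp : s ≤ p) (hpq : p ≤ q) (hqt : q ≤ t) :
    Integrable (fun ω => ∫ v in p..q, distF μ v * zetaFn β v * (iteratedDeriv 2 (Φ μ v) (X v ω)) ^ 2) P :=
  bdd_int ((h.drift_sm hsp hpq hqt).mono (𝓕.le q)).measurable (h.drift_b hsp hpq hqt)

lemma SD.drift_add (h : SD P β Φ B 𝓕 μ s t x X) {p q r : ℝ} (hsp : s ≤ p) (hpq : p ≤ q) (hqr : q ≤ r) (hrt : r ≤ t)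
    (ω : Ω) : (∫ v in p..r, distF μ v * zetaFn β v * (iteratedDeriv 2 (Φ μ v) (X v ω)) ^ 2) =
      (∫ v in p..q, distF μ v * zetaFn β v * (iteratedDeriv 2 (Φ μ v) (X v ω)) ^ 2) +
      ∫ v in q..r, distF μ v * zetaFn β v * (iteratedDeriv 2 (Φ μ v) (X v ω)) ^ 2 := by
  have i1 := kapF_ii h.hβ h.hμ (h.hs.trans hsp) hpq ((hqr.trans hrt).trans h.ht)
    (((h.wcont ω).mono (Icc_subset_Icc hsp (hqr.trans hrt))).pow 2)
  have i2 := kapF_ii h.hβ h.hμ ((h.hs.trans hsp).trans hpq) hqr (hrt.trans h.ht)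
    (((h.wcont ω).mono (Icc_subset_Icc (hsp.trans hpq) hrt)).pow 2)
  exact (intervalIntegral.integral_add_adjacent_intervals i1 i2).symm

lemma SD.drift_add_int (h : SD P β Φ B 𝓕 μ s t x X) {p q r : ℝ} (hsp : s ≤ p) (hpq : p ≤ q) (hqr : q ≤ r) (hrt : r ≤ t)
    (A : Set Ω) : (∫ ω in A, (∫ v in p..r, distF μ v * zetaFn β v * (iteratedDeriv 2 (Φ μ v) (X v ω)) ^ 2) ∂P) =
      (∫ ω in A, (∫ v in p..q, distF μ v * zetaFn β v * (iteratedDeriv 2 (Φ μ v) (X v ω)) ^ 2) ∂P) +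
      ∫ ω in A, (∫ v in q..r, distF μ v * zetaFn β v * (iteratedDeriv 2 (Φ μ v) (X v ω)) ^ 2) ∂P := by
  have d1 := h.drift_int hsp hpq (hqr.trans hrt)
  have d2 := h.drift_int (hsp.trans hpq) hqr hrt
  rw [← integral_add d1.integrableOn d2.integrableOn]
  simp only [h.drift_add hsp hpq hqr hrt]

lemma SD.f_int (h : SD P β Φ B 𝓕 μ s t x X) {K : ℝ} {f : ℝ → ℝ} (hf : QD K f) {r : ℝ} (hr : r ∈ Icc s t) :
    Integrable (fun ω => iteratedDeriv 2 f (X r ω)) P :=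
  bdd_int (hf.c2.measurable.comp (h.Xm hr)) (C := 1) fun ω => by
    rw [abs_of_nonneg (hf.p2 _)]; exact hf.b2 _

lemma dist_ii {μ ν : Measure ℝ} (hμ : MemM μ) (hν : MemM ν) (a b : ℝ) :
    IntervalIntegrable (fun v => |distF μ v - distF ν v|) volume a b :=
  ((distF_mono hμ).intervalIntegrable.sub (distF_mono hν).intervalIntegrable).abs

lemma SD.grid (h : SD P β Φ B 𝓕 μ s t x X) {ν : Measure ℝ} {S : Finset ℝ} (hG : Grid ν S) {a b : ℝ}
    (ha : a ∈ S) (hb : b ∈ S) (hsa : s ≤ a) (hab : a ≤ b) (hbt : b ≤ t) {η Z : ℝ} (Z0 : 0 ≤ Z)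
    (hZ : ∀ y ∈ Icc (0 : ℝ) 1, zetaFn β y ≤ Z) (hη : ∀ p q, Cons S p q → q - p < η) {ε : ℝ} (ε0 : 0 ≤ ε)
    (hε : ∀ r ∈ Icc (0 : ℝ) 1, ∀ y, |Φ μ r y - Φ ν r y| ≤ ε) {A : Set Ω} (hA : MeasurableSet[𝓕 a] A) :
    |∫ ω in A, (iteratedDeriv 2 (Φ ν b) (X b ω) - iteratedDeriv 2 (Φ ν a) (X a ω)
      + ∫ v in a..b, distF μ v * zetaFn β v * (iteratedDeriv 2 (Φ μ v) (X v ω)) ^ 2) ∂P|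
    ≤ (KK β + 1) * (Z * ∫ v in a..b, |distF μ v - distF ν v|) + (xiD β b - xiD β a) * ER β (Z * η) ε := by
  have hat := h.hΦ.1 ν hG.mem hG.fin
  have k0 := KK_nonneg β
  have key : ∀ p ∈ S, p ≤ b → (a ≤ p → |∫ ω in A, (iteratedDeriv 2 (Φ ν b) (X b ω) - iteratedDeriv 2 (Φ ν p) (X p ω)
      + ∫ v in p..b, distF μ v * zetaFn β v * (iteratedDeriv 2 (Φ μ v) (X v ω)) ^ 2) ∂P|
    ≤ (KK β + 1) * (Z * ∫ v in p..b, |distF μ v - distF ν v|) + (xiD β b - xiD β p) * ER β (Z * η) ε) := by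
    refine Cons.induct hb ?_ ?_
    · intro _; simp
    · intro p q hc hqb ih hap
      have hpq := hc.lt.le
      have ih := ih (hap.trans hpq)
      have hsp := hsa.trans hap
      have hqt := hqb.trans hbt
      have hp0 := h.hs.trans hsp
      have hq1 := hqt.trans h.ht
      have st := h.step hG hc hsp hqt ε0 hε (𝓕.mono hap A hA)
      have Qp := (GC.toQ (hG.GD h.hβ hat p hc.hp))
      have Qq := (GC.toQ (hG.GD h.hβ hat q hc.hq))
      have Qb := (GC.toQ (hG.GD h.hβ hat b hb))
      have ip := h.f_int (f := Φ ν p) (K := KK β) Qp (r := p) ⟨hsp, hpq.trans hqt⟩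
      have iq := h.f_int (f := Φ ν q) (K := KK β) Qq (r := q) ⟨hsp.trans hpq, hqt⟩
      have ib := h.f_int (f := Φ ν b) (K := KK β) Qb (r := b) ⟨hsp.trans (hpq.trans hqb), hbt⟩
      have d1 := h.drift_int hsp hpq hqt
      have d2 := h.drift_int (hsp.trans hpq) hqb hbt
      have e : ∫ ω in A, (iteratedDeriv 2 (Φ ν b) (X b ω) - iteratedDeriv 2 (Φ ν p) (X p ω)
          + ∫ v in p..b, distF μ v * zetaFn β v * (iteratedDeriv 2 (Φ μ v) (X v ω)) ^ 2) ∂P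
          = (∫ ω in A, (iteratedDeriv 2 (Φ ν q) (X q ω) - iteratedDeriv 2 (Φ ν p) (X p ω)
          + ∫ v in p..q, distF μ v * zetaFn β v * (iteratedDeriv 2 (Φ μ v) (X v ω)) ^ 2) ∂P)
          + ∫ ω in A, (iteratedDeriv 2 (Φ ν b) (X b ω) - iteratedDeriv 2 (Φ ν q) (X q ω)
          + ∫ v in q..b, distF μ v * zetaFn β v * (iteratedDeriv 2 (Φ μ v) (X v ω)) ^ 2) ∂P := by
        rw [int_sub_add ib ip (h.drift_int hsp (hpq.trans hqb) hbt), int_sub_add iq ip d1, int_sub_add ib iq d2,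
          h.drift_add_int hsp hpq hqb hbt A]
        ring
      rw [e]
      refine (abs_add_le _ _).trans ((add_le_add st ih).trans ?_)
      have m1 : ER β (xiD β q - xiD β p) ε ≤ ER β (Z * η) ε := by
        refine ER_mono ((xiD_lip h.hβ hZ hp0 hpq hq1).trans ?_) ε
        exact mul_le_mul_of_nonneg_left (hη p q hc).le Z0
      have m2 : (∫ v in p..q, |distF μ v - distF ν p| * zetaFn β v) ≤ Z * ∫ v in p..q, |distF μ v - distF ν v| := by
        rw [← intervalIntegral.integral_const_mul]
        refine intervalIntegral.integral_mono_on_of_le_Ioo hpq ?_ ((dist_ii h.hμ hG.mem p q).const_mul Z) fun v hv => ?_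
        · refine IntervalIntegrable.mul_continuousOn ?_ ?_
          · exact ((distF_mono h.hμ).intervalIntegrable.sub intervalIntegrable_const).abs
          · rw [uIcc_of_le hpq]; exact (zeta_cont h.hβ).mono (Icc_subset_Icc hp0 hq1)
        · rw [hG.distF hc hv.1.le hv.2, mul_comm]
          exact mul_le_mul_of_nonneg_right (hZ v ⟨hp0.trans hv.1.le, hv.2.le.trans hq1⟩) (abs_nonneg _)
      have m3 := xiD_mono h.hβ hp0 hpq hq1
      have m4 := intervalIntegral.integral_add_adjacent_intervals (dist_ii h.hμ hG.mem p q) (dist_ii h.hμ hG.mem q b)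
      have m5 := mul_le_mul_of_nonneg_left m1 (sub_nonneg.2 m3)
      have m6 := mul_le_mul_of_nonneg_left m2 (by linarith : 0 ≤ KK β + 1)
      rw [← m4]
      nlinarith
  exact key a ha hab le_rfl

lemma ER_cont (β : ℕ → ℝ) : Continuous fun y => ER β y y := by
  have h1 := om1_cont
  have h2 := om2_cont (KK β)
  unfold ER rr
  fun_prop

lemma ER_zero (β : ℕ → ℝ) : ER β 0 0 = 0 := by
  simp [ER, rr, om1_zero, om2_zero]

lemma SD.main (h : SD P β Φ B 𝓕 μ s t x X) {a b : ℝ} (hsa : s ≤ a) (hab : a ≤ b) (hbt : b ≤ t) {A : Set Ω}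
    (hA : MeasurableSet[𝓕 a] A) :
    ∫ ω in A, (iteratedDeriv 2 (Φ μ b) (X b ω) - iteratedDeriv 2 (Φ μ a) (X a ω)
      + ∫ v in a..b, distF μ v * zetaFn β v * (iteratedDeriv 2 (Φ μ v) (X v ω)) ^ 2) ∂P = 0 := by
  obtain ⟨Z, Z0, hZ⟩ := zeta_bound h.hβ
  have am : a ∈ Icc (0 : ℝ) 1 := ⟨h.hs.trans hsa, (hab.trans hbt).trans h.ht⟩
  have bm : b ∈ Icc (0 : ℝ) 1 := ⟨am.1.trans hab, hbt.trans h.ht⟩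
  have k0 := KK_nonneg β
  have da := h.drift_int hsa hab hbt
  have Qa := Phi_QD h.hβ h.hΦ h.hμ am
  have Qb := Phi_QD h.hβ h.hΦ h.hμ bm
  have ia := h.f_int Qa (r := a) ⟨hsa, hab.trans hbt⟩
  have ib := h.f_int Qb (r := b) ⟨hsa.trans hab, hbt⟩
  set G := ∫ ω in A, (iteratedDeriv 2 (Φ μ b) (X b ω) - iteratedDeriv 2 (Φ μ a) (X a ω)
      + ∫ v in a..b, distF μ v * zetaFn β v * (iteratedDeriv 2 (Φ μ v) (X v ω)) ^ 2) ∂P with hGd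
  set err : ℝ → ℝ := fun y => (KK β + 1) * (Z * y) + (xiD β b - xiD β a) * ER β y y + 2 * om2 (KK β) y with herr
  have ec : Continuous err := by
    have h1 := ER_cont β
    have h2 := om2_cont (KK β)
    simp only [herr]; fun_prop
  have e0 : err 0 = 0 := by simp [herr, ER_zero, om2_zero]
  have key : ∀ y, 0 < y → |G| ≤ err y := by
    intro y y0
    obtain ⟨δ, δ0, hδ⟩ := h.hΦ.2 μ h.hμ y y0
    have η0 : 0 < min δ (y / (Z + 1)) := lt_min δ0 (by positivity)
    obtain ⟨ν, S, hG, haS, hbS, hd, hm⟩ := exists_grid h.hμ am bm η0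
    set η := min δ (y / (Z + 1)) with hη
    have hηy : (Z + 1) * η ≤ y := by
      have := min_le_right δ (y / (Z + 1))
      rw [← hη, le_div_iff₀ (by positivity)] at this
      linarith
    have hε : ∀ r ∈ Icc (0 : ℝ) 1, ∀ z, |Φ μ r z - Φ ν r z| ≤ y := fun r hr z =>
      (hδ ν hG.mem (hd.trans_le (min_le_left _ _)) r hr z).le
    have g := h.grid hG haS hbS hsa hab hbt Z0 hZ hm y0.le hε hA
    have hat := h.hΦ.1 ν hG.mem hG.fin
    have Na := (GC.toQ (hG.GD h.hβ hat a haS))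
    have Nb := (GC.toQ (hG.GD h.hβ hat b hbS))
    have ja := h.f_int (f := Φ ν a) (K := KK β) Na (r := a) ⟨hsa, hab.trans hbt⟩
    have jb := h.f_int (f := Φ ν b) (K := KK β) Nb (r := b) ⟨hsa.trans hab, hbt⟩
    have c1 : ∫ v in a..b, |distF μ v - distF ν v| ≤ η := by
      refine le_trans ?_ hd.le
      exact intervalIntegral.integral_mono_interval am.1 hab bm.2 (ae_of_all _ fun _ => abs_nonneg _)
        (dist_ii h.hμ hG.mem 0 1)
    have sa : |∫ ω in A, (iteratedDeriv 2 (Φ μ a) (X a ω) - iteratedDeriv 2 (Φ ν a) (X a ω)) ∂P| ≤ om2 (KK β) y := by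
      refine (set_le (ia.sub ja) A).trans ?_
      refine (integral_mono (ia.sub ja).abs (integrable_const (om2 (KK β) y)) fun ω => ?_).trans (by simp)
      exact Qa.interp2 Na y0.le (hε a am) _
    have sb : |∫ ω in A, (iteratedDeriv 2 (Φ μ b) (X b ω) - iteratedDeriv 2 (Φ ν b) (X b ω)) ∂P| ≤ om2 (KK β) y := by
      refine (set_le (ib.sub jb) A).trans ?_
      refine (integral_mono (ib.sub jb).abs (integrable_const (om2 (KK β) y)) fun ω => ?_).trans (by simp)
      exact Qb.interp2 Nb y0.le (hε b bm) _
    rw [integral_sub ia.integrableOn ja.integrableOn] at sa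
    rw [integral_sub ib.integrableOn jb.integrableOn] at sb
    rw [int_sub_add jb ja da] at g
    rw [hGd, int_sub_add ib ia da]
    have x0 := xiD_mono h.hβ am.1 hab bm.2
    have m1 : ER β (Z * η) y ≤ ER β y y := ER_mono (by nlinarith) y
    have m2 := mul_le_mul_of_nonneg_left m1 (sub_nonneg.2 x0)
    have m3 : (KK β + 1) * (Z * ∫ v in a..b, |distF μ v - distF ν v|) ≤ (KK β + 1) * (Z * y) := by
      have : η ≤ y := by nlinarith
      have := c1.trans this
      gcongr
    simp only [herr]
    rw [abs_le] at sa sb g ⊢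
    constructor <;> linarith [sa.1, sa.2, sb.1, sb.2, g.1, g.2]
  have lim : Tendsto err (𝓝[>] 0) (𝓝 0) := by
    have := ec.tendsto 0
    rw [e0] at this
    exact this.mono_left nhdsWithin_le_nhds
  have : |G| ≤ 0 := ge_of_tendsto lim (by filter_upwards [self_mem_nhdsWithin] with y hy using key y hy)
  exact abs_eq_zero.1 (le_antisymm this (abs_nonneg _))

lemma SD.final (h : SD P β Φ B 𝓕 μ s t x X) : 
    (∀ r ∈ Icc s t, StronglyMeasurable[𝓕 r] fun ω =>
      iteratedDeriv 2 (Φ μ r) (X r ω)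
        + ∫ v in s..r, distF μ v * zetaFn β v * (iteratedDeriv 2 (Φ μ v) (X v ω)) ^ 2) ∧
    (∀ r ∈ Icc s t, Integrable (fun ω =>
      iteratedDeriv 2 (Φ μ r) (X r ω)
        + ∫ v in s..r, distF μ v * zetaFn β v * (iteratedDeriv 2 (Φ μ v) (X v ω)) ^ 2) P) ∧
    (∀ a b : ℝ, s ≤ a → a ≤ b → b ≤ t →
      P[(fun ω => iteratedDeriv 2 (Φ μ b) (X b ω)
          + ∫ v in s..b, distF μ v * zetaFn β v * (iteratedDeriv 2 (Φ μ v) (X v ω)) ^ 2)|𝓕 a]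
        =ᵐ[P] fun ω => iteratedDeriv 2 (Φ μ a) (X a ω)
          + ∫ v in s..a, distF μ v * zetaFn β v * (iteratedDeriv 2 (Φ μ v) (X v ω)) ^ 2) ∧
    (∀ a b : ℝ, s ≤ a → a ≤ b → b ≤ t →
      (∫ ω, (iteratedDeriv 2 (Φ μ b) (X b ω) - iteratedDeriv 2 (Φ μ a) (X a ω)) ∂P)
        = - ∫ ω, (∫ r in a..b,
            distF μ r * zetaFn β r * (iteratedDeriv 2 (Φ μ r) (X r ω)) ^ 2) ∂P) := by
  have QQ : ∀ r ∈ Icc s t, QD (KK β) (Φ μ r) := fun r hr =>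
    Phi_QD h.hβ h.hΦ h.hμ ⟨h.hs.trans hr.1, hr.2.trans h.ht⟩
  have c1 : ∀ r ∈ Icc s t, StronglyMeasurable[𝓕 r] fun ω =>
      iteratedDeriv 2 (Φ μ r) (X r ω)
        + ∫ v in s..r, distF μ v * zetaFn β v * (iteratedDeriv 2 (Φ μ v) (X v ω)) ^ 2 := fun r hr =>
    StronglyMeasurable.add ((QQ r hr).c2.comp_stronglyMeasurable (h.hXadap r hr)) (h.drift_sm le_rfl hr.1 hr.2)
  have c2 : ∀ r ∈ Icc s t, Integrable (fun ω =>
      iteratedDeriv 2 (Φ μ r) (X r ω)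
        + ∫ v in s..r, distF μ v * zetaFn β v * (iteratedDeriv 2 (Φ μ v) (X v ω)) ^ 2) P := fun r hr =>
    (h.f_int (QQ r hr) hr).add (h.drift_int le_rfl hr.1 hr.2)
  refine ⟨c1, c2, fun a b hsa hab hbt => ?_, fun a b hsa hab hbt => ?_⟩
  · have ha : a ∈ Icc s t := ⟨hsa, hab.trans hbt⟩
    have hb : b ∈ Icc s t := ⟨hsa.trans hab, hbt⟩
    refine (ae_eq_condExp_of_forall_setIntegral_eq (𝓕.le a) (c2 b hb) (fun A _ _ => (c2 a ha).integrableOn)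
      (fun A hA _ => ?_) (c1 a ha).aestronglyMeasurable).symm
    have m := h.main hsa hab hbt hA
    have i1 := h.f_int (QQ a ha) ha
    have i2 := h.f_int (QQ b hb) hb
    have d1 := h.drift_int le_rfl hsa (hab.trans hbt)
    have d2 := h.drift_int hsa hab hbt
    rw [int_sub_add i2 i1 d2] at m
    rw [integral_add i1.integrableOn d1.integrableOn,
      integral_add i2.integrableOn (h.drift_int le_rfl (hsa.trans hab) hbt).integrableOn,
      h.drift_add_int le_rfl hsa hab hbt A]
    linarith
  · have ha : a ∈ Icc s t := ⟨hsa, hab.trans hbt⟩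
    have hb : b ∈ Icc s t := ⟨hsa.trans hab, hbt⟩
    have m := h.main hsa hab hbt (A := univ) MeasurableSet.univ
    have i1 := h.f_int (QQ a ha) ha
    have i2 := h.f_int (QQ b hb) hb
    have d2 := h.drift_int hsa hab hbt
    rw [int_sub_add i2 i1 d2] at m
    simp only [Measure.restrict_univ] at m
    rw [integral_sub i2 i1]
    linarith

end

end Parisi

end

/-- **Lemma 2, equation (17).** Along the SDE solution `X`, the process
`r ↦ ∂ₓₓΦ_μ(r, X(r)) + ∫_s^r α ζ (∂ₓₓΦ_μ(v, X(v)))² dv` is a continuous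
`(𝓕_r)`-martingale on `[s,t]`; in particular, for `s ≤ a ≤ b ≤ t`,
`E[∂ₓₓΦ_μ(b,X(b)) - ∂ₓₓΦ_μ(a,X(a))] = -E[∫_a^b α ζ (∂ₓₓΦ_μ(r,X(r)))² dr]`. -/
theorem stmt19 {Ω : Type*} [mΩ : MeasurableSpace Ω] (P : Measure Ω) [IsProbabilityMeasure P]
    (β : ℕ → ℝ) (hβ : ValidBeta β)
    (Φ : Measure ℝ → ℝ → ℝ → ℝ) (hΦ : IsParisiFamily β Φ)
    (B : ℝ → Ω → ℝ) (hB : IsStdBM P B)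
    (𝓕 : Filtration ℝ mΩ)
    (h𝓕 : ∀ r : ℝ, (𝓕 r : MeasurableSpace Ω)
      = ⨆ v ∈ Icc (0 : ℝ) r, MeasurableSpace.comap (fun ω => B (xiD β v) ω) inferInstance)
    (μ : Measure ℝ) (hμ : MemM μ)
    (s t : ℝ) (hs : 0 ≤ s) (hst : s ≤ t) (ht : t ≤ 1) (x : ℝ)
    (X : ℝ → Ω → ℝ)
    (hXcont : ∀ ω, ContinuousOn (fun r => X r ω) (Icc s t))
    (hXadap : ∀ r ∈ Icc s t, StronglyMeasurable[𝓕 r] (X r))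
    (hX : ∀ ω, ∀ r ∈ Icc s t, X r ω
      = x + (∫ v in s..r, distF μ v * zetaFn β v * deriv (Φ μ v) (X v ω))
          + (B (xiD β r) ω - B (xiD β s) ω)) :
    (∀ r ∈ Icc s t, StronglyMeasurable[𝓕 r] fun ω =>
      iteratedDeriv 2 (Φ μ r) (X r ω)
        + ∫ v in s..r, distF μ v * zetaFn β v * (iteratedDeriv 2 (Φ μ v) (X v ω)) ^ 2) ∧
    (∀ r ∈ Icc s t, Integrable (fun ω =>
      iteratedDeriv 2 (Φ μ r) (X r ω)
        + ∫ v in s..r, distF μ v * zetaFn β v * (iteratedDeriv 2 (Φ μ v) (X v ω)) ^ 2) P) ∧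
    (∀ a b : ℝ, s ≤ a → a ≤ b → b ≤ t →
      P[(fun ω => iteratedDeriv 2 (Φ μ b) (X b ω)
          + ∫ v in s..b, distF μ v * zetaFn β v * (iteratedDeriv 2 (Φ μ v) (X v ω)) ^ 2)|𝓕 a]
        =ᵐ[P] fun ω => iteratedDeriv 2 (Φ μ a) (X a ω)
          + ∫ v in s..a, distF μ v * zetaFn β v * (iteratedDeriv 2 (Φ μ v) (X v ω)) ^ 2) ∧
    (∀ a b : ℝ, s ≤ a → a ≤ b → b ≤ t →
      (∫ ω, (iteratedDeriv 2 (Φ μ b) (X b ω) - iteratedDeriv 2 (Φ μ a) (X a ω)) ∂P)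
        = - ∫ ω, (∫ r in a..b,
            distF μ r * zetaFn β r * (iteratedDeriv 2 (Φ μ r) (X r ω)) ^ 2) ∂P) := by
  exact Parisi.SD.final (⟨hβ, hΦ, hB, h𝓕, hμ, hs, hst, ht, hXcont, hXadap, hX⟩ : Parisi.SD P β Φ B 𝓕 μ s t x X)

end
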